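/- For every graph H: H has no minor isomorphic to K_4, K_{2,3}, C_{3,2}, or A if and only if g(H) ≤ 2. -/

import Mathlib

/-!
Common definitions: minors, widths, connectivity, the specific graphs
`K4`, `K23`, `C32`, `graphA`, the binary trees `CT_h`, the graphs `𝒫_k`, `𝒬_k`,
the trees `T_h`, homeomorphic embeddings, cascades, and related notions,
following Dang--Thomas, "Minors of two-connected graphs of large path-width".
-/

open SimpleGraph

/-- A minor model of `H` in `G`: branch sets `f w` are nonempty, connected,
pairwise disjoint, and edges of `H` are realized by edges of `G` between branch sets. -/
def IsMinorModel {W V : Type*} (H : SimpleGraph W) (G : SimpleGraph V) (f : W → Set V) : Prop :=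
  (∀ w, (f w).Nonempty) ∧
  (∀ w, (G.induce (f w)).Connected) ∧
  (∀ w₁ w₂ : W, w₁ ≠ w₂ → Disjoint (f w₁) (f w₂)) ∧
  (∀ w₁ w₂ : W, H.Adj w₁ w₂ → ∃ v₁ ∈ f w₁, ∃ v₂ ∈ f w₂, G.Adj v₁ v₂)

/-- `H` is (isomorphic to) a minor of `G`. -/
def IsMinor {W V : Type*} (H : SimpleGraph W) (G : SimpleGraph V) : Prop :=
  ∃ f : W → Set V, IsMinorModel H G f

/-- The complete graph on four vertices. -/
def K4 : SimpleGraph (Fin 4) := ⊤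

/-- The complete bipartite graph `K_{2,3}`. -/
def K23 : SimpleGraph (Fin 2 ⊕ Fin 3) := completeBipartiteGraph (Fin 2) (Fin 3)

/-- The graph `A`: a cycle `a₁a₂a₃a₄a₅a₆a₁` plus the edges `a₁a₃`, `a₃a₅`, `a₅a₁`. -/
def graphA : SimpleGraph (Fin 6) :=
  SimpleGraph.fromEdgeSet
    {s(0, 1), s(1, 2), s(2, 3), s(3, 4), s(4, 5), s(5, 0), s(0, 2), s(2, 4), s(4, 0)}

/-- The graph `C_{3,2}`: two disjoint triangles. -/
def C32 : SimpleGraph (Fin 2 × Fin 3) :=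
  SimpleGraph.fromRel (fun u v => u.1 = v.1)

/-- A graph is outerplanar iff it has no `K₄` minor and no `K_{2,3}` minor
(the classical characterization of outerplanarity). -/
def Outerplanar {V : Type*} (G : SimpleGraph V) : Prop :=
  ¬ IsMinor K4 G ∧ ¬ IsMinor K23 G

/-- `G` is `k`-connected: it has more than `k` vertices and deleting fewer than `k`
vertices leaves a connected graph. -/
def IsKConnected {V : Type*} [Fintype V] (k : ℕ) (G : SimpleGraph V) : Prop :=
  k + 1 ≤ Fintype.card V ∧
  ∀ S : Finset V, S.card < k → (G.induce ((↑S : Set V)ᶜ)).Connected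

/-- `(Tr, X)` is a tree-decomposition of `G`: `Tr` is a tree, the bags `X t` cover all
vertices and edges (W1), and whenever `t₂` lies on the path of `Tr` between `t₁` and `t₃`
we have `X t₁ ∩ X t₃ ⊆ X t₂` (W2). -/
def IsTreeDecomp {V T : Type*} (G : SimpleGraph V) (Tr : SimpleGraph T) (X : T → Finset V) :
    Prop :=
  Tr.IsTree ∧
  (∀ v : V, ∃ t, v ∈ X t) ∧
  (∀ u v : V, G.Adj u v → ∃ t, u ∈ X t ∧ v ∈ X t) ∧
  (∀ (t₁ t₂ t₃ : T) (p : Tr.Walk t₁ t₃), p.IsPath → t₂ ∈ p.support →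
    ∀ v : V, v ∈ X t₁ → v ∈ X t₃ → v ∈ X t₂)

/-- A path-decomposition of `G`, with bags indexed by `Fin n`. -/
def IsPathDecomp {V : Type*} (G : SimpleGraph V) {n : ℕ} (X : Fin n → Finset V) : Prop :=
  (∀ v : V, ∃ i, v ∈ X i) ∧
  (∀ u v : V, G.Adj u v → ∃ i, u ∈ X i ∧ v ∈ X i) ∧
  (∀ i j k : Fin n, i ≤ j → j ≤ k → ∀ v : V, v ∈ X i → v ∈ X k → v ∈ X j)

/-- The path-width of a finite graph: the least `w` such that `G` has a
path-decomposition all of whose bags have at most `w + 1` vertices. -/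
noncomputable def pathwidth {V : Type*} [Fintype V] (G : SimpleGraph V) : ℕ :=
  sInf {w | ∃ (n : ℕ) (X : Fin n → Finset V), IsPathDecomp G X ∧ ∀ i, (X i).card ≤ w + 1}

/-- The tree-width of a finite graph: the least `w` such that `G` has a
tree-decomposition all of whose bags have at most `w + 1` vertices. -/
noncomputable def treewidth {V : Type*} [Fintype V] (G : SimpleGraph V) : ℕ :=
  sInf {w | ∃ (T : Type) (_ : Fintype T) (Tr : SimpleGraph T) (X : T → Finset V),
    IsTreeDecomp G Tr X ∧ ∀ t, (X t).card ≤ w + 1}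

/-- Vertices of the binary tree `CT_h`: paths from the root, recorded as reversed
lists of left/right moves, of length at most `h`. -/
abbrev CTVert (h : ℕ) := {l : List Bool // l.length ≤ h}

/-- The binary tree `CT_h` of height `h`. -/
def CTgraph (h : ℕ) : SimpleGraph (CTVert h) :=
  SimpleGraph.fromEdgeSet
    {e | ∃ (b : Bool) (σ : List Bool) (hσ : σ.length < h),
      e = s((⟨σ, le_of_lt hσ⟩ : CTVert h), (⟨b :: σ, by simpa using hσ⟩ : CTVert h))}

/-- The graph `𝒫_k`: the binary tree `CT_k` together with one extra vertex (`none`)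
adjacent to every leaf of `CT_k`. -/
def Pgraph (k : ℕ) : SimpleGraph (Option (CTVert k)) :=
  SimpleGraph.fromEdgeSet
    ({e | ∃ (b : Bool) (σ : List Bool) (hσ : σ.length < k),
        e = s(some (⟨σ, le_of_lt hσ⟩ : CTVert k), some (⟨b :: σ, by simpa using hσ⟩ : CTVert k))} ∪
     {e | ∃ l : CTVert k, l.1.length = k ∧ e = s(none, some l)})

/-- Vertices of `𝒬_k`: the two base vertices of the root triangle (`Sum.inl false` and
`Sum.inl true`), together with one apex vertex for each node of the complete binary tree
of depth `< k` (recorded as a reversed list of moves). -/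
abbrev QVert (k : ℕ) := Bool ⊕ {l : List Bool // l.length < k}

/-- The two ends of the base edge of the copy of the triangle at node `σ` of `𝒬_k`. -/
def qbase (k : ℕ) : List Bool → QVert k × QVert k
  | [] => (Sum.inl false, Sum.inl true)
  | b :: σ =>
      ((if b then (qbase k σ).2 else (qbase k σ).1),
        if h : σ.length < k then Sum.inr ⟨σ, h⟩ else Sum.inl false)

/-- The graph `𝒬_k`, built from triangles as in the recursive definition: the triangle at
node `σ` consists of the base edge `qbase k σ` together with the apex vertex `Sum.inr σ`;
the base edge of `𝒬_k` is `s(Sum.inl false, Sum.inl true)`. -/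
def Qgraph (k : ℕ) : SimpleGraph (QVert k) :=
  SimpleGraph.fromEdgeSet
    ({s(Sum.inl false, Sum.inl true)} ∪
     {e | ∃ (σ : List Bool) (h : σ.length < k),
        e = s(Sum.inr ⟨σ, h⟩, (qbase k σ).1) ∨ e = s(Sum.inr ⟨σ, h⟩, (qbase k σ).2)})

/-- The minor vertices of the tree `T_h` (one for each string of length `≤ h`). -/
abbrev MVert (h : ℕ) := {l : List Bool // l.length ≤ h}

/-- The major vertices of the tree `T_h` (one for each string of length `≤ h - 1`). -/
abbrev JVert (h : ℕ) := {l : List Bool // l.length + 1 ≤ h}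

/-- Vertices of the tree `T_h` (obtained from `CT_h` by subdividing every edge not incident
with a degree-one vertex and adding the minor root). -/
abbrev TVert (h : ℕ) := MVert h ⊕ JVert h

/-- The tree `T_h`: each major vertex `σ` is adjacent to the minor vertices `σ` (its parent),
`false :: σ` (its left neighbor) and `true :: σ` (its right neighbor). -/
def Tgraph (h : ℕ) : SimpleGraph (TVert h) :=
  SimpleGraph.fromEdgeSet
    {e | ∃ (σ : List Bool) (hσ : σ.length + 1 ≤ h),
      e = s(Sum.inr ⟨σ, hσ⟩, Sum.inl ⟨σ, Nat.le_of_succ_le hσ⟩) ∨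
      ∃ b : Bool, e = s(Sum.inr ⟨σ, hσ⟩, Sum.inl ⟨b :: σ, by simpa using hσ⟩)}

/-- A homeomorphic embedding of `TA` into `TB`: an injection such that for any two edges of
`TA` sharing an end `t`, the corresponding paths of `TB` are edge-disjoint. -/
def IsHomeoEmb {A B : Type*} (TA : SimpleGraph A) (TB : SimpleGraph B) (η : A → B) : Prop :=
  Function.Injective η ∧
  ∀ ⦃t t₁ t₂ : A⦄, TA.Adj t t₁ → TA.Adj t t₂ → t₁ ≠ t₂ →
    ∀ (p₁ : TB.Walk (η t) (η t₁)) (p₂ : TB.Walk (η t) (η t₂)),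
      p₁.IsPath → p₂.IsPath → ∀ e ∈ p₁.edges, e ∉ p₂.edges

/-- `v` lies in the span of `η`: it lies on a path of `TB` between two vertices in the
image of `η`. -/
def inSpan {A B : Type*} (TB : SimpleGraph B) (η : A → B) (v : B) : Prop :=
  ∃ (a₁ a₂ : A) (p : TB.Walk (η a₁) (η a₂)), p.IsPath ∧ v ∈ p.support

/-- A cascade of height `h` and size `s` in the tree-decomposition `(Tr, X)`:
a homeomorphic embedding of `T_h` with `|X (η t)| = s` for every minor vertex `t`
and `|X t| ≥ s` for every `t` in the span. -/
def IsCascade {V T : Type*} (Tr : SimpleGraph T) (X : T → Finset V) (h s : ℕ)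
    (η : TVert h → T) : Prop :=
  IsHomeoEmb (Tgraph h) Tr η ∧
  (∀ l : MVert h, (X (η (Sum.inl l))).card = s) ∧
  (∀ t : T, inSpan Tr η t → s ≤ (X t).card)

/-- An injective cascade with common intersection set `I`. -/
def IsInjectiveCascade {V T : Type*} (Tr : SimpleGraph T) (X : T → Finset V) (h s : ℕ)
    (η : TVert h → T) (I : Finset V) : Prop :=
  IsCascade Tr X h s η ∧ I.card < s ∧
  ∀ t t' : TVert h, t ≠ t' → ((X (η t) : Set V) ∩ (X (η t') : Set V)) = (I : Set V)

/-- A family of `s` disjoint paths in `G \ I` (a linkage). -/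
def IsLinkage {V : Type*} (G : SimpleGraph V) (I : Finset V) {s : ℕ} {x y : Fin s → V}
    (P : ∀ i : Fin s, G.Walk (x i) (y i)) : Prop :=
  (∀ i, (P i).IsPath) ∧
  (∀ i, ∀ v ∈ (P i).support, v ∉ I) ∧
  (∀ i j, i ≠ j → ∀ v ∈ (P i).support, v ∉ (P j).support)

/-- An ordered cascade: an injective cascade of size `s + |I|` with common intersection set
`I`, together with orderings `ξ t : Fin s → X (η t) \ I` of the bags at minor vertices, such
that at every major vertex there are left and right linkages connecting corresponding
vertices. -/
def IsOrderedCascade {V T : Type*} (G : SimpleGraph V) (Tr : SimpleGraph T)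
    (X : T → Finset V) (h s : ℕ) (η : TVert h → T) (I : Finset V)
    (ξ : MVert h → Fin s → V) : Prop :=
  IsInjectiveCascade Tr X h (s + I.card) η I ∧
  (∀ t : MVert h, Function.Injective (ξ t) ∧
    Set.range (ξ t) = (X (η (Sum.inl t)) : Set V) \ (I : Set V)) ∧
  ∀ (σ : List Bool) (hσ : σ.length + 1 ≤ h),
    (∃ P : ∀ i : Fin s,
        G.Walk (ξ ⟨σ, Nat.le_of_succ_le hσ⟩ i) (ξ ⟨false :: σ, by simpa using hσ⟩ i),
      IsLinkage G I P) ∧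
    (∃ Q : ∀ i : Fin s,
        G.Walk (ξ ⟨σ, Nat.le_of_succ_le hσ⟩ i) (ξ ⟨true :: σ, by simpa using hσ⟩ i),
      IsLinkage G I Q)

/-- The vertex set of the `η`-torso at the major vertex `σ` of `T_h`: the union of the bags
`X t - I` over all `t` such that the path in `Tr` from `t` to `η σ` contains none of the
images of the three minor neighbors of `σ` as an internal vertex. -/
def torsoSet {V T : Type*} (Tr : SimpleGraph T) (X : T → Finset V) {h : ℕ}
    (η : TVert h → T) (I : Finset V) (σ : List Bool) (hσ : σ.length + 1 ≤ h) : Set V :=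
  {v | v ∉ I ∧ ∃ t : T,
    (∀ p : Tr.Walk t (η (Sum.inr ⟨σ, hσ⟩)), p.IsPath →
      ∀ u : T,
        (u = η (Sum.inl ⟨σ, Nat.le_of_succ_le hσ⟩) ∨
         u = η (Sum.inl ⟨false :: σ, by simpa using hσ⟩) ∨
         u = η (Sum.inl ⟨true :: σ, by simpa using hσ⟩)) →
        u ∈ p.support → u = t ∨ u = η (Sum.inr ⟨σ, hσ⟩)) ∧
    v ∈ X t}

/-- `H` is a tripod in `G` with all vertices in `S`, center `c` and feet `f₁, f₂, f₃`:
the union of three paths from `c` to the feet, pairwise disjoint except for `c`,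
at least two of which have length at least one. -/
def IsTripodOn {V : Type*} (G : SimpleGraph V) (S : Set V) (H : G.Subgraph)
    (c f₁ f₂ f₃ : V) : Prop :=
  ∃ (W₁ : G.Walk c f₁) (W₂ : G.Walk c f₂) (W₃ : G.Walk c f₃),
    W₁.IsPath ∧ W₂.IsPath ∧ W₃.IsPath ∧
    (∀ v ∈ W₁.support, v ∈ S) ∧ (∀ v ∈ W₂.support, v ∈ S) ∧ (∀ v ∈ W₃.support, v ∈ S) ∧
    (∀ v, v ∈ W₁.support → v ∈ W₂.support → v = c) ∧
    (∀ v, v ∈ W₁.support → v ∈ W₃.support → v = c) ∧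
    (∀ v, v ∈ W₂.support → v ∈ W₃.support → v = c) ∧
    ((1 ≤ W₁.length ∧ 1 ≤ W₂.length) ∨ (1 ≤ W₁.length ∧ 1 ≤ W₃.length) ∨
      (1 ≤ W₂.length ∧ 1 ≤ W₃.length)) ∧
    H = W₁.toSubgraph ⊔ W₂.toSubgraph ⊔ W₃.toSubgraph

/-- The major vertex `σ` has property `A_{ij}` in the ordered cascade `η` with orderings
`ξ`: there are two disjoint tripods in the `η`-torso at `σ`, with feet as prescribed. -/
def HasPropA {V T : Type*} (G : SimpleGraph V) (Tr : SimpleGraph T) (X : T → Finset V)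
    {h s : ℕ} (η : TVert h → T) (I : Finset V) (ξ : MVert h → Fin s → V)
    (σ : List Bool) (hσ : σ.length + 1 ≤ h) (i j : Fin s) : Prop :=
  ∃ (Li Lj : G.Subgraph) (ci cj : V),
    (∃ m₂ m₃ : Fin s, (m₂ = i ∨ m₂ = j) ∧ (m₃ = i ∨ m₃ = j) ∧
      IsTripodOn G (torsoSet Tr X η I σ hσ) Li ci
        (ξ ⟨σ, Nat.le_of_succ_le hσ⟩ i)
        (ξ ⟨false :: σ, by simpa using hσ⟩ m₂)
        (ξ ⟨true :: σ, by simpa using hσ⟩ m₃)) ∧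
    (∃ m₂ m₃ : Fin s, (m₂ = i ∨ m₂ = j) ∧ (m₃ = i ∨ m₃ = j) ∧
      IsTripodOn G (torsoSet Tr X η I σ hσ) Lj cj
        (ξ ⟨σ, Nat.le_of_succ_le hσ⟩ j)
        (ξ ⟨false :: σ, by simpa using hσ⟩ m₂)
        (ξ ⟨true :: σ, by simpa using hσ⟩ m₃)) ∧
    Disjoint Li.verts Lj.verts

/-- The major vertex `σ` has property `B_{ij}`: there are two tripods `L_i`, `L_j` in the
`η`-torso at `σ`, with feet `v_{m,1}, v_{m,2}, v_{m,3}` where `{v_{i,y}, v_{j,y}}` equals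
`{ξ_{t_y} i, ξ_{t_y} j}` for each `y`, which intersect exactly in a path that is the
intersection of the branch of `L_i` to `v_{i,3}` and the branch of `L_j` to `v_{j,2}`,
and which avoids both centers. -/
def HasPropB {V T : Type*} (G : SimpleGraph V) (Tr : SimpleGraph T) (X : T → Finset V)
    {h s : ℕ} (η : TVert h → T) (I : Finset V) (ξ : MVert h → Fin s → V)
    (σ : List Bool) (hσ : σ.length + 1 ≤ h) (i j : Fin s) : Prop :=
  ∃ (vi vj : Fin 3 → V) (ci cj : V)
    (Wi : ∀ y : Fin 3, G.Walk ci (vi y)) (Wj : ∀ y : Fin 3, G.Walk cj (vj y)),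
    (∀ y : Fin 3, ({vi y, vj y} : Set V) =
      {(![ξ ⟨σ, Nat.le_of_succ_le hσ⟩,
          ξ ⟨false :: σ, by simpa using hσ⟩,
          ξ ⟨true :: σ, by simpa using hσ⟩] : Fin 3 → Fin s → V) y i,
       (![ξ ⟨σ, Nat.le_of_succ_le hσ⟩,
          ξ ⟨false :: σ, by simpa using hσ⟩,
          ξ ⟨true :: σ, by simpa using hσ⟩] : Fin 3 → Fin s → V) y j}) ∧
    (∀ y, (Wi y).IsPath) ∧ (∀ y, (Wj y).IsPath) ∧
    (∀ y, ∀ v ∈ (Wi y).support, v ∈ torsoSet Tr X η I σ hσ) ∧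
    (∀ y, ∀ v ∈ (Wj y).support, v ∈ torsoSet Tr X η I σ hσ) ∧
    (∀ y y' : Fin 3, y ≠ y' → ∀ v, v ∈ (Wi y).support → v ∈ (Wi y').support → v = ci) ∧
    (∀ y y' : Fin 3, y ≠ y' → ∀ v, v ∈ (Wj y).support → v ∈ (Wj y').support → v = cj) ∧
    ((1 ≤ (Wi 0).length ∧ 1 ≤ (Wi 1).length) ∨ (1 ≤ (Wi 0).length ∧ 1 ≤ (Wi 2).length) ∨
      (1 ≤ (Wi 1).length ∧ 1 ≤ (Wi 2).length)) ∧
    ((1 ≤ (Wj 0).length ∧ 1 ≤ (Wj 1).length) ∨ (1 ≤ (Wj 0).length ∧ 1 ≤ (Wj 2).length) ∨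
      (1 ≤ (Wj 1).length ∧ 1 ≤ (Wj 2).length)) ∧
    (((Wi 0).toSubgraph ⊔ (Wi 1).toSubgraph ⊔ (Wi 2).toSubgraph) ⊓
      ((Wj 0).toSubgraph ⊔ (Wj 1).toSubgraph ⊔ (Wj 2).toSubgraph)
        = (Wi 2).toSubgraph ⊓ (Wj 1).toSubgraph) ∧
    ∃ (x y : V) (p : G.Walk x y), p.IsPath ∧
      (Wi 2).toSubgraph ⊓ (Wj 1).toSubgraph = p.toSubgraph ∧
      ci ∉ p.support ∧ cj ∉ p.support

/-- The major vertex `σ` has property `AB_{ij}`: in the `η`-torso at `σ` there are disjoint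
paths `L_i, L_j` from `ξ_{t₁}(m)` to `ξ_{t₂}(m)` and disjoint paths `R_i, R_j` from
`ξ_{t₁}(m)` to `ξ_{t₃}(m)`, for `m ∈ {i, j}`. -/
def HasPropAB {V T : Type*} (G : SimpleGraph V) (Tr : SimpleGraph T) (X : T → Finset V)
    {h s : ℕ} (η : TVert h → T) (I : Finset V) (ξ : MVert h → Fin s → V)
    (σ : List Bool) (hσ : σ.length + 1 ≤ h) (i j : Fin s) : Prop :=
  ∃ (Li : G.Walk (ξ ⟨σ, Nat.le_of_succ_le hσ⟩ i) (ξ ⟨false :: σ, by simpa using hσ⟩ i))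
    (Lj : G.Walk (ξ ⟨σ, Nat.le_of_succ_le hσ⟩ j) (ξ ⟨false :: σ, by simpa using hσ⟩ j))
    (Ri : G.Walk (ξ ⟨σ, Nat.le_of_succ_le hσ⟩ i) (ξ ⟨true :: σ, by simpa using hσ⟩ i))
    (Rj : G.Walk (ξ ⟨σ, Nat.le_of_succ_le hσ⟩ j) (ξ ⟨true :: σ, by simpa using hσ⟩ j)),
    Li.IsPath ∧ Lj.IsPath ∧ Ri.IsPath ∧ Rj.IsPath ∧
    (∀ v ∈ Li.support, v ∈ torsoSet Tr X η I σ hσ) ∧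
    (∀ v ∈ Lj.support, v ∈ torsoSet Tr X η I σ hσ) ∧
    (∀ v ∈ Ri.support, v ∈ torsoSet Tr X η I σ hσ) ∧
    (∀ v ∈ Rj.support, v ∈ torsoSet Tr X η I σ hσ) ∧
    (∀ v ∈ Li.support, v ∉ Lj.support) ∧
    (∀ v ∈ Ri.support, v ∉ Rj.support)

/-- A monotone homeomorphic embedding `T_a ↪ T_h`: the minor root maps to the minor root,
and for every major vertex with trinity `(t₁, t₂, t₃)`, the images of `t₂` and `t₃` are the
left and right neighbors of the (major) image of the vertex. -/
def IsMonotoneEmb (a h : ℕ) (γ : TVert a → TVert h) : Prop :=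
  IsHomeoEmb (Tgraph a) (Tgraph h) γ ∧
  γ (Sum.inl ⟨[], Nat.zero_le a⟩) = Sum.inl ⟨[], Nat.zero_le h⟩ ∧
  ∀ (σ : List Bool) (hσ : σ.length + 1 ≤ a),
    ∃ (τ : List Bool) (hτ : τ.length + 1 ≤ h),
      γ (Sum.inr ⟨σ, hσ⟩) = Sum.inr ⟨τ, hτ⟩ ∧
      γ (Sum.inl ⟨false :: σ, by simpa using hσ⟩) = Sum.inl ⟨false :: τ, by simpa using hτ⟩ ∧
      γ (Sum.inl ⟨true :: σ, by simpa using hσ⟩) = Sum.inl ⟨true :: τ, by simpa using hτ⟩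

/-- `g(H) ≤ g` holds for a particular value `g` if there is a positive integer `p` such
that every `g`-connected graph with no `H` minor has path-width at most `p`. -/
def gProperty {W : Type} (H : SimpleGraph W) (g : ℕ) : Prop :=
  ∃ p : ℕ, 0 < p ∧ ∀ (V : Type) [Fintype V] (G : SimpleGraph V),
    IsKConnected g G → ¬ IsMinor H G → pathwidth G ≤ p


/-! Basics on connected sets -/

def Cn {V : Type*} (G : SimpleGraph V) (s : Set V) : Prop := (G.induce s).Connected

def Tch {V : Type*} (G : SimpleGraph V) (A B : Set V) : Prop := ∃ a ∈ A, ∃ b ∈ B, G.Adj a b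

section basics
variable {V : Type*} {G : SimpleGraph V}

theorem Tch.symm {A B : Set V} (h : Tch G A B) : Tch G B A := by
  obtain ⟨a, ha, b, hb, e⟩ := h
  exact ⟨b, hb, a, ha, e.symm⟩

theorem Tch.mono {A B A' B' : Set V} (h : Tch G A B) (h1 : A ⊆ A') (h2 : B ⊆ B') :
    Tch G A' B' := by
  obtain ⟨a, ha, b, hb, e⟩ := h
  exact ⟨a, h1 ha, b, h2 hb, e⟩

theorem Cn.nonempty {s : Set V} (h : Cn G s) : s.Nonempty := by
  obtain ⟨x⟩ := Connected.nonempty h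
  exact ⟨x.1, x.2⟩

theorem Cn.cut {s : Set V} (h : Cn G s) {T : Set V} (h1 : (s ∩ T).Nonempty)
    (h2 : (s \ T).Nonempty) : Tch G (s ∩ T) (s \ T) := by
  obtain ⟨a, ha, haT⟩ := h1
  obtain ⟨b, hb, hbT⟩ := h2
  obtain ⟨w⟩ := h.preconnected ⟨a, ha⟩ ⟨b, hb⟩
  obtain ⟨d, _, hd1, hd2⟩ := w.exists_boundary_dart {x : s | x.1 ∈ T} haT hbT
  exact ⟨d.fst.1, ⟨d.fst.2, hd1⟩, d.snd.1, ⟨d.snd.2, hd2⟩, d.adj⟩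

theorem cn_of_cut {s : Set V} (h0 : s.Nonempty) (h : ∀ T ⊆ s, T.Nonempty → (s \ T).Nonempty →
    Tch G T (s \ T)) : Cn G s := by
  obtain ⟨a, ha⟩ := h0
  have : Nonempty s := ⟨⟨a, ha⟩⟩
  refine (connected_iff_exists_forall_reachable _).2 ⟨⟨a, ha⟩, ?_⟩
  by_contra hcon
  push Not at hcon
  obtain ⟨⟨b, hb⟩, hab⟩ := hcon
  obtain ⟨x, hx, y, hy, e⟩ := h {v | ∃ hv : v ∈ s, (G.induce s).Reachable ⟨a, ha⟩ ⟨v, hv⟩}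
    (fun v hv => hv.1) ⟨a, ha, Reachable.refl _⟩ ⟨b, hb, fun hh => hab hh.2⟩
  obtain ⟨hxs, hxr⟩ := hx
  exact hy.2 ⟨hy.1, hxr.trans (Adj.reachable (by simpa using e))⟩

/-- weaker version: only sets containing a given vertex -/
theorem cn_of_cut_at {s : Set V} {x : V} (h0 : x ∈ s) (h : ∀ T ⊆ s, x ∈ T → (s \ T).Nonempty →
    Tch G T (s \ T)) : Cn G s := by
  refine cn_of_cut ⟨x, h0⟩ fun T hT hTn hTc => ?_
  by_cases hx : x ∈ T
  · exact h T hT hx hTc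
  · have := h (s \ T) Set.sdiff_subset ⟨h0, hx⟩ (by rwa [Set.sdiff_sdiff_cancel_left hT])
    rw [Set.sdiff_sdiff_cancel_left hT] at this
    exact this.symm

theorem cn_of_all {s : Set V} {x : V} (h0 : x ∈ s)
    (h : ∀ y ∈ s, ∃ C ⊆ s, x ∈ C ∧ y ∈ C ∧ Cn G C) : Cn G s := by
  refine cn_of_cut_at h0 fun T hT hx ⟨y, hy, hyT⟩ => ?_
  obtain ⟨C, hC, hxC, hyC, hc⟩ := h y hy
  exact (hc.cut ⟨x, hxC, hx⟩ ⟨y, hyC, hyT⟩).mono Set.inter_subset_right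
    (Set.sdiff_subset_sdiff_left hC)

theorem cn_singleton (x : V) : Cn G {x} := by
  refine cn_of_cut_at (x := x) rfl fun T _ hx ⟨y, hy, hyT⟩ => ?_
  rw [Set.mem_singleton_iff] at hy
  subst hy
  exact absurd hx hyT

theorem Cn.union_inter {s t : Set V} (hs : Cn G s) (ht : Cn G t) (h : (s ∩ t).Nonempty) :
    Cn G (s ∪ t) := by
  obtain ⟨x, hx1, hx2⟩ := h
  refine cn_of_all (x := x) (Or.inl hx1) ?_
  rintro y (hy | hy)
  · exact ⟨s, Set.subset_union_left, hx1, hy, hs⟩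
  · exact ⟨t, Set.subset_union_right, hx2, hy, ht⟩

theorem cn_pair {x y : V} (h : G.Adj x y) : Cn G {x, y} := by
  refine cn_of_cut_at (x := x) (by simp) fun T hT hx ⟨z, hz, hzT⟩ => ?_
  rcases hz with rfl | hz
  · exact absurd hx hzT
  · rw [Set.mem_singleton_iff] at hz
    subst hz
    exact ⟨x, hx, z, ⟨by simp, hzT⟩, h⟩

theorem Cn.union {s t : Set V} (hs : Cn G s) (ht : Cn G t) (h : Tch G s t) :
    Cn G (s ∪ t) := by
  obtain ⟨a, ha, b, hb, e⟩ := h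
  have h1 := hs.union_inter (cn_pair e) ⟨a, ha, by simp⟩
  have h2 := h1.union_inter ht ⟨b, by simp, hb⟩
  convert h2 using 1
  ext z
  simp only [Set.mem_union, Set.mem_insert_iff, Set.mem_singleton_iff]
  constructor
  · rintro (h | h) <;> simp [h]
  · rintro ((h | rfl | rfl) | h) <;> simp [*]

theorem Cn.insert {s : Set V} {x : V} (hs : Cn G s) (h : Tch G s {x}) : Cn G (insert x s) := by
  have := hs.union (cn_singleton x) h
  rwa [Set.union_singleton] at this

theorem Cn.mono_graph {G' : SimpleGraph V} {s : Set V} (hs : Cn G s)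
    (h : ∀ a ∈ s, ∀ b ∈ s, G.Adj a b → G'.Adj a b) : Cn G' s := by
  refine cn_of_cut hs.nonempty fun T hT hn hc => ?_
  obtain ⟨a, ha, b, hb, e⟩ := hs.cut (T := T) (by rwa [Set.inter_eq_right.2 hT]) hc
  exact ⟨a, ha.2, b, hb, h a ha.1 b hb.1 e⟩

/-- union of a family of connected sets, pattern connected via an index graph -/
theorem cn_biUnion {ι : Type*} {K : SimpleGraph ι} {I : Set ι} {f : ι → Set V} (hI : Cn K I)
    (hf : ∀ i ∈ I, Cn G (f i)) (hK : ∀ i ∈ I, ∀ j ∈ I, K.Adj i j → Tch G (f i) (f j)) :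
    Cn G (⋃ i ∈ I, f i) := by
  obtain ⟨i0, hi0⟩ := hI.nonempty
  refine cn_of_cut ?_ fun T hT ⟨x, hx⟩ ⟨y, hy, hyT⟩ => ?_
  · obtain ⟨x, hx⟩ := (hf i0 hi0).nonempty
    exact ⟨x, Set.mem_biUnion hi0 hx⟩
  have hsub : ∀ i ∈ I, f i ⊆ ⋃ i ∈ I, f i := fun i hi => Set.subset_biUnion_of_mem hi
  by_cases hsplit : ∃ i ∈ I, (f i ∩ T).Nonempty ∧ (f i \ T).Nonempty
  · obtain ⟨i, hi, h1, h2⟩ := hsplit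
    exact ((hf i hi).cut h1 h2).mono Set.inter_subset_right (Set.sdiff_subset_sdiff_left (hsub i hi))
  push Not at hsplit
  have hall : ∀ i ∈ I, f i ⊆ T ∨ ∀ z ∈ f i, z ∉ T := by
    intro i hi
    by_cases hne : (f i ∩ T).Nonempty
    · left
      have := hsplit i hi hne
      rwa [Set.sdiff_eq_empty] at this
    · right
      intro z hz hzT
      exact hne ⟨z, hz, hzT⟩
  obtain ⟨i, hi, hxi⟩ := Set.mem_iUnion₂.1 (hT hx)
  obtain ⟨j, hj, hyj⟩ := Set.mem_iUnion₂.1 hy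
  obtain ⟨a, ⟨ha, haT⟩, b, ⟨hb, hbT⟩, e⟩ := hI.cut (T := {i | f i ⊆ T})
    ⟨i, hi, by
      rcases hall i hi with h | h
      · exact h
      · exact absurd hx (h x hxi)⟩
    ⟨j, hj, fun h => hyT (h hyj)⟩
  obtain ⟨p, hp, q, hq, e'⟩ := hK a ha b hb e
  refine ⟨p, haT hp, q, ⟨hsub b hb hq, ?_⟩, e'⟩
  rcases hall b hb with h | h
  · exact absurd h hbT
  · exact h q hq

/-- component of `x` in `s` -/
def cpt (G : SimpleGraph V) (s : Set V) (x : V) : Set V := {v | ∃ C ⊆ s, x ∈ C ∧ v ∈ C ∧ Cn G C}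

theorem cpt_sub {s : Set V} {x : V} : cpt G s x ⊆ s := fun _ ⟨_, hC, _, hv, _⟩ => hC hv

theorem mem_cpt {s : Set V} {x : V} (h : x ∈ s) : x ∈ cpt G s x :=
  ⟨{x}, by simpa using h, rfl, rfl, cn_singleton x⟩

theorem cpt_cn {s : Set V} {x : V} (h : x ∈ s) : Cn G (cpt G s x) := by
  refine cn_of_all (mem_cpt h) fun y ⟨C, hC, hx, hy, hc⟩ => ⟨C, ?_, hx, hy, hc⟩
  exact fun z hz => ⟨C, hC, hx, hz, hc⟩

theorem cpt_max {s D : Set V} {x : V} (hD : D ⊆ s) (hc : Cn G D)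
    (h : (D ∩ cpt G s x).Nonempty) : D ⊆ cpt G s x := by
  obtain ⟨y, hyD, C, hC, hx, hyC, hCc⟩ := h
  intro z hz
  exact ⟨C ∪ D, Set.union_subset hC hD, Or.inl hx, Or.inr hz, hCc.union_inter hc ⟨y, hyC, hyD⟩⟩

theorem cpt_closed {s : Set V} {x a b : V} (ha : a ∈ cpt G s x) (hb : b ∈ s) (e : G.Adj a b) :
    b ∈ cpt G s x :=
  cpt_max (D := {a, b}) (by
    rintro z (rfl | rfl)
    · exact cpt_sub ha
    · exact hb) (cn_pair e) ⟨a, by simp, ha⟩ (by simp)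

theorem cpt_eq {s : Set V} {x y : V} (hy : y ∈ cpt G s x) : cpt G s y = cpt G s x := by
  obtain ⟨C, hC, hxC, hyC, hc⟩ := id hy
  have hxs := hC hxC
  apply Set.Subset.antisymm
  · exact cpt_max cpt_sub (cpt_cn (hC hyC)) ⟨y, mem_cpt (hC hyC), hy⟩
  · exact cpt_max cpt_sub (cpt_cn hxs) ⟨y, hy, mem_cpt (hC hyC)⟩

/-- grow a family of disjoint connected sets to a partition -/
theorem grow [Finite V] {ι : Type*} [Nonempty ι] (X : Set V) (hX : Cn G X) (f : ι → Set V)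
    (hf : ∀ i, Cn G (f i)) (hs : ∀ i, f i ⊆ X) (hd : ∀ i j, i ≠ j → Disjoint (f i) (f j)) :
    ∃ g : ι → Set V, (∀ i, f i ⊆ g i) ∧ (∀ i, Cn G (g i)) ∧
      (∀ i j, i ≠ j → Disjoint (g i) (g j)) ∧ (⋃ i, g i) = X := by
  classical
  induction hn : (X \ ⋃ i, f i).ncard using Nat.strong_induction_on generalizing f with
  | _ n ih =>
  by_cases he : (X \ ⋃ i, f i).Nonempty
  · obtain ⟨i0⟩ := (inferInstance : Nonempty ι)
    obtain ⟨x0, hx0⟩ := (hf i0).nonempty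
    obtain ⟨a, ⟨_, ha⟩, b, hb, e⟩ := hX.cut (T := ⋃ i, f i)
      ⟨x0, hs i0 hx0, Set.mem_iUnion.2 ⟨i0, hx0⟩⟩ he
    obtain ⟨i, hai⟩ := Set.mem_iUnion.1 ha
    have hbn : ∀ j, b ∉ f j := fun j hj => hb.2 (Set.mem_iUnion.2 ⟨j, hj⟩)
    let f' := Function.update f i (insert b (f i))
    have hsub : ∀ j, f j ⊆ f' j := by
      intro j
      by_cases h : j = i
      · subst h
        simp [f']
      · simp [f', h]
    obtain ⟨g, h1, h2, h3, h4⟩ := ih (X \ ⋃ i, f' i).ncard (by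
        rw [← hn]
        refine Set.ncard_lt_ncard ?_
        refine ⟨Set.sdiff_subset_sdiff_right (Set.iUnion_mono hsub), fun h => ?_⟩
        exact (h hb).2 (Set.mem_iUnion.2 ⟨i, by simp [f']⟩)) f' (by
        intro j
        by_cases h : j = i
        · subst h
          simp only [f', Function.update_self]
          exact (hf j).insert ⟨a, hai, b, rfl, e⟩
        · simpa [f', h] using hf j) (by
        intro j
        by_cases h : j = i
        · subst h
          simp only [f', Function.update_self]
          exact Set.insert_subset hb.1 (hs j)
        · simpa [f', h] using hs j) (by
        intro j k hjk
        by_cases h : j = i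
        · subst h
          have hk : k ≠ j := hjk.symm
          simp only [f', Function.update_self, Function.update_of_ne hk]
          exact Set.disjoint_insert_left.2 ⟨hbn k, hd _ _ hjk⟩
        · by_cases h' : k = i
          · subst h'
            simp only [f', Function.update_self, Function.update_of_ne h]
            exact Set.disjoint_insert_right.2 ⟨hbn j, hd _ _ hjk⟩
          · simpa [f', h, h'] using hd _ _ hjk) rfl
    exact ⟨g, fun j => (hsub j).trans (h1 j), h2, h3, h4⟩
  · refine ⟨f, fun _ => le_rfl, hf, hd, ?_⟩
    rw [Set.not_nonempty_iff_eq_empty, Set.sdiff_eq_empty] at he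
    exact (Set.iUnion_subset hs).antisymm he

theorem grow2 [Finite V] {X A B : Set V} (hX : Cn G X) (hA : Cn G A) (hB : Cn G B) (hAX : A ⊆ X)
    (hBX : B ⊆ X) (hd : Disjoint A B) :
    ∃ A' B', A ⊆ A' ∧ B ⊆ B' ∧ Cn G A' ∧ Cn G B' ∧ Disjoint A' B' ∧ A' ∪ B' = X ∧
      Tch G A' B' := by
  obtain ⟨g, h1, h2, h3, h4⟩ := grow X hX (fun b : Bool => if b then A else B)
    (by intro i; cases i <;> simp [hA, hB]) (by intro i; cases i <;> simp [hAX, hBX])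
    (by intro i j hij; cases i <;> cases j <;> simp_all [disjoint_comm])
  have hU : g true ∪ g false = X := by
    rw [← h4]; ext; simp [or_comm]
  have hD := h3 true false (by simp)
  refine ⟨g true, g false, by simpa using h1 true, by simpa using h1 false, h2 _, h2 _,
    hD, hU, ?_⟩
  obtain ⟨a, ha⟩ := (h2 true).nonempty
  obtain ⟨b, hb⟩ := (h2 false).nonempty
  have hc := hX.cut (T := g true) ⟨a, hU ▸ Or.inl ha, ha⟩
    ⟨b, hU ▸ Or.inr hb, fun h => Set.disjoint_left.1 hD h hb⟩
  refine hc.mono Set.inter_subset_right ?_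
  rintro z ⟨hz, hz'⟩
  rw [← hU] at hz
  exact hz.resolve_left hz'

theorem split2 [Finite V] {X : Set V} (hX : Cn G X) {x y : V} (hx : x ∈ X) (hy : y ∈ X)
    (hxy : x ≠ y) : ∃ A B, x ∈ A ∧ y ∈ B ∧ Cn G A ∧ Cn G B ∧ Disjoint A B ∧ A ∪ B = X ∧
      Tch G A B := by
  obtain ⟨A, B, h1, h2, h⟩ := grow2 hX (cn_singleton x) (cn_singleton y) (by simpa) (by simpa)
    (by simpa using hxy)
  exact ⟨A, B, h1 rfl, h2 rfl, h⟩

end basics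

theorem isMinor_mk {W V : Type*} {H : SimpleGraph W} {G : SimpleGraph V} (f : W → Set V)
    (h1 : ∀ w, Cn G (f w)) (h2 : ∀ w₁ w₂ : W, w₁ ≠ w₂ → Disjoint (f w₁) (f w₂))
    (h3 : ∀ w₁ w₂ : W, H.Adj w₁ w₂ → Tch G (f w₁) (f w₂)) : IsMinor H G :=
  ⟨f, fun w => (h1 w).nonempty, h1, h2, h3⟩

theorem IsMinor.trans {U W V : Type*} {F : SimpleGraph U} {H : SimpleGraph W} {G : SimpleGraph V}
    (h : IsMinor F H) (h' : IsMinor H G) : IsMinor F G := by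
  obtain ⟨f, -, f1, f2, f3⟩ := h
  obtain ⟨g, -, g1, g2, g3⟩ := h'
  refine isMinor_mk (fun u => ⋃ w ∈ f u, g w) (fun u => cn_biUnion (f1 u) (fun i _ => g1 i)
    (fun i _ j _ e => g3 i j e)) (fun u u' huu => ?_) (fun u u' e => ?_)
  · simp only [Set.disjoint_iUnion_left, Set.disjoint_iUnion_right]
    intro i hi j hj
    exact g2 j i fun h => Set.disjoint_left.1 (f2 u u' huu) (h ▸ hj) (by simpa using hi)
  · obtain ⟨a, ha, b, hb, e⟩ := f3 u u' e
    obtain ⟨p, hp, q, hq, e⟩ := g3 a b e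
    exact ⟨p, Set.mem_biUnion ha hp, q, Set.mem_biUnion hb hq, e⟩


/-! Rank -/

def Rk {V : Type*} (G : SimpleGraph V) : ℕ → V → Set V → Prop
  | 0, r, X => r ∈ X ∧ Cn G X
  | k + 1, r, X => ∃ Y X1 X2 r1 r2, X = Y ∪ X1 ∪ X2 ∧ Disjoint Y X1 ∧ Disjoint Y X2 ∧
      Disjoint X1 X2 ∧ r ∈ Y ∧ Cn G Y ∧ Tch G Y {r1} ∧ Tch G Y {r2} ∧ Rk G k r1 X1 ∧ Rk G k r2 X2

section rank
variable {V : Type*} {G : SimpleGraph V}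

theorem Rk.mem {k : ℕ} {r : V} {X : Set V} (h : Rk G k r X) : r ∈ X := by
  cases k with
  | zero => exact h.1
  | succ k =>
    obtain ⟨Y, X1, X2, r1, r2, rfl, -, -, -, h, -⟩ := h
    exact Or.inl (Or.inl h)

theorem Rk.cn {k : ℕ} {r : V} {X : Set V} (h : Rk G k r X) : Cn G X := by
  induction k generalizing r X with
  | zero => exact h.2
  | succ k ih =>
    obtain ⟨Y, X1, X2, r1, r2, rfl, -, -, -, h, hY, t1, t2, h1, h2⟩ := h
    exact (hY.union (ih h1) (t1.mono le_rfl (by simpa using h1.mem))).union (ih h2)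
      (t2.mono Set.subset_union_left (by simpa using h2.mem))

theorem Rk.ext {k : ℕ} {r r' : V} {X Z : Set V} (h : Rk G k r X) (hZ : Cn G Z) (hr : r' ∈ Z)
    (ht : Tch G Z {r}) (hd : Disjoint Z X) : Rk G k r' (Z ∪ X) := by
  cases k with
  | zero => exact ⟨Or.inl hr, hZ.union h.2 (ht.mono le_rfl (by simpa using h.1))⟩
  | succ k =>
    obtain ⟨Y, X1, X2, r1, r2, rfl, d1, d2, d3, h, hY, t1, t2, h1, h2⟩ := h
    rw [Set.disjoint_union_right, Set.disjoint_union_right] at hd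
    refine ⟨Z ∪ Y, X1, X2, r1, r2, by simp only [Set.union_assoc], ?_, ?_, d3, Or.inl hr,
      hZ.union hY (ht.mono le_rfl (by simpa using h)), t1.mono Set.subset_union_right le_rfl,
      t2.mono Set.subset_union_right le_rfl, h1, h2⟩
    · exact Set.disjoint_union_left.2 ⟨hd.1.2, d1⟩
    · exact Set.disjoint_union_left.2 ⟨hd.2, d2⟩

theorem Rk.dec {k : ℕ} {r : V} {X : Set V} (h : Rk G (k + 1) r X) : Rk G k r X := by
  induction k generalizing r X with
  | zero => exact ⟨h.mem, h.cn⟩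
  | succ k ih =>
    obtain ⟨Y, X1, X2, r1, r2, rfl, d1, d2, d3, h, hY, t1, t2, h1, h2⟩ := h
    exact ⟨Y, X1, X2, r1, r2, rfl, d1, d2, d3, h, hY, t1, t2, ih h1, ih h2⟩

theorem Rk.le {k j : ℕ} {r : V} {X : Set V} (h : Rk G k r X) (hj : j ≤ k) : Rk G j r X := by
  induction k, hj using Nat.le_induction with
  | base => exact h
  | succ k hk ih => exact ih h.dec

theorem Rk.reroot {k : ℕ} {r a : V} {X : Set V} (h : Rk G (k + 1) r X) (ha : a ∈ X) :
    Rk G k a X := by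
  cases k with
  | zero => exact ⟨ha, h.cn⟩
  | succ k =>
    obtain ⟨Y, X1, X2, r1, r2, rfl, d1, d2, d3, h, hY, t1, t2, h1, h2⟩ := h
    by_cases haY : a ∈ Y
    · exact ⟨Y, X1, X2, r1, r2, rfl, d1, d2, d3, haY, hY, t1, t2, h1.dec, h2.dec⟩
    -- key step, symmetric in the two sides
    have key : ∀ (X1 X2 : Set V) (r1 r2 : V), Disjoint Y X1 → Disjoint Y X2 → Disjoint X1 X2 →
        Tch G Y {r1} → Tch G Y {r2} → Rk G (k + 1) r1 X1 → Rk G (k + 1) r2 X2 → a ∈ X1 →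
        Rk G (k + 1) a (Y ∪ X1 ∪ X2) := by
      clear! X1 X2
      intro X1 X2 r1 r2 d1 d2 d3 t1 t2 h1 h2 ha1
      obtain ⟨y, hy, q, hq, e⟩ := t1
      rw [Set.mem_singleton_iff] at hq
      subst hq
      obtain ⟨Y1, A, B, s1, s2, rfl, c1, c2, c3, hr1, hY1, u1, u2, g1, g2⟩ := h1
      have hYX : Rk G k y (Y ∪ X2) := h2.dec.ext hY hy t2 d2
      have key2 : ∀ (A B : Set V) (s1 s2 : V), Disjoint Y1 A → Disjoint Y1 B → Disjoint A B →
          Disjoint Y (Y1 ∪ A ∪ B) → Disjoint (Y1 ∪ A ∪ B) X2 →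
          Tch G Y1 {s1} → Tch G Y1 {s2} → Rk G k s1 A → Rk G k s2 B → a ∈ Y1 ∪ A →
          Rk G (k + 1) a (Y ∪ (Y1 ∪ A ∪ B) ∪ X2) := by
        intro A B s1 s2 c1 c2 c3 d1 d3 u1 u2 g1 g2 ha
        simp only [Set.disjoint_union_left, Set.disjoint_union_right] at d1 d3
        refine ⟨Y1 ∪ A, B, Y ∪ X2, s2, y, ?_, ?_, ?_, ?_, ha,
          hY1.union g1.cn (u1.mono le_rfl (by simpa using g1.mem)),
          u2.mono Set.subset_union_left le_rfl,
          ⟨q, Or.inl hr1, y, rfl, e.symm⟩, g2, hYX⟩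
        · ext z; simp only [Set.mem_union]; tauto
        · exact Set.disjoint_union_left.2 ⟨c2, c3⟩
        · simp only [Set.disjoint_union_left, Set.disjoint_union_right]
          exact ⟨⟨d1.1.1.symm, d1.1.2.symm⟩, d3.1.1, d3.1.2⟩
        · simp only [Set.disjoint_union_right]
          exact ⟨d1.2.symm, d3.2⟩
      by_cases haB : a ∈ B
      · have h := key2 B A s2 s1 c2 c1 c3.symm (by rwa [Set.union_right_comm])
          (by rwa [Set.union_right_comm]) u2 u1 g2 g1 (Or.inr haB)
        rwa [Set.union_right_comm Y1] at h
      · exact key2 A B s1 s2 c1 c2 c3 d1 d3 u1 u2 g1 g2 (ha1.resolve_right haB)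
    by_cases ha1 : a ∈ X1
    · exact key X1 X2 r1 r2 d1 d2 d3 t1 t2 h1 h2 ha1
    · have ha2 : a ∈ X2 := by
        rcases ha with (h | h) | h
        · exact absurd h haY
        · exact absurd h ha1
        · exact h
      rw [Set.union_right_comm]
      exact key X2 X1 r2 r1 d2 d1 d3.symm t2 t1 h2 h1 ha2

theorem Rk.mono [Finite V] {k : ℕ} {r : V} {X X' : Set V} (h : Rk G k r X) (hX : X ⊆ X')
    (hc : Cn G X') : Rk G k r X' := by
  induction k generalizing r X X' with
  | zero => exact ⟨hX h.1, hc⟩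
  | succ k ih =>
    obtain ⟨Y, X1, X2, r1, r2, rfl, d1, d2, d3, h, hY, t1, t2, h1, h2⟩ := h
    obtain ⟨g, g1, g2, g3, g4⟩ := grow X' hc (fun i : Option Bool => match i with
      | none => Y | some true => X1 | some false => X2)
      (by
        rintro (_ | _ | _)
        · exact hY
        · exact h2.cn
        · exact h1.cn)
      (by
        rintro (_ | _ | _)
        · exact (Set.subset_union_left.trans Set.subset_union_left).trans hX
        · exact Set.subset_union_right.trans hX
        · exact (Set.subset_union_right.trans Set.subset_union_left).trans hX)
      (by
        rintro (_ | _ | _) (_ | _ | _) hij <;> first | exact absurd rfl hij | skip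
        · exact d2
        · exact d1
        · exact d2.symm
        · exact d3.symm
        · exact d1.symm
        · exact d3)
    refine ⟨g none, g (some true), g (some false), r1, r2, ?_, g3 _ _ (by simp), g3 _ _ (by simp),
      g3 _ _ (by simp), g1 none h, g2 _, t1.mono (g1 none) le_rfl, t2.mono (g1 none) le_rfl,
      ih h1 (g1 (some true)) (g2 _), ih h2 (g1 (some false)) (g2 _)⟩
    rw [← g4]
    ext z
    simp only [Set.mem_union, Set.mem_iUnion, Option.exists, Bool.exists_bool]
    tauto

def HRk (G : SimpleGraph V) (k : ℕ) (X : Set V) : Prop := ∃ r, Rk G k r X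

theorem HRk.mono [Finite V] {k : ℕ} {X X' : Set V} (h : HRk G k X) (hX : X ⊆ X')
    (hc : Cn G X') : HRk G k X' := by
  obtain ⟨r, h⟩ := h
  exact ⟨r, h.mono hX hc⟩

/-- removing a piece from a part -/
theorem piece_aux {Y X1 X2 Z : Set V} {r1 r2 : V} (hY : Cn G Y) (h2 : Cn G X2) (hr2 : r2 ∈ X2)
    (t1 : Tch G Y {r1}) (t2 : Tch G Y {r2}) (d1 : Disjoint Y X1) (d3 : Disjoint X1 X2)
    (hZ : Z ⊆ X1) (hc : Cn G (X1 \ Z)) (hr1 : r1 ∈ X1 \ Z) :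
    Cn G ((Y ∪ X1 ∪ X2) \ Z) ∧ X1 \ Z ⊆ (Y ∪ X1 ∪ X2) \ Z ∧ X2 ⊆ (Y ∪ X1 ∪ X2) \ Z ∧
      Y ⊆ (Y ∪ X1 ∪ X2) \ Z := by
  have e : (Y ∪ X1 ∪ X2) \ Z = Y ∪ (X1 \ Z) ∪ X2 := by
    ext z
    have h1 := fun h : z ∈ Z => hZ h
    have h2 := fun (h : z ∈ Y) h' => Set.disjoint_left.1 d1 h h'
    have h3 := fun (h : z ∈ X1) h' => Set.disjoint_left.1 d3 h h'
    simp only [Set.mem_union, Set.mem_sdiff]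
    tauto
  rw [e]
  refine ⟨(hY.union hc (t1.mono le_rfl (by simpa using hr1))).union h2
    (t2.mono Set.subset_union_left (by simpa using hr2)), ?_, ?_, ?_⟩ <;>
  · intro z hz
    simp only [Set.mem_union]
    tauto

theorem Rk.piece [Finite V] {j m : ℕ} {r : V} {X : Set V} (h : Rk G (j + m + 1) r X) (At : Set V)
    (hA : (At ∩ X).ncard ≤ m) : ∃ Z r', Z ⊆ X ∧ Rk G j r' Z ∧ Disjoint Z At ∧ r ∈ X \ Z ∧
      Cn G (X \ Z) ∧ Tch G (X \ Z) {r'} ∧ HRk G j (X \ Z) := by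
  induction m generalizing r X with
  | zero =>
    rw [Nat.le_zero, Set.ncard_eq_zero] at hA
    obtain ⟨Y, X1, X2, r1, r2, rfl, d1, d2, d3, h, hY, t1, t2, h1, h2⟩ := h
    have e : (Y ∪ X1 ∪ X2) \ X1 = Y ∪ X2 := by
      ext z
      have h2 := fun (h : z ∈ Y) h' => Set.disjoint_left.1 d1 h h'
      have h3 := fun (h : z ∈ X1) h' => Set.disjoint_left.1 d3 h h'
      simp only [Set.mem_union, Set.mem_sdiff]
      tauto
    have hc : Cn G (Y ∪ X2) := hY.union h2.cn (t2.mono le_rfl (by simpa using h2.mem))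
    refine ⟨X1, r1, fun z hz => Or.inl (Or.inr hz), h1, ?_, ?_, ?_, ?_, ?_⟩
    · rw [Set.disjoint_left]
      intro z hz hzA
      have : z ∈ At ∩ (Y ∪ X1 ∪ X2) := ⟨hzA, Or.inl (Or.inr hz)⟩
      rw [hA] at this
      exact this
    · rw [e]; exact Or.inl h
    · rwa [e]
    · rw [e]; exact t1.mono Set.subset_union_left le_rfl
    · rw [e]; exact HRk.mono ⟨r2, h2⟩ Set.subset_union_right hc
  | succ m ih =>
    have h0 := h
    obtain ⟨Y, X1, X2, r1, r2, rfl, d1, d2, d3, h, hY, t1, t2, h1, h2⟩ := h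
    have e : (Y ∪ X1 ∪ X2) \ X2 = Y ∪ X1 := by
      ext z
      have h2 := fun (h : z ∈ Y) h' => Set.disjoint_left.1 d2 h h'
      have h3 := fun (h : z ∈ X1) h' => Set.disjoint_left.1 d3 h h'
      simp only [Set.mem_union, Set.mem_sdiff]
      tauto
    by_cases hm : (At ∩ X2).Nonempty
    · obtain ⟨x, hxA, hx2⟩ := hm
      have hlt : (At ∩ X1).ncard ≤ m := by
        have : (At ∩ X1).ncard < (At ∩ (Y ∪ X1 ∪ X2)).ncard := by
          refine Set.ncard_lt_ncard ⟨fun z hz => ⟨hz.1, Or.inl (Or.inr hz.2)⟩, fun hh => ?_⟩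
          exact Set.disjoint_left.1 d3 (hh ⟨hxA, Or.inr hx2⟩).2 hx2
        omega
      obtain ⟨Z, r', hZ, hr, hD, hr1, hc, ht, hk⟩ := ih h1 hlt
      obtain ⟨p1, p2, p3, p4⟩ := piece_aux hY h2.cn h2.mem t1 t2 d1 d3 hZ hc hr1
      exact ⟨Z, r', fun z hz => Or.inl (Or.inr (hZ hz)), hr, hD, p4 h, p1, ht.mono p2 le_rfl,
        hk.mono p2 p1⟩
    · have hc : Cn G (Y ∪ X1) := hY.union h1.cn (t1.mono le_rfl (by simpa using h1.mem))
      refine ⟨X2, r2, Set.subset_union_right, h2.le (by omega), ?_, ?_, ?_, ?_, ?_⟩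
      · rw [Set.disjoint_left]
        intro z hz hzA
        exact hm ⟨z, hzA, hz⟩
      · rw [e]; exact Or.inl h
      · rwa [e]
      · rw [e]; exact t2.mono Set.subset_union_left le_rfl
      · rw [e]; exact HRk.mono ⟨r1, h1.le (by omega)⟩ Set.subset_union_right hc

end rank


/-! path-width lower bound from rank -/

theorem pd_between {V : Type*} {G : SimpleGraph V} {n : ℕ} {X : Fin n → Finset V}
    (hX : IsPathDecomp G X) {C : Set V} (hC : Cn G C) {i j k : Fin n} (hij : i ≤ j) (hjk : j ≤ k)
    (hi : ∃ x ∈ C, x ∈ X i) (hk : ∃ x ∈ C, x ∈ X k) : ∃ x ∈ C, x ∈ X j := by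
  by_contra hcon
  push Not at hcon
  obtain ⟨x, hx, hxi⟩ := hi
  obtain ⟨y, hy, hyk⟩ := hk
  obtain ⟨h1, h2, h3⟩ := hX
  obtain ⟨a, ⟨ha, i', hi', hai⟩, b, ⟨hb, hbT⟩, e⟩ := hC.cut (T := {v | ∃ i, i ≤ j ∧ v ∈ X i})
    ⟨x, hx, i, hij, hxi⟩ ⟨y, hy, fun ⟨i', h, h'⟩ => hcon y hy (h3 _ _ _ h hjk y h' hyk)⟩
  obtain ⟨t, hat, hbt⟩ := h2 a b e
  rcases le_total t j with h | h
  · exact hbT ⟨t, h, hbt⟩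
  · exact hcon a ha (h3 _ _ _ hi' h a hai hat)

theorem rk_bag {V : Type*} [Finite V] {G : SimpleGraph V} {n : ℕ} {X : Fin n → Finset V}
    (hX : IsPathDecomp G X) {k : ℕ} {r : V} {S : Set V} (h : Rk G (2 * k) r S) :
    ∃ i, k + 1 ≤ ((X i : Set V) ∩ S).ncard := by
  induction k generalizing r S with
  | zero =>
    obtain ⟨i, hi⟩ := hX.1 r
    refine ⟨i, ?_⟩
    rw [Nat.zero_add, Nat.one_le_iff_ne_zero, Ne, Set.ncard_eq_zero]
    exact Set.Nonempty.ne_empty ⟨r, hi, h.mem⟩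
  | succ k ih =>
    obtain ⟨Y, X1, X2, r1, r2, rfl, d1, d2, d3, h, hY, t1, t2, h1, h2⟩ := h
    -- three pieces
    have key : ∀ C D : Set V, Cn G C → Disjoint C D → C ∪ D ⊆ Y ∪ X1 ∪ X2 → ∀ i j l : Fin n,
        i ≤ j → j ≤ l → (∃ x ∈ C, x ∈ X i) → (∃ x ∈ C, x ∈ X l) →
        k + 1 ≤ ((X j : Set V) ∩ D).ncard →
        k + 1 + 1 ≤ ((X j : Set V) ∩ (Y ∪ X1 ∪ X2)).ncard := by
      intro C D hC hd hs i j l hij hjl hi hl hj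
      obtain ⟨x, hxC, hx⟩ := pd_between hX hC hij hjl hi hl
      have : ((X j : Set V) ∩ D).ncard < ((X j : Set V) ∩ (Y ∪ X1 ∪ X2)).ncard := by
        refine Set.ncard_lt_ncard ⟨Set.inter_subset_inter_right _
          (Set.subset_union_right.trans hs), fun hh => ?_⟩
        exact Set.disjoint_left.1 hd hxC (hh ⟨hx, hs (Or.inl hxC)⟩).2
      omega
    have meet : ∀ (i : Fin n) (D : Set V), k + 1 ≤ ((X i : Set V) ∩ D).ncard →
        ∃ x ∈ D, x ∈ X i := by
      intro i D h
      obtain ⟨x, hx⟩ := Set.nonempty_of_ncard_ne_zero (s := (X i : Set V) ∩ D) (by omega)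
      exact ⟨x, hx.2, hx.1⟩
    have h1' := h1
    obtain ⟨Y1, A, B, s1, s2, rfl, c1, c2, c3, hr1, hY1, u1, u2, g1, g2⟩ := h1
    obtain ⟨iA, hA⟩ := ih g1
    obtain ⟨iB, hB⟩ := ih g2
    obtain ⟨iC, hC⟩ := ih h2.dec
    simp only [Set.disjoint_union_left, Set.disjoint_union_right] at d1 d3
    have m1 : Y1 ⊆ Y1 ∪ A ∪ B := fun z hz => Or.inl (Or.inl hz)
    -- complements
    have cA : Cn G (Y1 ∪ B ∪ (Y ∪ X2)) := by
      refine Cn.union (hY1.union g2.cn (u2.mono le_rfl (by simpa using g2.mem)))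
        (hY.union h2.cn (t2.mono le_rfl (by simpa using h2.mem))) (Tch.symm (t1.mono ?_ ?_))
      · exact Set.subset_union_left
      · simpa using Or.inl hr1
    have cB : Cn G (Y1 ∪ A ∪ (Y ∪ X2)) := by
      refine Cn.union (hY1.union g1.cn (u1.mono le_rfl (by simpa using g1.mem)))
        (hY.union h2.cn (t2.mono le_rfl (by simpa using h2.mem))) (Tch.symm (t1.mono ?_ ?_))
      · exact Set.subset_union_left
      · simpa using Or.inl hr1
    have kA := key _ A cA (by
      simp only [Set.disjoint_union_left]
      exact ⟨⟨c1, c3.symm⟩, d1.1.2, d3.1.2.symm⟩) (by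
      intro z
      simp only [Set.mem_union]
      tauto)
    have kB := key _ B cB (by
      simp only [Set.disjoint_union_left]
      exact ⟨⟨c2, c3⟩, d1.2, d3.2.symm⟩) (by
      intro z
      simp only [Set.mem_union]
      tauto)
    have kC := key _ X2 h1'.cn (by
      simp only [Set.disjoint_union_left]
      exact d3) (by
      intro z
      simp only [Set.mem_union]
      tauto)
    obtain ⟨a, ha, ha'⟩ := meet _ _ hA
    obtain ⟨b, hb, hb'⟩ := meet _ _ hB
    obtain ⟨c, hc, hc'⟩ := meet _ _ hC
    have fA : ∀ i l, (∃ x ∈ B, x ∈ X i) → (∃ x ∈ X2, x ∈ X l) → _ := fun i l ⟨x, hx, hx'⟩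
        ⟨y, hy, hy'⟩ => And.intro (kA i iA l · · ⟨x, Or.inl (Or.inr hx), hx'⟩
        ⟨y, Or.inr (Or.inr hy), hy'⟩ hA) (kA l iA i · · ⟨y, Or.inr (Or.inr hy), hy'⟩
        ⟨x, Or.inl (Or.inr hx), hx'⟩ hA)
    have fB : ∀ i l, (∃ x ∈ A, x ∈ X i) → (∃ x ∈ X2, x ∈ X l) → _ := fun i l ⟨x, hx, hx'⟩
        ⟨y, hy, hy'⟩ => And.intro (kB i iB l · · ⟨x, Or.inl (Or.inr hx), hx'⟩
        ⟨y, Or.inr (Or.inr hy), hy'⟩ hB) (kB l iB i · · ⟨y, Or.inr (Or.inr hy), hy'⟩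
        ⟨x, Or.inl (Or.inr hx), hx'⟩ hB)
    have fC : ∀ i l, (∃ x ∈ A, x ∈ X i) → (∃ x ∈ B, x ∈ X l) → _ := fun i l ⟨x, hx, hx'⟩
        ⟨y, hy, hy'⟩ => And.intro (kC i iC l · · ⟨x, Or.inl (Or.inr hx), hx'⟩
        ⟨y, Or.inr hy, hy'⟩ hC) (kC l iC i · · ⟨y, Or.inr hy, hy'⟩
        ⟨x, Or.inl (Or.inr hx), hx'⟩ hC)
    have eA := fA iB iC ⟨b, hb, hb'⟩ ⟨c, hc, hc'⟩
    have eB := fB iA iC ⟨a, ha, ha'⟩ ⟨c, hc, hc'⟩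
    have eC := fC iA iB ⟨a, ha, ha'⟩ ⟨b, hb, hb'⟩
    rcases le_total iA iB with h1 | h1 <;> rcases le_total iB iC with h2 | h2 <;>
      rcases le_total iA iC with h3 | h3
    all_goals first
      | exact ⟨iA, eA.1 h1 h3⟩
      | exact ⟨iA, eA.2 h3 h1⟩
      | exact ⟨iB, eB.1 h1 h2⟩
      | exact ⟨iB, eB.2 h2 h1⟩
      | exact ⟨iC, eC.1 h3 h2⟩
      | exact ⟨iC, eC.2 h2 h3⟩

theorem rk_pathwidth {V : Type*} [Fintype V] {G : SimpleGraph V} {k : ℕ} {r : V} {S : Set V}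
    (h : Rk G (2 * k) r S) : k ≤ pathwidth G := by
  refine le_csInf ⟨Fintype.card V, 1, fun _ => Finset.univ, ⟨?_, ?_, ?_⟩, ?_⟩ ?_
  · simp
  · simp
  · simp
  · simp [Finset.card_univ]
  · rintro w ⟨n, X, hX, hw⟩
    obtain ⟨i, hi⟩ := rk_bag hX h
    have h1 : ((X i : Set V) ∩ S).ncard ≤ (X i).card := by
      rw [← Set.ncard_coe_finset]
      exact Set.ncard_le_ncard Set.inter_subset_left
    have := hw i
    omega


/-! Family one: binary tree plus apex -/

section forest
variable {V : Type*} {G : SimpleGraph V} (F : Set V) (lb : V → List Bool)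

theorem forest_top (hF : ∀ a ∈ F, ∀ b ∈ F, G.Adj a b →
      (∃ c, lb a = c :: lb b) ∨ ∃ c, lb b = c :: lb a) {A : Set V} (hA : Cn G A) (hAF : A ⊆ F) :
    ∃ t ∈ A, ∀ a ∈ A, lb t <:+ lb a := by
  obtain ⟨t, ht, hmin⟩ := exists_minimalFor_of_wellFoundedLT (· ∈ A)
    (fun a => (lb a).length) hA.nonempty
  refine ⟨t, ht, ?_⟩
  by_contra hcon
  push Not at hcon
  obtain ⟨y, hy, hyt⟩ := hcon
  obtain ⟨a, ⟨ha, haT⟩, b, ⟨hb, hbT⟩, e⟩ := hA.cut (T := {a | lb t <:+ lb a})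
    ⟨t, ht, List.suffix_rfl⟩ ⟨y, hy, hyt⟩
  rcases hF a (hAF ha) b (hAF hb) e with ⟨c, hc⟩ | ⟨c, hc⟩
  · rw [Set.mem_ofPred_eq, hc, List.suffix_cons_iff] at haT
    rcases haT with h | h
    · have h1 := hmin hb
      simp only [h, List.length_cons] at h1
      omega
    · exact hbT h
  · exact hbT (by
      rw [Set.mem_ofPred_eq, hc]
      exact haT.trans (List.suffix_cons _ _))

theorem forest_mid (hF : ∀ a ∈ F, ∀ b ∈ F, G.Adj a b →
      (∃ c, lb a = c :: lb b) ∨ ∃ c, lb b = c :: lb a) {A : Set V} (hA : Cn G A) (hAF : A ⊆ F)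
    {t x : V} (ht : t ∈ A) (hx : x ∈ A) {s : List Bool} (h1 : lb t <:+ s) (h2 : s <:+ lb x) :
    ∃ v ∈ A, lb v = s := by
  by_contra hcon
  push Not at hcon
  obtain ⟨a, ⟨ha, haT⟩, b, ⟨hb, hbT⟩, e⟩ := hA.cut (T := {a | s <:+ lb a})
    ⟨x, hx, h2⟩ ⟨t, ht, fun h => hcon t ht (h1.eq_of_length_le h.length_le)⟩
  rcases hF a (hAF ha) b (hAF hb) e with ⟨c, hc⟩ | ⟨c, hc⟩
  · rw [Set.mem_ofPred_eq, hc, List.suffix_cons_iff] at haT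
    rcases haT with h | h
    · exact hcon a ha (by rw [hc, h])
    · exact hbT h
  · exact hbT (by
      rw [Set.mem_ofPred_eq, hc]
      exact haT.trans (List.suffix_cons _ _))

theorem forest_no_tri (hinj : ∀ a ∈ F, ∀ b ∈ F, lb a = lb b → a = b)
    (hF : ∀ a ∈ F, ∀ b ∈ F, G.Adj a b →
      (∃ c, lb a = c :: lb b) ∨ ∃ c, lb b = c :: lb a) (f : Fin 3 → Set V)
    (h1 : ∀ i, Cn G (f i)) (h2 : ∀ i j, i ≠ j → Disjoint (f i) (f j))
    (h3 : ∀ i j, i ≠ j → Tch G (f i) (f j)) (h4 : ∀ i, f i ⊆ F) : False := by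
  choose t ht htop using fun i => forest_top F lb hF (h1 i) (h4 i)
  -- main step
  have main : ∀ i j, i ≠ j → ∀ a ∈ f i, ∀ b ∈ f j, ∀ c, lb b = c :: lb a →
      (∃ v ∈ f i, ∃ c, lb (t j) = c :: lb v) ∨ ∃ v ∈ f j, ∃ c, lb (t i) = c :: lb v := by
    intro i j hij a ha b hb c hc
    have hs := htop j b hb
    rw [hc, List.suffix_cons_iff] at hs
    rcases hs with h | h
    · exact Or.inl ⟨a, ha, c, h⟩
    · exfalso
      rcases List.suffix_or_suffix_of_suffix h (htop i a ha) with h' | h'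
      · -- t i between t j and b in f j
        obtain ⟨v, hv, hvt⟩ := forest_mid F lb hF (h1 j) (h4 j) (ht j) hb h'
          ((htop i a ha).trans (by rw [hc]; exact List.suffix_cons _ _))
        have := hinj v (h4 j hv) (t i) (h4 i (ht i)) hvt
        subst this
        exact Set.disjoint_left.1 (h2 i j hij) (ht i) hv
      · obtain ⟨v, hv, hvt⟩ := forest_mid F lb hF (h1 i) (h4 i) (ht i) ha h' h
        have := hinj v (h4 i hv) (t j) (h4 j (ht j)) hvt
        subst this
        exact Set.disjoint_left.1 (h2 i j hij) hv (ht j)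
  have main2 : ∀ i j, i ≠ j →
      (∃ v ∈ f i, ∃ c, lb (t j) = c :: lb v) ∨ ∃ v ∈ f j, ∃ c, lb (t i) = c :: lb v := by
    intro i j hij
    obtain ⟨a, ha, b, hb, e⟩ := h3 i j hij
    rcases hF a (h4 i ha) b (h4 j hb) e with ⟨c, hc⟩ | ⟨c, hc⟩
    · exact (main j i hij.symm b hb a ha c hc).symm
    · exact main i j hij a ha b hb c hc
  obtain ⟨m, hm⟩ := Finite.exists_max (fun i => (lb (t i)).length)
  have main3 : ∀ i, i ≠ m → ∃ v ∈ f i, ∃ c, lb (t m) = c :: lb v := by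
    intro i him
    rcases main2 i m him with h | ⟨v, hv, c, hc⟩
    · exact h
    · have h1 := (htop m v hv).length_le
      have h2 := hm i
      simp only [hc, List.length_cons] at h2
      omega
  obtain ⟨v, hv, c, hc⟩ := main3 (m + 1) (by fin_cases m <;> decide)
  obtain ⟨v', hv', c', hc'⟩ := main3 (m + 2) (by fin_cases m <;> decide)
  rw [hc] at hc'
  have := hinj v (h4 _ hv) v' (h4 _ hv') (List.cons.inj hc').2
  subst this
  exact Set.disjoint_left.1 (h2 (m + 1) (m + 2) (by fin_cases m <;> decide)) hv hv'

end forest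

def PG (k : ℕ) : SimpleGraph (Option (CTVert k)) where
  Adj x y := match x, y with
    | none, none => False
    | none, some _ => True
    | some _, none => True
    | some a, some b => (∃ c, a.1 = c :: b.1) ∨ ∃ c, b.1 = c :: a.1
  symm := ⟨by
    rintro (_ | a) (_ | b) h
    · exact h
    · trivial
    · trivial
    · exact Or.symm h⟩
  loopless := ⟨by
    rintro (_ | a) h
    · exact h
    · rcases h with ⟨c, h⟩ | ⟨c, h⟩ <;> simp at h⟩

theorem PG_no_tri (k : ℕ) (f : Fin 3 → Set (Option (CTVert k))) (h1 : ∀ i, Cn (PG k) (f i))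
    (h2 : ∀ i j, i ≠ j → Disjoint (f i) (f j)) (h3 : ∀ i j, i ≠ j → Tch (PG k) (f i) (f j)) :
    ∃ i, none ∈ f i := by
  by_contra hcon
  push Not at hcon
  refine forest_no_tri {x : Option (CTVert k) | x ≠ none} (fun x => match x with
    | none => [] | some a => a.1) ?_ ?_ f h1 h2 h3 (fun i x hx h => hcon i (h ▸ hx))
  · rintro (_ | a) ha (_ | b) hb h
    · rfl
    · exact absurd rfl ha
    · exact absurd rfl hb
    · rw [Subtype.ext h]
  · rintro (_ | a) ha (_ | b) hb h
    · exact absurd rfl ha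
    · exact absurd rfl ha
    · exact absurd rfl hb
    · exact h

theorem PG_no_C32 (k : ℕ) : ¬ IsMinor C32 (PG k) := by
  rintro ⟨f, -, h1, h2, h3⟩
  have key : ∀ a : Fin 2, ∃ i, none ∈ f (a, i) := fun a =>
    PG_no_tri k (fun i => f (a, i)) (fun i => h1 _) (fun i j hij => h2 _ _ (by simp [hij]))
      (fun i j hij => h3 _ _ (by simp [C32, hij]))
  obtain ⟨i, hi⟩ := key 0
  obtain ⟨j, hj⟩ := key 1
  exact Set.disjoint_left.1 (h2 (0, i) (1, j) (by simp)) hi hj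

theorem graphA_adj (a b : Fin 6) : graphA.Adj a b ↔ (s(a, b) = s(0, 1) ∨ s(a, b) = s(1, 2) ∨
    s(a, b) = s(2, 3) ∨ s(a, b) = s(3, 4) ∨ s(a, b) = s(4, 5) ∨ s(a, b) = s(5, 0) ∨
    s(a, b) = s(0, 2) ∨ s(a, b) = s(2, 4) ∨ s(a, b) = s(4, 0)) ∧ a ≠ b := by
  simp only [graphA, fromEdgeSet_adj, Set.mem_insert_iff, Set.mem_singleton_iff]

theorem PG_no_A (k : ℕ) : ¬ IsMinor graphA (PG k) := by
  rintro ⟨f, -, h1, h2, h3⟩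
  have key : ∀ e : Fin 3 → Fin 6, Function.Injective e → (∀ i j, i ≠ j → graphA.Adj (e i) (e j)) →
      ∃ i, none ∈ f (e i) := fun e he ha =>
    PG_no_tri k (fun i => f (e i)) (fun i => h1 _) (fun i j hij => h2 _ _ (he.ne hij))
      (fun i j hij => h3 _ _ (ha i j hij))
  obtain ⟨i, hi⟩ := key ![0, 2, 4] (by decide) (by
    simp only [graphA_adj]; decide)
  have hun : ∀ a b, none ∈ f a → none ∈ f b → a = b := by
    intro a b ha hb
    by_contra hne
    exact Set.disjoint_left.1 (h2 a b hne) ha hb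
  have key2 : ∀ e : Fin 3 → Fin 6, Function.Injective e →
      (∀ i j, i ≠ j → graphA.Adj (e i) (e j)) → ∃ j, (![0, 2, 4] : Fin 3 → Fin 6) i = e j := by
    intro e he ha
    obtain ⟨j, hj⟩ := key e he ha
    exact ⟨j, hun _ _ hi hj⟩
  have k1 := key2 ![2, 3, 4] (by decide) (by
    simp only [graphA_adj]; decide)
  have k2 := key2 ![4, 5, 0] (by decide) (by
    simp only [graphA_adj]; decide)
  have k3 := key2 ![0, 1, 2] (by decide) (by
    simp only [graphA_adj]; decide)
  clear key key2
  revert k1 k2 k3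
  fin_cases i <;> decide

instance (k : ℕ) : Finite (CTVert k) := List.finite_length_le Bool k

noncomputable instance (k : ℕ) : Fintype (CTVert k) := Fintype.ofFinite _

theorem PG_tree_cn (k : ℕ) : Cn (PG k) {x | x ≠ none} := by
  refine cn_of_cut_at (x := some ⟨[], by simp⟩) (by simp) fun T hT hx hn => ?_
  obtain ⟨t, ht, hmin⟩ := exists_minimalFor_of_wellFoundedLT
    (· ∈ ({x | x ≠ none} \ T : Set (Option (CTVert k))))
    (fun a => match a with | none => 0 | some a => a.1.length) hn
  rcases t with _ | ⟨_ | ⟨c, l⟩, hl⟩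
  · exact absurd rfl ht.1
  · exact absurd hx ht.2
  · have hl' : l.length ≤ k := by simp at hl; omega
    refine ⟨some ⟨l, hl'⟩, ?_, _, ht, Or.inr ⟨c, rfl⟩⟩
    by_contra hlT
    have := hmin (j := some ⟨l, hl'⟩) ⟨by simp, hlT⟩
    simp at this

theorem PG_conn (k : ℕ) (hk : 1 ≤ k) : IsKConnected 2 (PG k) := by
  constructor
  · let e : Fin 3 → Option (CTVert k) := ![none, some ⟨[], by simp⟩, some ⟨[true], by simpa⟩]
    have he : Function.Injective e := by
      intro i j; fin_cases i <;> fin_cases j <;> simp [e]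
    have := Fintype.card_le_of_injective e he
    simpa using this
  · intro S hS
    change Cn (PG k) _
    by_cases h : none ∈ S
    · have : ((S : Set (Option (CTVert k)))ᶜ) = {x | x ≠ none} := by
        obtain ⟨a, rfl⟩ := Finset.card_eq_one.1 (le_antisymm (by omega)
          (Finset.card_pos.2 ⟨_, h⟩))
        rw [Finset.mem_singleton] at h
        subst h
        ext; simp
      rw [this]
      exact PG_tree_cn k
    · refine cn_of_all (x := none) (by simpa) fun y hy => ?_
      cases y with
      | none => exact ⟨{none}, by simpa, rfl, rfl, cn_singleton _⟩
      | some y => exact ⟨{none, some y}, by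
          rintro z (rfl | rfl)
          · simpa
          · exact hy, by simp, by simp, cn_pair (by trivial)⟩

theorem PG_rk (k : ℕ) (j : ℕ) (s : CTVert k) (h : s.1.length + j = k) :
    Rk (PG k) j (some s) {x | ∃ a : CTVert k, x = some a ∧ s.1 <:+ a.1} := by
  induction j generalizing s with
  | zero =>
    have : {x : Option (CTVert k) | ∃ a : CTVert k, x = some a ∧ s.1 <:+ a.1} = {some s} := by
      ext x
      constructor
      · rintro ⟨a, rfl, ha⟩
        rw [Set.mem_singleton_iff, Option.some_inj]
        exact Subtype.ext (ha.eq_of_length_le (by have := a.2; omega)).symm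
      · rintro rfl
        exact ⟨s, rfl, List.suffix_rfl⟩
    rw [this]
    exact ⟨rfl, cn_singleton _⟩
  | succ j ih =>
    let s1 : CTVert k := ⟨true :: s.1, by simp; omega⟩
    let s2 : CTVert k := ⟨false :: s.1, by simp; omega⟩
    refine ⟨{some s}, _, _, some s1, some s2, ?_, ?_, ?_, ?_, rfl, cn_singleton _, ?_, ?_,
      ih s1 (by simp [s1]; omega), ih s2 (by simp [s2]; omega)⟩
    · ext x
      constructor
      · rintro ⟨a, rfl, l, hl⟩
        rcases List.eq_nil_or_concat l with rfl | ⟨l', b, rfl⟩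
        · left; left
          rw [Set.mem_singleton_iff, Option.some_inj]
          exact Subtype.ext hl.symm
        · cases b
          · right
            exact ⟨a, rfl, l', by simpa [s2] using hl⟩
          · left; right
            exact ⟨a, rfl, l', by simpa [s1] using hl⟩
      · rintro ((rfl | ⟨a, rfl, ha⟩) | ⟨a, rfl, ha⟩)
        · exact ⟨s, rfl, List.suffix_rfl⟩
        · exact ⟨a, rfl, (List.suffix_cons _ _).trans ha⟩
        · exact ⟨a, rfl, (List.suffix_cons _ _).trans ha⟩
    · rw [Set.disjoint_left]
      rintro x rfl ⟨a, ha, hs⟩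
      rw [Option.some_inj] at ha
      subst ha
      have := hs.length_le
      simp [s1] at this
    · rw [Set.disjoint_left]
      rintro x rfl ⟨a, ha, hs⟩
      rw [Option.some_inj] at ha
      subst ha
      have := hs.length_le
      simp [s2] at this
    · rw [Set.disjoint_left]
      rintro x ⟨a, rfl, h1⟩ ⟨b, hb, h2⟩
      rw [Option.some_inj] at hb
      subst hb
      have := List.suffix_of_suffix_length_le h1 h2 (by simp [s1, s2])
      have := this.eq_of_length_le (by simp [s1, s2])
      simp [s1, s2] at this
    · exact ⟨_, rfl, _, rfl, Or.inr ⟨true, rfl⟩⟩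
    · exact ⟨_, rfl, _, rfl, Or.inr ⟨false, rfl⟩⟩

theorem IsKConnected.le {V : Type*} [Fintype V] {G : SimpleGraph V} {k j : ℕ}
    (h : IsKConnected k G) (hj : j ≤ k) : IsKConnected j G :=
  ⟨by have := h.1; omega, fun S hS => h.2 S (by omega)⟩

theorem gP_PG {W : Type} {H : SimpleGraph W} {g : ℕ} (hg : g ≤ 2) (h : gProperty H g) :
    ∃ k, IsMinor H (PG k) := by
  obtain ⟨p, hp, h⟩ := h
  refine ⟨2 * (p + 1), ?_⟩
  by_contra hcon
  have h1 := h _ (PG (2 * (p + 1))) ((PG_conn _ (by omega)).le hg) hcon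
  have h2 := rk_pathwidth (PG_rk (2 * (p + 1)) (2 * (p + 1)) ⟨[], by simp⟩ (by simp))
  omega


/-! Family two: the dyadic outerplanar graphs -/

section noncross
variable {V : Type*} [LinearOrder V] {G : SimpleGraph V}

theorem noncross (hnc : ∀ a c b d, a < c → c < b → b < d → G.Adj a b → ¬ G.Adj c d)
    {A B : Set V} (hA : Cn G A) (hB : Cn G B) (hd : Disjoint A B) {a b c d : V} (ha : a ∈ A)
    (hb : b ∈ A) (hc : c ∈ B) (hdB : d ∈ B) (h1 : a < c) (h2 : c < b) (h3 : b < d) : False := by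
  have hAB : ∀ x ∈ A, ∀ y ∈ B, x ≠ y := fun x hx y hy h => Set.disjoint_left.1 hd hx (h ▸ hy)
  obtain ⟨x, ⟨hx, hxc, hxd⟩, y, ⟨hy, hyT⟩, e⟩ := hA.cut (T := Set.Ioo c d)
    ⟨b, hb, h2, h3⟩ ⟨a, ha, fun h => absurd h.1 h1.not_gt⟩
  -- general crossing
  have key : ∀ p q, p ∈ A → q ∈ A → G.Adj p q → p < q → (B ∩ Set.Ioo p q).Nonempty →
      (B \ Set.Ioo p q).Nonempty → False := by
    intro p q hp hq e hpq n1 n2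
    obtain ⟨u, ⟨hu, hup, huq⟩, w, ⟨hw, hwT⟩, e'⟩ := hB.cut n1 n2
    rcases lt_or_gt_of_ne (hAB p hp w hw) with h | h
    · have : q < w := by
        rcases lt_or_gt_of_ne (hAB q hq w hw) with h' | h'
        · exact h'
        · exact absurd ⟨h, h'⟩ hwT
      exact hnc p u q w hup huq this e e'
    · exact hnc w p u q h hup huq e'.symm e
  rcases lt_or_gt_of_ne (hAB y hy c hc) with h | h
  · exact key y x hy hx e.symm (h.trans hxc) ⟨c, hc, h, hxc⟩
      ⟨d, hdB, fun hh => absurd hh.2 hxd.not_gt⟩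
  · have : d < y := by
      rcases lt_or_gt_of_ne (hAB y hy d hdB) with h' | h'
      · exact absurd ⟨h, h'⟩ hyT
      · exact h'
    exact key x y hx hy e (hxd.trans this) ⟨d, hdB, hxd, this⟩
      ⟨c, hc, fun hh => absurd hh.1 hxc.not_gt⟩

theorem noncross_K4 (hnc : ∀ a c b d, a < c → c < b → b < d → G.Adj a b → ¬ G.Adj c d) :
    ¬ IsMinor K4 G := by
  rintro ⟨f, -, h1, h2, h3⟩
  choose x hx using fun i => Cn.nonempty (h1 i)
  have hinj : Function.Injective x := by
    intro i j hij
    by_contra hne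
    exact Set.disjoint_left.1 (h2 i j hne) (hx i) (hij ▸ hx j)
  have hadj : ∀ i j, i ≠ j → Tch G (f i) (f j) := fun i j hij => h3 i j (by simpa [K4] using hij)
  let σ := Tuple.sort x
  have hm : StrictMono (x ∘ σ) :=
    (Tuple.monotone_sort x).strictMono_of_injective (hinj.comp σ.injective)
  have hne : ∀ i j, i ≠ j → σ i ≠ σ j := fun i j h => σ.injective.ne h
  refine noncross hnc (A := f (σ 0) ∪ f (σ 2)) (B := f (σ 1) ∪ f (σ 3))
    (Cn.union (h1 _) (h1 _) (hadj _ _ (hne _ _ (by decide))))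
    (Cn.union (h1 _) (h1 _) (hadj _ _ (hne _ _ (by decide)))) ?_ (Or.inl (hx _)) (Or.inr (hx _))
    (Or.inl (hx _)) (Or.inr (hx _)) (hm (by decide)) (hm (by decide)) (hm (by decide))
  simp only [Set.disjoint_union_left, Set.disjoint_union_right]
  exact ⟨⟨h2 _ _ (hne _ _ (by decide)), h2 _ _ (hne _ _ (by decide))⟩,
    h2 _ _ (hne _ _ (by decide)), h2 _ _ (hne _ _ (by decide))⟩

end noncross

theorem noncross_side {N : ℕ} {G : SimpleGraph (Fin N)}
    (hnc : ∀ a c b d, a < c → c < b → b < d → G.Adj a b → ¬ G.Adj c d)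
    {X Y P Q : Set (Fin N)} (hX : Cn G X) (hY : Cn G Y) (hP : Cn G P) (hQ : Cn G Q)
    (d1 : Disjoint X Y) (d2 : Disjoint X P) (d3 : Disjoint X Q) (d4 : Disjoint Y P)
    (d5 : Disjoint Y Q) (d6 : Disjoint P Q) (t1 : Tch G X P) (t2 : Tch G X Q) (t3 : Tch G Y P)
    (t4 : Tch G Y Q) {x y p q : Fin N} (hx : x ∈ X) (hy : y ∈ Y) (hp : p ∈ P) (hq : q ∈ Q) :
    ¬ ((min x y < p ∧ p < max x y) ↔ (min x y < q ∧ q < max x y)) := by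
  have n1 : ∀ a ∈ X ∪ Q, ∀ b ∈ X ∪ Q, ∀ c ∈ Y ∪ P, ∀ d ∈ Y ∪ P,
      ¬ (a < c ∧ c < b ∧ b < d) ∧ ¬ (c < a ∧ a < d ∧ d < b) := by
    intro a ha b hb c hc d hd
    have hdd : Disjoint (X ∪ Q) (Y ∪ P) := by
      simp only [Set.disjoint_union_left, Set.disjoint_union_right]
      exact ⟨⟨d1, d5.symm⟩, d2, d6.symm⟩
    exact ⟨fun h => noncross hnc (hX.union hQ t2) (hY.union hP t3) hdd ha hb hc hd h.1 h.2.1 h.2.2,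
     fun h => noncross hnc (hY.union hP t3) (hX.union hQ t2) hdd.symm hc hd ha hb h.1 h.2.1 h.2.2⟩
  have n2 : ∀ a ∈ X ∪ P, ∀ b ∈ X ∪ P, ∀ c ∈ Y ∪ Q, ∀ d ∈ Y ∪ Q,
      ¬ (a < c ∧ c < b ∧ b < d) ∧ ¬ (c < a ∧ a < d ∧ d < b) := by
    intro a ha b hb c hc d hd
    have hdd : Disjoint (X ∪ P) (Y ∪ Q) := by
      simp only [Set.disjoint_union_left, Set.disjoint_union_right]
      exact ⟨⟨d1, d4.symm⟩, d3, d6⟩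
    exact ⟨fun h => noncross hnc (hX.union hP t1) (hY.union hQ t4) hdd ha hb hc hd h.1 h.2.1 h.2.2,
     fun h => noncross hnc (hY.union hQ t4) (hX.union hP t1) hdd.symm hc hd ha hb h.1 h.2.1 h.2.2⟩
  have a1 := n1 x (Or.inl hx) q (Or.inr hq) y (Or.inl hy) p (Or.inr hp)
  have a2 := n1 q (Or.inr hq) x (Or.inl hx) y (Or.inl hy) p (Or.inr hp)
  have a3 := n1 x (Or.inl hx) q (Or.inr hq) p (Or.inr hp) y (Or.inl hy)
  have a4 := n1 q (Or.inr hq) x (Or.inl hx) p (Or.inr hp) y (Or.inl hy)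
  have b1 := n2 x (Or.inl hx) p (Or.inr hp) y (Or.inl hy) q (Or.inr hq)
  have b2 := n2 p (Or.inr hp) x (Or.inl hx) y (Or.inl hy) q (Or.inr hq)
  have b3 := n2 x (Or.inl hx) p (Or.inr hp) q (Or.inr hq) y (Or.inl hy)
  have b4 := n2 p (Or.inr hp) x (Or.inl hx) q (Or.inr hq) y (Or.inl hy)
  have e1 : x ≠ y := fun h => Set.disjoint_left.1 d1 hx (h ▸ hy)
  have e2 : x ≠ p := fun h => Set.disjoint_left.1 d2 hx (h ▸ hp)
  have e3 : x ≠ q := fun h => Set.disjoint_left.1 d3 hx (h ▸ hq)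
  have e4 : y ≠ p := fun h => Set.disjoint_left.1 d4 hy (h ▸ hp)
  have e5 : y ≠ q := fun h => Set.disjoint_left.1 d5 hy (h ▸ hq)
  have e6 : p ≠ q := fun h => Set.disjoint_left.1 d6 hp (h ▸ hq)
  clear n1 n2
  rcases lt_or_gt_of_ne e1 with h | h
  · rw [min_eq_left h.le, max_eq_right h.le]
    omega
  · rw [min_eq_right h.le, max_eq_left h.le]
    omega

theorem noncross_K23 {N : ℕ} {G : SimpleGraph (Fin N)}
    (hnc : ∀ a c b d, a < c → c < b → b < d → G.Adj a b → ¬ G.Adj c d) : ¬ IsMinor K23 G := by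
  rintro ⟨f, -, h1, h2, h3⟩
  choose x hx using fun i => Cn.nonempty (h1 i)
  have key : ∀ i j : Fin 3, i ≠ j → _ := fun i j hij =>
    noncross_side hnc (h1 (Sum.inl 0)) (h1 (Sum.inl 1)) (h1 (Sum.inr i)) (h1 (Sum.inr j))
      (h2 _ _ (by simp)) (h2 _ _ (by simp)) (h2 _ _ (by simp)) (h2 _ _ (by simp))
      (h2 _ _ (by simp)) (h2 _ _ (by simpa using hij)) (h3 _ _ (by simp [K23]))
      (h3 _ _ (by simp [K23])) (h3 _ _ (by simp [K23])) (h3 _ _ (by simp [K23]))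
      (hx _) (hx _) (hx _) (hx _)
  have k1 := key 0 1 (by decide)
  have k2 := key 0 2 (by decide)
  have k3 := key 1 2 (by decide)
  tauto

def QE (a b : ℕ) : Prop := ∃ i j, a = j * 2 ^ i ∧ b = (j + 1) * 2 ^ i

def QG (k : ℕ) : SimpleGraph (Fin (2 ^ k + 1)) where
  Adj a b := QE a b ∨ QE b a
  symm := ⟨fun _ _ h => Or.symm h⟩
  loopless := ⟨by
    rintro a (⟨i, j, h1, h2⟩ | ⟨i, j, h1, h2⟩) <;>
    · rw [h1, add_mul] at h2
      have := Nat.two_pow_pos i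
      omega⟩

theorem QE_lt {a b : ℕ} (h : QE a b) : a < b := by
  obtain ⟨i, j, rfl, rfl⟩ := h
  have := Nat.two_pow_pos i
  rw [add_mul]
  omega

theorem QG_nc (k : ℕ) : ∀ a c b d, a < c → c < b → b < d → (QG k).Adj a b → ¬ (QG k).Adj c d := by
  intro a c b d h1 h2 h3 e1 e2
  have e1' : QE a b := by
    rcases e1 with h | h
    · exact h
    · have := QE_lt h; omega
  have e2' : QE c d := by
    rcases e2 with h | h
    · exact h
    · have := QE_lt h; omega
  obtain ⟨i, j, ha, hb⟩ := e1'
  obtain ⟨i', j', hc, hd⟩ := e2'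
  have h1 : (a : ℕ) < c := h1
  have h2 : (c : ℕ) < b := h2
  have h3 : (b : ℕ) < d := h3
  have gen : ∀ q t m : ℕ, m * q < t * q → t * q < (m + 1) * q → False := by
    intro q t m h1 h2
    have h1 := Nat.lt_of_mul_lt_mul_right h1
    have h2 := Nat.lt_of_mul_lt_mul_right h2
    omega
  rcases le_total i i' with h | h
  · obtain ⟨e, rfl⟩ := Nat.exists_eq_add_of_le h
    refine gen (2 ^ i) (j' * 2 ^ e) j ?_ ?_
    · rw [← ha]
      calc (a : ℕ) < c := h1
        _ = _ := by rw [hc, pow_add]; ring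
    · rw [← hb]
      calc _ = (c : ℕ) := by rw [hc, pow_add]; ring
        _ < _ := h2
  · obtain ⟨e, rfl⟩ := Nat.exists_eq_add_of_le h
    refine gen (2 ^ i') ((j + 1) * 2 ^ e) j' ?_ ?_
    · rw [← hc]
      calc (c : ℕ) < b := h2
        _ = _ := by rw [hb, pow_add]; ring
    · rw [← hd]
      calc _ = (b : ℕ) := by rw [hb, pow_add]; ring
        _ < _ := h3

def ivl (k a b : ℕ) : Set (Fin (2 ^ k + 1)) := {v | a ≤ v.1 ∧ v.1 < b}

theorem ivl_cn (k a b : ℕ) (h : a < b) (hb : b ≤ 2 ^ k + 1) : Cn (QG k) (ivl k a b) := by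
  refine cn_of_cut_at (x := ⟨a, by omega⟩) ⟨le_rfl, h⟩ fun T hT hx hn => ?_
  obtain ⟨t, ht, hmin⟩ := exists_minimalFor_of_wellFoundedLT (· ∈ (ivl k a b \ T)) id hn
  have hta : a ≠ t.1 := by
    intro hta
    exact ht.2 (by convert hx; exact hta.symm)
  have h1 := ht.1.1
  have h2 := ht.1.2
  refine ⟨⟨t.1 - 1, by omega⟩, ?_, t, ht, Or.inl ⟨0, t.1 - 1, by simp, by simp; omega⟩⟩
  by_contra hcon
  have := hmin (j := ⟨t.1 - 1, by omega⟩) ⟨⟨by simp; omega, by simp; omega⟩, hcon⟩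
    (by simp [Fin.le_def])
  simp only [id, Fin.le_def] at this
  omega

theorem QG_conn (k : ℕ) (hk : 1 ≤ k) : IsKConnected 2 (QG k) := by
  have h2k : 2 ≤ 2 ^ k := by
    calc 2 = 2 ^ 1 := by norm_num
      _ ≤ _ := Nat.pow_le_pow_right (by norm_num) hk
  constructor
  · simp; omega
  · intro S hS
    change Cn (QG k) _
    by_cases h0 : S.card = 0
    · rw [Finset.card_eq_zero] at h0
      subst h0
      convert ivl_cn k 0 (2 ^ k + 1) (by omega) le_rfl
      ext v
      simp [ivl]
      omega
    · obtain ⟨s, rfl⟩ := Finset.card_eq_one.1 (show S.card = 1 by omega)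
      have hs := s.2
      by_cases hs0 : s.1 = 0
      · convert ivl_cn k 1 (2 ^ k + 1) (by omega) le_rfl
        ext v
        simp [ivl, Fin.ext_iff]
        omega
      by_cases hs1 : s.1 = 2 ^ k
      · convert ivl_cn k 0 (2 ^ k) (by omega) (by omega)
        ext v
        simp [ivl, Fin.ext_iff]
        omega
      convert Cn.union (ivl_cn k 0 s.1 (by omega) (by omega))
        (ivl_cn k (s.1 + 1) (2 ^ k + 1) (by omega) le_rfl)
        ⟨⟨0, by omega⟩, ⟨le_rfl, by change 0 < s.1; omega⟩, ⟨2 ^ k, by omega⟩,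
          ⟨by simp; omega, by simp⟩, Or.inl ⟨k, 0, by simp, by simp⟩⟩
      ext v
      simp [ivl, Fin.ext_iff]
      omega

theorem QG_rk (k l : ℕ) : ∀ (i j : ℕ) (_ : 2 * l ≤ i) (h : (j + 1) * 2 ^ i ≤ 2 ^ k),
    Rk (QG k) l ⟨j * 2 ^ i, by rw [add_mul] at h; omega⟩ (ivl k (j * 2 ^ i) ((j + 1) * 2 ^ i)) := by
  induction l with
  | zero =>
    intro i j hi h
    have := Nat.two_pow_pos i
    exact ⟨⟨le_rfl, by simp only [add_mul]; omega⟩, ivl_cn k _ _ (by rw [add_mul]; omega)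
      (by omega)⟩
  | succ l ih =>
    intro i j hi h
    obtain ⟨i, rfl⟩ : ∃ i', i = i' + 2 := ⟨i - 2, by omega⟩
    have hq := Nat.two_pow_pos i
    have e0 : j * 2 ^ (i + 2) = 4 * j * 2 ^ i := by ring
    have e1 : (j + 1) * 2 ^ (i + 2) = 4 * j * 2 ^ i + 4 * 2 ^ i := by ring
    have e2 : (4 * j + 1) * 2 ^ i = 4 * j * 2 ^ i + 2 ^ i := by ring
    have e3 : (4 * j + 1 + 1) * 2 ^ i = 4 * j * 2 ^ i + 2 * 2 ^ i := by ring
    have e4 : (2 * j + 1) * 2 ^ (i + 1) = 4 * j * 2 ^ i + 2 * 2 ^ i := by ring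
    have e5 : (2 * j + 1 + 1) * 2 ^ (i + 1) = 4 * j * 2 ^ i + 4 * 2 ^ i := by ring
    have r1 := ih i (4 * j + 1) (by omega) (by omega)
    have r2 := ih (i + 1) (2 * j + 1) (by omega) (by omega)
    refine ⟨ivl k (4 * j * 2 ^ i) ((4 * j + 1) * 2 ^ i), _, _, _, _, ?_, ?_, ?_, ?_, ?_,
      ivl_cn k _ _ (by omega) (by omega), ?_, ?_, r1, r2⟩
    · ext v
      simp only [ivl, Set.mem_union, Set.mem_ofPred_eq]
      omega
    · rw [Set.disjoint_left]
      rintro v ⟨h1, h2⟩ ⟨h3, h4⟩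
      omega
    · rw [Set.disjoint_left]
      rintro v ⟨h1, h2⟩ ⟨h3, h4⟩
      omega
    · rw [Set.disjoint_left]
      rintro v ⟨h1, h2⟩ ⟨h3, h4⟩
      omega
    · exact ⟨by simp only; omega, by simp only; omega⟩
    · exact ⟨⟨4 * j * 2 ^ i, by omega⟩, ⟨le_rfl, by simp only; omega⟩, _, rfl,
        Or.inl ⟨i, 4 * j, rfl, rfl⟩⟩
    · exact ⟨⟨4 * j * 2 ^ i, by omega⟩, ⟨le_rfl, by simp only; omega⟩, _, rfl,
        Or.inl ⟨i + 1, 2 * j, by simp only; ring, rfl⟩⟩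

theorem gP_QG {W : Type} {H : SimpleGraph W} {g : ℕ} (hg : g ≤ 2) (h : gProperty H g) :
    ∃ k, IsMinor H (QG k) := by
  obtain ⟨p, hp, h⟩ := h
  refine ⟨2 * (2 * (p + 1)), ?_⟩
  by_contra hcon
  have h1 := h _ (QG (2 * (2 * (p + 1)))) ((QG_conn _ (by omega)).le hg) hcon
  have h2 := rk_pathwidth (QG_rk (2 * (2 * (p + 1))) (2 * (p + 1)) (2 * (2 * (p + 1))) 0 le_rfl
    (by simp))
  omega

theorem part_one {W : Type} {H : SimpleGraph W} {g : ℕ} (hg : g ≤ 2) (h : gProperty H g) :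
    ¬ IsMinor K4 H ∧ ¬ IsMinor K23 H ∧ ¬ IsMinor C32 H ∧ ¬ IsMinor graphA H := by
  obtain ⟨k, hP⟩ := gP_PG hg h
  obtain ⟨l, hQ⟩ := gP_QG hg h
  exact ⟨fun hh => noncross_K4 (QG_nc l) (hh.trans hQ), fun hh => noncross_K23 (QG_nc l)
    (hh.trans hQ), fun hh => PG_no_C32 k (hh.trans hP), fun hh => PG_no_A k (hh.trans hP)⟩


/-! Structure of H, part one -/

section core
variable {V : Type*} {G : SimpleGraph V}

def MinorIn {W V : Type*} (K : SimpleGraph W) (G : SimpleGraph V) (S : Set V) : Prop :=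
  ∃ f : W → Set V, (∀ w, Cn G (f w)) ∧ (∀ w, f w ⊆ S) ∧
    (∀ a b, a ≠ b → Disjoint (f a) (f b)) ∧ ∀ a b, K.Adj a b → Tch G (f a) (f b)

theorem MinorIn.isMinor {W : Type*} {K : SimpleGraph W} {S : Set V} (h : MinorIn K G S) :
    IsMinor K G := by
  obtain ⟨f, h1, -, h2, h3⟩ := h
  exact isMinor_mk f h1 h2 h3

theorem MinorIn.mono {W : Type*} {K : SimpleGraph W} {S T : Set V} (h : MinorIn K G S)
    (hs : S ⊆ T) : MinorIn K G T := by
  obtain ⟨f, h1, h2, h3⟩ := h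
  exact ⟨f, h1, fun w => (h2 w).trans hs, h3⟩

theorem minorIn_fin {n : ℕ} {K : SimpleGraph (Fin n)} {S : Set V} (f : Fin n → Set V)
    (h1 : ∀ i, Cn G (f i)) (h2 : ∀ i, f i ⊆ S) (h3 : ∀ i j, i < j → Disjoint (f i) (f j))
    (h4 : ∀ i j, i < j → K.Adj i j → Tch G (f i) (f j)) : MinorIn K G S := by
  refine ⟨f, h1, h2, fun i j hij => ?_, fun i j hij => ?_⟩
  · rcases lt_or_gt_of_ne hij with h | h
    · exact h3 i j h
    · exact (h3 j i h).symm
  · rcases lt_or_gt_of_ne hij.ne with h | h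
    · exact h4 i j h hij
    · exact (h4 j i h hij.symm).symm

def Tri (G : SimpleGraph V) (S : Set V) : Prop := MinorIn (⊤ : SimpleGraph (Fin 3)) G S

theorem tri_mk {S A B C : Set V} (hA : Cn G A) (hB : Cn G B) (hC : Cn G C) (sA : A ⊆ S)
    (sB : B ⊆ S) (sC : C ⊆ S) (d1 : Disjoint A B) (d2 : Disjoint A C) (d3 : Disjoint B C)
    (t1 : Tch G A B) (t2 : Tch G A C) (t3 : Tch G B C) : Tri G S := by
  refine minorIn_fin ![A, B, C] ?_ ?_ ?_ ?_
  · intro i; fin_cases i <;> assumption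
  · intro i; fin_cases i <;> assumption
  · intro i j hij; fin_cases i <;> fin_cases j <;> first | assumption | simp at hij
  · intro i j hij _; fin_cases i <;> fin_cases j <;> first | assumption | simp at hij

theorem k4_mk {S A B C D : Set V} (hA : Cn G A) (hB : Cn G B) (hC : Cn G C) (hD : Cn G D)
    (sA : A ⊆ S) (sB : B ⊆ S) (sC : C ⊆ S) (sD : D ⊆ S)
    (d1 : Disjoint A B) (d2 : Disjoint A C) (d3 : Disjoint A D) (d4 : Disjoint B C)
    (d5 : Disjoint B D) (d6 : Disjoint C D)
    (t1 : Tch G A B) (t2 : Tch G A C) (t3 : Tch G A D) (t4 : Tch G B C) (t5 : Tch G B D)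
    (t6 : Tch G C D) : MinorIn K4 G S := by
  refine minorIn_fin ![A, B, C, D] ?_ ?_ ?_ ?_
  · intro i; fin_cases i <;> assumption
  · intro i; fin_cases i <;> assumption
  · intro i j hij; fin_cases i <;> fin_cases j <;> first | assumption | simp at hij
  · intro i j hij _; fin_cases i <;> fin_cases j <;> first | assumption | simp at hij

theorem c32_mk {S T S' : Set V} (h1 : Tri G S) (h2 : Tri G T) (hd : Disjoint S T)
    (hS : S ⊆ S') (hT : T ⊆ S') : MinorIn C32 G S' := by
  obtain ⟨f, f1, f2, f3, f4⟩ := h1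
  obtain ⟨g, g1, g2, g3, g4⟩ := h2
  refine ⟨fun p => if p.1 = 0 then f p.2 else g p.2, ?_, ?_, ?_, ?_⟩
  · rintro ⟨i, j⟩
    by_cases h : i = 0 <;> simp [h, f1, g1]
  · rintro ⟨i, j⟩
    by_cases h : i = 0 <;> simp [h, (f2 j).trans hS, (g2 j).trans hT]
  · rintro ⟨i, j⟩ ⟨i', j'⟩ hne
    by_cases h : i = 0 <;> by_cases h' : i' = 0 <;> simp only [h, h', if_true, if_false]
    · exact f3 _ _ (by rintro rfl; exact hne (by rw [h, h']))
    · exact hd.mono (f2 _) (g2 _)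
    · exact (hd.mono (f2 _) (g2 _)).symm
    · exact g3 _ _ (by rintro rfl; exact hne (by rw [show i = i' by omega]))
  · rintro ⟨i, j⟩ ⟨i', j'⟩ he
    simp only [C32, fromRel_adj, ne_eq, Prod.mk.injEq] at he
    have hii : i = i' := he.2.elim id Eq.symm
    subst hii
    by_cases h : i = 0 <;> simp only [h, if_true, if_false]
    · exact f4 _ _ (by simpa using he.1)
    · exact g4 _ _ (by simpa using he.1)

def two (G : SimpleGraph V) (T : Set V) (v : V) : Prop :=
  ∃ a ∈ T, ∃ b ∈ T, a ≠ b ∧ G.Adj v a ∧ G.Adj v b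

theorem two.mono {T T' : Set V} {v : V} (h : two G T v) (hT : T ⊆ T') : two G T' v := by
  obtain ⟨a, ha, b, hb, h⟩ := h
  exact ⟨a, hT ha, b, hT hb, h⟩

def Core (G : SimpleGraph V) (T : Set V) : Prop := T.Nonempty ∧ ∀ v ∈ T, two G T v

def Acy (G : SimpleGraph V) (S : Set V) : Prop := ∀ T ⊆ S, ¬ Core G T

theorem Acy.mono {S T : Set V} (h : Acy G S) (hT : T ⊆ S) : Acy G T := fun U hU =>
  h U (hU.trans hT)

theorem Acy.leaf {F T : Set V} (h : Acy G F) (hT : T ⊆ F) (hn : T.Nonempty) :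
    ∃ z ∈ T, ¬ two G T z := by
  by_contra hcon
  push Not at hcon
  exact h T hT ⟨hn, hcon⟩

theorem core_of_exc [Finite V] {T : Set V} {y : V} (hn : (T \ {y}).Nonempty)
    (h : ∀ v ∈ T, v ≠ y → two G T v) : ∃ T' ⊆ T, Core G T' := by
  induction hN : T.ncard using Nat.strong_induction_on generalizing T y with
  | _ n ih =>
  by_cases hy : y ∈ T
  · by_cases hy2 : two G T y
    · refine ⟨T, le_rfl, ⟨y, hy⟩, fun v hv => ?_⟩
      by_cases hvy : v = y
      · exact hvy ▸ hy2
      · exact h v hv hvy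
    · have hlt : (T \ {y}).ncard < n := by
        rw [← hN]
        exact Set.ncard_lt_ncard ⟨Set.sdiff_subset, fun hh => (hh hy).2 rfl⟩
      by_cases hz : ∃ z ∈ T, G.Adj y z
      · obtain ⟨z, hzT, hz⟩ := hz
        have honly : ∀ w ∈ T, G.Adj y w → w = z := by
          intro w hw hyw
          by_contra hne
          exact hy2 ⟨w, hw, z, hzT, hne, hyw, hz⟩
        obtain ⟨T', hT', hc⟩ := ih _ hlt (T := T \ {y}) (y := z) (by
          obtain ⟨a, ha, b, hb, hab, h1, h2⟩ := h z hzT hz.ne'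
          by_cases hay : a = y
          · exact ⟨b, ⟨hb, fun hby => hab (hay.trans hby.symm)⟩, h2.ne'⟩
          · exact ⟨a, ⟨ha, hay⟩, h1.ne'⟩) (by
          rintro v ⟨hv, hvy⟩ hvz
          obtain ⟨a, ha, b, hb, hab, h1, h2⟩ := h v hv hvy
          exact ⟨a, ⟨ha, fun hh => hvz (honly v hv (hh ▸ h1.symm))⟩, b,
            ⟨hb, fun hh => hvz (honly v hv (hh ▸ h2.symm))⟩, hab, h1, h2⟩) rfl
        exact ⟨T', hT'.trans Set.sdiff_subset, hc⟩
      · push Not at hz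
        refine ⟨T \ {y}, Set.sdiff_subset, hn, ?_⟩
        rintro v ⟨hv, hvy⟩
        obtain ⟨a, ha, b, hb, hab, h1, h2⟩ := h v hv hvy
        exact ⟨a, ⟨ha, fun hh => hz v hv (hh ▸ h1.symm)⟩, b,
          ⟨hb, fun hh => hz v hv (hh ▸ h2.symm)⟩, hab, h1, h2⟩
  · exact ⟨T, le_rfl, hn.mono Set.sdiff_subset, fun v hv => h v hv (fun hh => hy (hh ▸ hv))⟩

theorem Acy.leaf_ne [Finite V] {F T : Set V} (h : Acy G F) (hT : T ⊆ F) {y : V}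
    (hn : (T \ {y}).Nonempty) : ∃ z ∈ T, z ≠ y ∧ ¬ two G T z := by
  by_contra hcon
  push Not at hcon
  obtain ⟨T', hT', hc⟩ := core_of_exc hn hcon
  exact h T' (hT'.trans hT) hc

theorem Core.tri [Finite V] {T : Set V} (h : Core G T) : Tri G T := by
  have main : ∀ n, ∀ x ∈ T, ∀ d ∈ T \ {x}, (cpt G (T \ {x}) d).ncard = n → Tri G T := by
    intro n
    induction n using Nat.strong_induction_on with
    | _ n ih =>
    intro x hx d hd hn
    set D := cpt G (T \ {x}) d with hD
    have hDc : Cn G D := cpt_cn hd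
    have hDT : D ⊆ T \ {x} := cpt_sub
    by_cases h2 : two G D x
    · obtain ⟨p, hp, q, hq, hpq, e1, e2⟩ := h2
      obtain ⟨A, B, hpA, hqB, hA, hB, hd, hU, ht⟩ := split2 hDc hp hq hpq
      have hAD : A ⊆ D := hU ▸ Set.subset_union_left
      have hBD : B ⊆ D := hU ▸ Set.subset_union_right
      refine tri_mk (cn_singleton x) hA hB (by simpa) (fun z hz => (hDT (hAD hz)).1)
        (fun z hz => (hDT (hBD hz)).1) ?_ ?_ hd ⟨x, rfl, p, hpA, e1⟩ ⟨x, rfl, q, hqB, e2⟩ ht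
      · exact Set.disjoint_singleton_left.2 fun hh => (hDT (hAD hh)).2 rfl
      · exact Set.disjoint_singleton_left.2 fun hh => (hDT (hBD hh)).2 rfl
    · obtain ⟨d0, hd0, honly⟩ : ∃ d0 ∈ D, ∀ w ∈ D, G.Adj x w → w = d0 := by
        by_cases hz : ∃ z ∈ D, G.Adj x z
        · obtain ⟨z, hz, hxz⟩ := hz
          refine ⟨z, hz, fun w hw hxw => ?_⟩
          by_contra hne
          exact h2 ⟨w, hw, z, hz, hne, hxw, hxz⟩
        · push Not at hz
          exact ⟨d, mem_cpt hd, fun w hw hh => absurd hh (hz w hw)⟩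
      have hcl : ∀ p ∈ D, ∀ q ∈ T, G.Adj p q → q ∈ D ∨ q = x := by
        intro p hp q hq e
        by_cases hqx : q = x
        · exact Or.inr hqx
        · exact Or.inl (cpt_closed hp ⟨hq, hqx⟩ e)
      obtain ⟨d', hd', hdd'⟩ : ∃ d' ∈ D, G.Adj d0 d' := by
        obtain ⟨a, ha, b, hb, hab, h1, h2⟩ := h.2 d0 (hDT hd0).1
        rcases hcl d0 hd0 a ha h1 with h' | h'
        · exact ⟨a, h', h1⟩
        · rcases hcl d0 hd0 b hb h2 with h'' | h''
          · exact ⟨b, h'', h2⟩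
          · exact absurd (h'.trans h''.symm) hab
      have hd'T : d' ∈ T \ {d0} := ⟨(hDT hd').1, hdd'.ne'⟩
      have hsub : cpt G (T \ {d0}) d' ⊆ D := by
        by_contra hns
        rw [Set.not_subset] at hns
        obtain ⟨w, hw, hwD⟩ := hns
        obtain ⟨a, ⟨ha, haD⟩, b, ⟨hb, hbD⟩, e⟩ := (cpt_cn (G := G) hd'T).cut (T := D)
          ⟨d', mem_cpt hd'T, hd'⟩ ⟨w, hw, hwD⟩
        rcases hcl a haD b (cpt_sub hb).1 e with h' | h'
        · exact hbD h'
        · subst h'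
          exact (cpt_sub ha).2 (honly a haD e.symm)
      refine ih _ ?_ d0 (hDT hd0).1 d' hd'T rfl
      rw [← hn]
      exact Set.ncard_lt_ncard ⟨hsub, fun hh => (cpt_sub (hh hd0)).2 rfl⟩
  obtain ⟨x, hx⟩ := h.1
  obtain ⟨a, ha, b, hb, hab, h1, h2⟩ := h.2 x hx
  exact main _ x hx a ⟨ha, h1.ne'⟩ rfl

theorem Cn.diff_leaf {D : Set V} {w : V} (h : Cn G D) (hw : ¬ two G D w)
    (hn : (D \ {w}).Nonempty) : Cn G (D \ {w}) := by
  by_cases hwD : w ∈ D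
  · refine cn_of_cut hn fun T hT hTn hTc => ?_
    by_contra hcon
    obtain ⟨a, ⟨ha, haT⟩, b, ⟨hb, hbT⟩, e⟩ := h.cut (T := T)
      (hTn.mono fun z hz => ⟨(hT hz).1, hz⟩) (hTc.mono fun z hz => ⟨hz.1.1, hz.2⟩)
    have hbw : b = w := by
      by_contra hbw
      exact hcon ⟨a, haT, b, ⟨⟨hb, hbw⟩, hbT⟩, e⟩
    obtain ⟨a', ⟨ha', haT'⟩, b', ⟨hb', hbT'⟩, e'⟩ := h.cut (T := (D \ {w}) \ T)
      (hTc.mono fun z hz => ⟨hz.1.1, hz⟩) ⟨w, hwD, fun hh => hh.1.2 rfl⟩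
    have hbw' : b' = w := by
      by_contra hbw
      refine hcon (Tch.symm ⟨a', haT', b', ?_, e'⟩)
      by_contra hbT
      exact hbT' ⟨⟨hb', hbw⟩, hbT⟩
    subst hbw
    subst hbw'
    exact hw ⟨a, ha, a', ha', fun hh => haT'.2 (hh ▸ haT), e.symm, e'.symm⟩
  · rwa [Set.sdiff_singleton_eq_self hwD]

/-- no second connection between the ends of an edge of an acyclic set -/
theorem Acy.edge [Finite V] {F D : Set V} (hF : Acy G F) {a b : V} (hab : G.Adj a b) (hD : D ⊆ F)
    (ha : a ∈ D) (hb : b ∈ D) (hc : Cn (G.deleteEdges {s(a, b)}) D) : False := by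
  induction hn : D.ncard using Nat.strong_induction_on generalizing D with
  | _ n ih =>
  set G' := G.deleteEdges {s(a, b)} with hG'
  have hle : ∀ x y, G'.Adj x y → G.Adj x y := fun x y h => (deleteEdges_adj.1 h).1
  have hnab : ¬ G'.Adj a b := by simp [hG']
  by_cases h : ∃ w ∈ D, w ≠ a ∧ w ≠ b ∧ ¬ two G' D w
  · obtain ⟨w, hw, hwa, hwb, h2⟩ := h
    refine ih (D \ {w}).ncard ?_ (Set.sdiff_subset.trans hD) ⟨ha, hwa.symm⟩ ⟨hb, hwb.symm⟩
      (hc.diff_leaf h2 ⟨a, ha, hwa.symm⟩) rfl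
    rw [← hn]
    exact Set.ncard_lt_ncard ⟨Set.sdiff_subset, fun hh => (hh hw).2 rfl⟩
  · push Not at h
    refine hF D hD ⟨⟨a, ha⟩, fun v hv => ?_⟩
    have gen : ∀ x y, x ∈ D → y ∈ D → G.Adj x y → ¬ G'.Adj x y → two G D x := by
      intro x y hx hy e e'
      obtain ⟨p, ⟨hp, hpx⟩, q, ⟨hq, hqx⟩, epq⟩ := hc.cut (T := {x}) ⟨x, hx, rfl⟩ ⟨y, hy, e.ne'⟩
      rw [Set.mem_singleton_iff] at hpx
      subst hpx
      exact ⟨q, hq, y, hy, fun hh => e' (hh ▸ epq), hle _ _ epq, e⟩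
    by_cases hva : v = a
    · subst hva
      exact gen v b hv hb hab hnab
    by_cases hvb : v = b
    · subst hvb
      exact gen v a hv ha hab.symm (fun h => hnab h.symm)
    obtain ⟨p, hp, q, hq, hpq, e1, e2⟩ := h v hv hva hvb
    exact ⟨p, hp, q, hq, hpq, hle _ _ e1, hle _ _ e2⟩

theorem Acy.edge' [Finite V] {F A B : Set V} (hF : Acy G F) {a b : V} (hab : G.Adj a b)
    (hA : A ⊆ F) (hB : B ⊆ F) (ha : a ∈ A) (hb : b ∈ B) (haB : a ∉ B) (hbA : b ∉ A)
    (cA : Cn G A) (cB : Cn G B) : Disjoint A B := by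
  rw [Set.disjoint_left]
  intro z hzA hzB
  refine hF.edge hab (Set.union_subset hA hB) (Or.inl ha) (Or.inr hb)
    (Cn.union_inter (cA.mono_graph ?_) (cB.mono_graph ?_) ⟨z, hzA, hzB⟩)
  · intro x hx y hy e
    refine deleteEdges_adj.2 ⟨e, ?_⟩
    simp only [Set.mem_singleton_iff, Sym2.eq_iff]
    rintro (⟨rfl, rfl⟩ | ⟨rfl, rfl⟩)
    · exact hbA hy
    · exact hbA hx
  · intro x hx y hy e
    refine deleteEdges_adj.2 ⟨e, ?_⟩
    simp only [Set.mem_singleton_iff, Sym2.eq_iff]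
    rintro (⟨rfl, rfl⟩ | ⟨rfl, rfl⟩)
    · exact haB hx
    · exact haB hy

end core


/-! Graphs without `K4`, `C32`, `A` minors have an acyclic one-vertex-deleted subgraph -/

section IIa
variable {V : Type*} {H : SimpleGraph V}

def ctr (H : SimpleGraph V) (a u : V) : SimpleGraph V where
  Adj p q := p ≠ q ∧ (H.Adj p q ∨ (p = a ∧ H.Adj u q) ∨ (q = a ∧ H.Adj u p))
  symm := ⟨by
    rintro p q ⟨h, h'⟩
    refine ⟨h.symm, ?_⟩
    rcases h' with h' | h' | h'
    · exact Or.inl h'.symm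
    · exact Or.inr (Or.inr h')
    · exact Or.inr (Or.inl h')⟩
  loopless := ⟨fun p h => h.1 rfl⟩

theorem MinorIn.of_ctr {W : Type*} {K : SimpleGraph W} {S : Set V} {a u : V} (hau : H.Adj u a)
    (hu : u ∈ S) (h : MinorIn K (ctr H a u) (S \ {u})) : MinorIn K H S := by
  classical
  obtain ⟨f, h1, h2, h3, h4⟩ := h
  have hnu : ∀ w, u ∉ f w := fun w hw => (h2 w hw).2 rfl
  have key : ∀ w w' p q, p ∈ f w → q ∈ f w' → (ctr H a u).Adj p q →
      Tch H (if a ∈ f w then insert u (f w) else f w)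
        (if a ∈ f w' then insert u (f w') else f w') := by
    intro w w' p q hp hq e
    have s1 : ∀ w, f w ⊆ (if a ∈ f w then insert u (f w) else f w) := by
      intro w; split_ifs <;> simp
    obtain ⟨-, e | ⟨rfl, e⟩ | ⟨rfl, e⟩⟩ := e
    · exact ⟨p, s1 _ hp, q, s1 _ hq, e⟩
    · exact ⟨u, by simp [hp], q, s1 _ hq, e⟩
    · exact ⟨p, s1 _ hp, u, by simp [hq], e.symm⟩
  refine ⟨fun w => if a ∈ f w then insert u (f w) else f w, fun w => ?_, fun w => ?_,
    fun w w' hw => ?_, fun w w' e => ?_⟩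
  · by_cases ha : a ∈ f w
    · simp only [ha, if_true]
      refine cn_of_cut_at (x := a) (Or.inr ha) fun T hT haT hc => ?_
      by_cases hun : u ∈ T
      · have hne : (f w \ T).Nonempty := by
          obtain ⟨z, hz, hzT⟩ := hc
          rcases hz with rfl | hz
          · exact absurd hun hzT
          · exact ⟨z, hz, hzT⟩
        obtain ⟨p, hp, q, hq, e⟩ := (h1 w).cut (T := T) ⟨a, ha, haT⟩ hne
        obtain ⟨-, e | ⟨rfl, e⟩ | ⟨rfl, e⟩⟩ := e
        · exact ⟨p, hp.2, q, ⟨Or.inr hq.1, hq.2⟩, e⟩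
        · exact ⟨u, hun, q, ⟨Or.inr hq.1, hq.2⟩, e⟩
        · exact absurd haT hq.2
      · exact ⟨a, haT, u, ⟨by simp, hun⟩, hau.symm⟩
    · simp only [ha, if_false]
      refine (h1 w).mono_graph fun p hp q hq e => ?_
      obtain ⟨-, e | ⟨rfl, e⟩ | ⟨rfl, e⟩⟩ := e
      · exact e
      · exact absurd hp ha
      · exact absurd hq ha
  · simp only
    split_ifs
    · exact Set.insert_subset hu ((h2 w).trans Set.sdiff_subset)
    · exact (h2 w).trans Set.sdiff_subset
  · have hd := h3 w w' hw
    have := Set.disjoint_left.1 hd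
    have e1 := hnu w
    have e2 := hnu w'
    simp only
    split_ifs with ha hb hb
    · exact absurd hb (this ha)
    · exact Set.disjoint_insert_left.2 ⟨e2, hd⟩
    · exact Set.disjoint_insert_right.2 ⟨e1, hd⟩
    · exact hd
  · obtain ⟨p, hp, q, hq, e⟩ := h4 w w' e
    exact key w w' p q hp hq e

def Bad (H : SimpleGraph V) (S : Set V) : Prop :=
  MinorIn K4 H S ∨ MinorIn C32 H S ∨ MinorIn graphA H S

theorem Bad.mono {S T : Set V} (h : Bad H S) (hs : S ⊆ T) : Bad H T :=
  h.imp (fun h => h.mono hs) (Or.imp (fun h => h.mono hs) (fun h => h.mono hs))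

theorem Bad.of_ctr {S : Set V} {a u : V} (hau : H.Adj u a)
    (hu : u ∈ S) (h : Bad (ctr H a u) (S \ {u})) : Bad H S :=
  h.imp (fun h => h.of_ctr hau hu) (Or.imp (fun h => h.of_ctr hau hu) (fun h => h.of_ctr hau hu))

theorem Acy.of_agree {G' : SimpleGraph V} {F : Set V} (h : Acy G' F)
    (he : ∀ a ∈ F, ∀ b ∈ F, H.Adj a b → G'.Adj a b) : Acy H F := by
  intro T hT ⟨hn, hc⟩
  refine h T hT ⟨hn, fun v hv => ?_⟩
  obtain ⟨a, ha, b, hb, hab, e1, e2⟩ := hc v hv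
  exact ⟨a, ha, b, hb, hab, he _ (hT hv) _ (hT ha) e1, he _ (hT hv) _ (hT hb) e2⟩

/-- case (3): all degrees at least three -/
theorem IIa_three [Finite V] {S : Set V} (hdeg : ∀ u ∈ S, ∀ a b, ∃ c ∈ S, H.Adj u c ∧ c ≠ a ∧ c ≠ b)
    {x y v : V} (hx : x ∈ S) (hy : y ∈ S) (hxy : H.Adj x y) (hv : v ∈ S \ {y})
    (hA : Acy (ctr H x y) ((S \ {y}) \ {v})) : MinorIn K4 H S := by
  have hne := hxy.ne
  have hsub : ∀ z ∈ S, ({z} : Set V) ⊆ S := fun z hz => by simpa using hz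
  by_cases hvx : v = x
  · subst hvx
    set F := (S \ {y}) \ {v} with hF
    have hA' : Acy H F := hA.of_agree fun a ha b hb e => ⟨e.ne, Or.inl e⟩
    obtain ⟨c, hc, -, hcy, hcv⟩ := hdeg y hy y v
    obtain ⟨z1, hz1, ht1⟩ := hA'.leaf le_rfl ⟨c, ⟨hc, hcy⟩, hcv⟩
    have key : ∀ T ⊆ F, ∀ z ∈ T, (∀ w ∈ F, H.Adj z w → w ∈ T) → ¬ two H T z →
        H.Adj z v ∧ H.Adj z y ∧ ∃ w ∈ T, H.Adj z w := by
      intro T hT z hz hcl ht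
      have hzS : z ∈ S := (hT hz).1.1
      have hnb : ∀ a ∈ S, H.Adj z a → a ≠ v → a ≠ y → a ∈ T := fun a ha e h1 h2 =>
        hcl a ⟨⟨ha, h2⟩, h1⟩ e
      have h1 : H.Adj z v := by
        by_contra hcon
        obtain ⟨c1, hc1, e1, n1, -⟩ := hdeg z hzS y y
        obtain ⟨c2, hc2, e2, n2, n3⟩ := hdeg z hzS y c1
        exact ht ⟨c1, hnb c1 hc1 e1 (fun h => hcon (h ▸ e1)) n1, c2,
          hnb c2 hc2 e2 (fun h => hcon (h ▸ e2)) n2, n3.symm, e1, e2⟩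
      have h2 : H.Adj z y := by
        by_contra hcon
        obtain ⟨c1, hc1, e1, n1, -⟩ := hdeg z hzS v v
        obtain ⟨c2, hc2, e2, n2, n3⟩ := hdeg z hzS v c1
        exact ht ⟨c1, hnb c1 hc1 e1 n1 (fun h => hcon (h ▸ e1)), c2,
          hnb c2 hc2 e2 n2 (fun h => hcon (h ▸ e2)), n3.symm, e1, e2⟩
      obtain ⟨c1, hc1, e1, n1, n2⟩ := hdeg z hzS v y
      exact ⟨h1, h2, c1, hnb c1 hc1 e1 n1 n2, e1⟩
    obtain ⟨k1, k2, w, hw, ew⟩ := key F le_rfl z1 hz1 (fun w hw _ => hw) ht1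
    set T := cpt H F z1 with hT
    have hz1T : z1 ∈ T := mem_cpt hz1
    have hTF : T ⊆ F := cpt_sub
    have hwT : w ∈ T := cpt_closed hz1T hw ew
    obtain ⟨z2, hz2, hz21, ht2⟩ := hA'.leaf_ne hTF (y := z1) ⟨w, hwT, ew.ne'⟩
    obtain ⟨k3, k4, -⟩ := key T hTF z2 hz2 (fun w hw e => cpt_closed hz2 hw e) ht2
    obtain ⟨A, B, hzA, hzB, cA, cB, dAB, hAB, tAB⟩ := split2 (cpt_cn hz1) hz1T hz2 hz21.symm
    have hAF : A ⊆ F := (hAB ▸ Set.subset_union_left).trans hTF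
    have hBF : B ⊆ F := (hAB ▸ Set.subset_union_right).trans hTF
    refine k4_mk (cn_singleton v) (cn_singleton y) cA cB (hsub _ hx) (hsub _ hy)
      (fun z hz => (hAF hz).1.1) (fun z hz => (hBF hz).1.1) (by simpa using hne)
      (by simpa using fun h => (hAF h).2 rfl) (by simpa using fun h => (hBF h).2 rfl)
      (by simpa using fun h => (hAF h).1.2 rfl) (by simpa using fun h => (hBF h).1.2 rfl) dAB
      ⟨v, rfl, y, rfl, hxy⟩ ⟨v, rfl, z1, hzA, k1.symm⟩ ⟨v, rfl, z2, hzB, k3.symm⟩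
      ⟨y, rfl, z1, hzA, k2.symm⟩ ⟨y, rfl, z2, hzB, k4.symm⟩ tAB
  · have hvy : v ≠ y := hv.2
    have key : ∀ T ⊆ (S \ {y}) \ {v}, ∀ z ∈ T, z ≠ x → x ∈ T →
        (∀ w ∈ S, H.Adj z w → w ≠ y → w ≠ v → w ∈ T) → ¬ two (ctr H x y) T z →
        H.Adj z x ∧ H.Adj z y ∧ H.Adj z v ∧ ∀ w ∈ S, H.Adj z w → w = x ∨ w = y ∨ w = v := by
      intro T hT z hz hzx hxT hcl ht
      have hzS : z ∈ S := (hT hz).1.1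
      have h1 : H.Adj z x ∨ H.Adj z y := by
        by_contra hcon
        push Not at hcon
        obtain ⟨c1, hc1, e1, n1, -⟩ := hdeg z hzS v v
        obtain ⟨c2, hc2, e2, n2, n3⟩ := hdeg z hzS v c1
        refine ht ⟨c1, hcl c1 hc1 e1 (fun h => hcon.2 (h ▸ e1)) n1, c2,
          hcl c2 hc2 e2 (fun h => hcon.2 (h ▸ e2)) n2, n3.symm, ?_, ?_⟩
        · exact ⟨e1.ne, Or.inl e1⟩
        · exact ⟨e2.ne, Or.inl e2⟩
      have h2 : (ctr H x y).Adj z x := ⟨hzx, h1.imp id (fun h => Or.inr ⟨rfl, h.symm⟩)⟩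
      have h3 : ∀ w ∈ S, H.Adj z w → w = x ∨ w = y ∨ w = v := by
        intro w hw e
        by_contra hcon
        push Not at hcon
        exact ht ⟨x, hxT, w, hcl w hw e hcon.2.1 hcon.2.2, hcon.1.symm, h2, e.ne, Or.inl e⟩
      refine ⟨?_, ?_, ?_, h3⟩
      · obtain ⟨c, hc, e, n1, n2⟩ := hdeg z hzS y v
        rcases h3 c hc e with rfl | h | h
        · exact e
        · exact absurd h n1
        · exact absurd h n2
      · obtain ⟨c, hc, e, n1, n2⟩ := hdeg z hzS x v
        rcases h3 c hc e with h | rfl | h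
        · exact absurd h n1
        · exact e
        · exact absurd h n2
      · obtain ⟨c, hc, e, n1, n2⟩ := hdeg z hzS x y
        rcases h3 c hc e with h | h | rfl
        · exact absurd h n1
        · exact absurd h n2
        · exact e
    have hxT : x ∈ (S \ {y}) \ {v} := ⟨⟨hx, hne⟩, fun h => hvx h.symm⟩
    obtain ⟨c, hc, ecx, hcy, hcv⟩ := hdeg x hx y v
    obtain ⟨z1, hz1, hz1x, ht1⟩ := hA.leaf_ne le_rfl (y := x) ⟨c, ⟨⟨hc, hcy⟩, hcv⟩, ecx.ne'⟩
    obtain ⟨k1, k2, k3, k4⟩ := key _ le_rfl z1 hz1 hz1x hxT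
      (fun w hw _ h1 h2 => ⟨⟨hw, h1⟩, h2⟩) ht1
    have n1 : z1 ≠ y := hz1.1.2
    have n2 : z1 ≠ v := hz1.2
    by_cases hmore : ((((S \ {y}) \ {v}) \ {z1}) \ {x}).Nonempty
    · obtain ⟨z2, hz2, hz2x, ht2⟩ := hA.leaf_ne (T := ((S \ {y}) \ {v}) \ {z1}) Set.sdiff_subset hmore
      have n4 : z2 ≠ y := hz2.1.1.2
      have n5 : z2 ≠ v := hz2.1.2
      obtain ⟨j1, j2, j3, -⟩ := key _ Set.sdiff_subset z2 hz2 hz2x ⟨hxT, hz1x.symm⟩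
        (fun w hw e h1 h2 => ⟨⟨⟨hw, h1⟩, h2⟩, by
          rintro rfl
          rcases k4 z2 hz2.1.1.1 e.symm with h | h | h
          · exact hz2x h
          · exact n4 h
          · exact n5 h⟩) ht2
      have n6 : z2 ≠ z1 := hz2.2
      refine k4_mk (A := {x}) (B := {y}) (C := {z1}) (D := {v, z2}) (cn_singleton x)
        (cn_singleton y) (cn_singleton z1) (cn_pair j3.symm) (hsub _ hx) (hsub _ hy)
        (hsub _ hz1.1.1) ?_ ?_ ?_ ?_ ?_ ?_ ?_
        ⟨x, rfl, y, rfl, hxy⟩ ⟨x, rfl, z1, rfl, k1.symm⟩ ⟨x, rfl, z2, by simp, j1.symm⟩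
        ⟨y, rfl, z1, rfl, k2.symm⟩ ⟨y, rfl, z2, by simp, j2.symm⟩ ⟨z1, rfl, v, by simp, k3⟩
      · rintro z (rfl | rfl)
        · exact hv.1
        · exact hz2.1.1.1
      · simpa using hne
      · simpa using hz1x.symm
      · simpa using ⟨fun h => hvx h.symm, hz2x.symm⟩
      · simpa using n1.symm
      · simpa using ⟨hvy.symm, n4.symm⟩
      · simpa using ⟨n2, n6.symm⟩
    · have hall : ∀ w ∈ S, w = x ∨ w = y ∨ w = v ∨ w = z1 := by
        intro w hw
        by_contra hcon
        push Not at hcon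
        exact hmore ⟨w, ⟨⟨⟨hw, hcon.2.1⟩, hcon.2.2.1⟩, hcon.2.2.2⟩, hcon.1⟩
      have m1 : H.Adj v x := by
        obtain ⟨c, hc, e, p1, p2⟩ := hdeg v hv.1 y z1
        rcases hall c hc with rfl | h | h | h
        · exact e
        · exact absurd h p1
        · exact absurd h e.ne'
        · exact absurd h p2
      have m2 : H.Adj v y := by
        obtain ⟨c, hc, e, p1, p2⟩ := hdeg v hv.1 x z1
        rcases hall c hc with h | rfl | h | h
        · exact absurd h p1
        · exact e
        · exact absurd h e.ne'
        · exact absurd h p2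
      refine k4_mk (A := {x}) (B := {y}) (C := {z1}) (D := {v}) (cn_singleton x)
        (cn_singleton y) (cn_singleton z1) (cn_singleton v) (hsub _ hx) (hsub _ hy)
        (hsub _ hz1.1.1) (hsub _ hv.1) ?_ ?_ ?_ ?_ ?_ ?_
        ⟨x, rfl, y, rfl, hxy⟩ ⟨x, rfl, z1, rfl, k1.symm⟩ ⟨x, rfl, v, rfl, m1.symm⟩
        ⟨y, rfl, z1, rfl, k2.symm⟩ ⟨y, rfl, v, rfl, m2.symm⟩ ⟨z1, rfl, v, rfl, k3⟩
      · simpa using hne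
      · simpa using hz1x.symm
      · simpa using fun h => hvx h.symm
      · simpa using n1.symm
      · simpa using hvy.symm
      · simpa using n2

theorem IIa_half [Finite V] {S : Set V} {u a b v : V} (hu : u ∈ S) (ha : a ∈ S) (hb : b ∈ S)
    (eua : H.Adj u a) (eub : H.Adj u b) (eab : H.Adj a b)
    (hnb : ∀ w ∈ S, H.Adj u w → w = a ∨ w = b) (hvb : v ≠ b)
    (hA : Acy H ((S \ {u}) \ {v})) (hbad : ¬ Bad H S) (hna : ¬ Acy H (S \ {a})) :
    ∃ B E, Cn H B ∧ Cn H E ∧ Disjoint B E ∧ Tch H B E ∧ b ∈ B ∧ Tch H B {v} ∧ Tch H E {v} ∧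
      B ∪ E = cpt H (((S \ {u}) \ {v}) \ {a}) b := by
  unfold Acy at hna
  push Not at hna
  obtain ⟨T, hT, hTc⟩ := hna
  set F := (S \ {u}) \ {v} with hF
  have hTa : a ∉ T := fun h => (hT h).2 rfl
  have huT : u ∉ T := by
    intro h
    obtain ⟨p, hp, q, hq, hpq, e1, e2⟩ := hTc.2 u h
    rcases hnb p (hT hp).1 e1 with rfl | rfl
    · exact hTa hp
    · rcases hnb q (hT hq).1 e2 with rfl | rfl
      · exact hTa hq
      · exact hpq rfl
  have hbT : b ∈ T := by
    by_contra h
    refine hbad (Or.inr (Or.inl (c32_mk hTc.tri (T := {u, a, b}) (tri_mk (cn_singleton u)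
      (cn_singleton a) (cn_singleton b) (by simp) (by simp) (by simp) (by simpa using eua.ne)
      (by simpa using eub.ne) (by simpa using eab.ne) ⟨u, rfl, a, rfl, eua⟩ ⟨u, rfl, b, rfl, eub⟩
      ⟨a, rfl, b, rfl, eab⟩) ?_ (hT.trans Set.sdiff_subset) ?_)))
    · simp [huT, hTa, h]
    · rintro z (rfl | rfl | rfl) <;> assumption
  have hbF : b ∈ F \ {a} := ⟨⟨⟨hb, eub.ne'⟩, hvb.symm⟩, eab.ne'⟩
  set D := cpt H (F \ {a}) b with hD
  have hbD : b ∈ D := mem_cpt hbF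
  have hcl : ∀ z ∈ T ∩ D, ∀ w ∈ T, H.Adj z w → w ≠ v → w ∈ T ∩ D := by
    intro z hz w hw e hwv
    refine ⟨hw, cpt_closed hz.2 ⟨⟨⟨(hT hw).1, ?_⟩, hwv⟩, ?_⟩ e⟩
    · rintro rfl; exact huT hw
    · rintro rfl; exact hTa hw
  have hlf : ∀ z ∈ T ∩ D, ¬ two H (T ∩ D) z → H.Adj z v ∧ ((T ∩ D) \ {z}).Nonempty := by
    intro z hz hzt
    obtain ⟨p, hp, q, hq, hpq, e1, e2⟩ := hTc.2 z hz.1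
    by_cases h1 : p = v
    · subst h1
      exact ⟨e1, q, hcl z hz q hq e2 hpq.symm, e2.ne'⟩
    · have h1' := hcl z hz p hp e1 h1
      by_cases h2 : q = v
      · subst h2
        exact ⟨e2, p, h1', e1.ne'⟩
      · exact absurd ⟨p, h1', q, hcl z hz q hq e2 h2, hpq, e1, e2⟩ hzt
  have hTF : T ∩ D ⊆ F := fun z hz => (cpt_sub hz.2).1
  obtain ⟨z, hz, hzt⟩ := hA.leaf hTF ⟨b, hbT, hbD⟩
  obtain ⟨k1, k2⟩ := hlf z hz hzt
  obtain ⟨z', hz', hzz, hzt'⟩ := hA.leaf_ne hTF k2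
  obtain ⟨k3, -⟩ := hlf z' hz' hzt'
  obtain ⟨A, B, hzA, hzB, cA, cB, dAB, hAB, tAB⟩ := split2 (cpt_cn hbF) hz.2 hz'.2 hzz.symm
  have : b ∈ A ∪ B := hAB ▸ hbD
  rcases this with h | h
  · exact ⟨A, B, cA, cB, dAB, tAB, h, ⟨z, hzA, v, rfl, k1⟩, ⟨z', hzB, v, rfl, k3⟩, hAB⟩
  · exact ⟨B, A, cB, cA, dAB.symm, tAB.symm, h, ⟨z', hzB, v, rfl, k3⟩, ⟨z, hzA, v, rfl, k1⟩,
      by rw [Set.union_comm]; exact hAB⟩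

theorem graphA_mk {S A0 A1 A2 A3 A4 A5 : Set V} (c0 : Cn H A0) (c1 : Cn H A1) (c2 : Cn H A2)
    (c3 : Cn H A3) (c4 : Cn H A4) (c5 : Cn H A5) (hs : A0 ∪ A1 ∪ A2 ∪ A3 ∪ A4 ∪ A5 ⊆ S)
    (d0 : Disjoint A0 (A1 ∪ A2 ∪ A3 ∪ A4 ∪ A5)) (d1 : Disjoint A1 (A2 ∪ A3 ∪ A4 ∪ A5))
    (d2 : Disjoint A2 (A3 ∪ A4 ∪ A5)) (d3 : Disjoint A3 (A4 ∪ A5)) (d4 : Disjoint A4 A5)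
    (t1 : Tch H A0 A1) (t2 : Tch H A1 A2) (t3 : Tch H A2 A3) (t4 : Tch H A3 A4)
    (t5 : Tch H A4 A5) (t6 : Tch H A0 A5) (t7 : Tch H A0 A2) (t8 : Tch H A2 A4)
    (t9 : Tch H A0 A4) : MinorIn graphA H S := by
  simp only [Set.disjoint_union_right, Set.union_subset_iff] at hs d0 d1 d2 d3
  obtain ⟨⟨⟨⟨⟨s0, s1⟩, s2⟩, s3⟩, s4⟩, s5⟩ := hs
  obtain ⟨⟨⟨⟨p1, p2⟩, p3⟩, p4⟩, p5⟩ := d0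
  obtain ⟨⟨⟨p6, p7⟩, p8⟩, p9⟩ := d1
  obtain ⟨⟨p10, p11⟩, p12⟩ := d2
  obtain ⟨p13, p14⟩ := d3
  refine minorIn_fin ![A0, A1, A2, A3, A4, A5] ?_ ?_ ?_ ?_
  · intro i; fin_cases i <;> assumption
  · intro i; fin_cases i <;> assumption
  · intro i j hij; fin_cases i <;> fin_cases j <;> first | assumption | simp at hij
  · intro i j hij e
    rw [graphA_adj] at e
    fin_cases i <;> fin_cases j <;> first | assumption | exact absurd hij (by decide) | exact absurd e (by decide)

theorem IIa_tri [Finite V] {S : Set V} {u a b v : V} (hu : u ∈ S) (ha : a ∈ S) (hb : b ∈ S)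
    (eua : H.Adj u a) (eub : H.Adj u b) (eab : H.Adj a b)
    (hnb : ∀ w ∈ S, H.Adj u w → w = a ∨ w = b) (hv : v ∈ S) (huv : v ≠ u) (hva : v ≠ a)
    (hvb : v ≠ b) (hA : Acy H ((S \ {u}) \ {v})) (hbad : ¬ Bad H S) :
    Acy H (S \ {a}) ∨ Acy H (S \ {b}) := by
  by_contra hcon
  push Not at hcon
  obtain ⟨B, E, cB, cE, dBE, tBE, hbB, tBv, tEv, hBE⟩ :=
    IIa_half hu ha hb eua eub eab hnb hvb hA hbad hcon.1
  obtain ⟨A, D, cA, cD, dAD, tAD, haA, tAv, tDv, hAD⟩ :=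
    IIa_half hu hb ha eub eua eab.symm (fun w hw e => (hnb w hw e).symm) hva hA hbad hcon.2
  set F := (S \ {u}) \ {v} with hF
  have hbF : b ∈ F \ {a} := ⟨⟨⟨hb, eub.ne'⟩, hvb.symm⟩, eab.ne'⟩
  have haF : a ∈ F \ {b} := ⟨⟨⟨ha, eua.ne'⟩, hva.symm⟩, eab.ne⟩
  have hdis : Disjoint (A ∪ D) (B ∪ E) := by
    rw [hAD, hBE]
    exact hA.edge' eab (cpt_sub.trans Set.sdiff_subset) (cpt_sub.trans Set.sdiff_subset)
      (mem_cpt haF) (mem_cpt hbF) (fun h => (cpt_sub h).2 rfl) (fun h => (cpt_sub h).2 rfl)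
      (cpt_cn haF) (cpt_cn hbF)
  have s1 : A ∪ D ⊆ F := hAD ▸ (cpt_sub.trans Set.sdiff_subset)
  have s2 : B ∪ E ⊆ F := hBE ▸ (cpt_sub.trans Set.sdiff_subset)
  simp only [Set.disjoint_union_left, Set.disjoint_union_right, Set.union_subset_iff] at hdis s1 s2
  obtain ⟨⟨q1, q2⟩, q3, q4⟩ := hdis
  obtain ⟨r1, r2⟩ := s1
  obtain ⟨r3, r4⟩ := s2
  have nv : v ∉ F := fun h => h.2 rfl
  have nu : u ∉ F := fun h => h.1.2 rfl
  have hFS : F ⊆ S := fun z hz => hz.1.1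
  refine hbad (Or.inr (Or.inr (graphA_mk (cn_singleton v) cD cA (cn_singleton u) cB cE ?_ ?_ ?_ ?_
    ?_ dBE tDv.symm tAD.symm ⟨a, haA, u, rfl, eua.symm⟩ ⟨u, rfl, b, hbB, eub⟩ tBE tEv.symm
    tAv.symm ⟨a, haA, b, hbB, eab⟩ tBv.symm)))
  · simp only [Set.union_subset_iff, Set.singleton_subset_iff]
    exact ⟨⟨⟨⟨⟨hv, r2.trans hFS⟩, r1.trans hFS⟩, hu⟩, r3.trans hFS⟩, r4.trans hFS⟩
  · simp only [Set.disjoint_singleton_left, Set.mem_union, Set.mem_singleton_iff]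
    grind
  · simp only [Set.disjoint_union_right, Set.disjoint_singleton_right]
    exact ⟨⟨⟨dAD.symm, fun h => nu (r2 h)⟩, q2⟩, q4⟩
  · simp only [Set.disjoint_union_right, Set.disjoint_singleton_right]
    exact ⟨⟨fun h => nu (r1 h), q1⟩, q3⟩
  · simp only [Set.disjoint_union_right, Set.disjoint_singleton_left]
    exact ⟨fun h => nu (r3 h), fun h => nu (r4 h)⟩

theorem IIa [Finite V] {S : Set V} (hS : S.Nonempty) (hbad : ¬ Bad H S) :
    ∃ v ∈ S, Acy H (S \ {v}) := by
  induction hn : S.ncard using Nat.strong_induction_on generalizing H S with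
  | _ n ih =>
  have hlt : ∀ u ∈ S, (S \ {u}).ncard < n := fun u hu => by
    rw [← hn]; exact Set.ncard_lt_ncard (Set.sdiff_singleton_ssubset.2 hu)
  by_cases hdeg : ∀ u ∈ S, ∀ a b, ∃ c ∈ S, H.Adj u c ∧ c ≠ a ∧ c ≠ b
  · exfalso
    obtain ⟨y, hy⟩ := hS
    obtain ⟨x, hx, exy, -⟩ := hdeg y hy y y
    obtain ⟨v, hv, hA⟩ := ih _ (hlt y hy) (H := ctr H x y) (S := S \ {y}) ⟨x, hx, exy.ne'⟩
      (fun h => hbad (h.of_ctr exy hy)) rfl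
    exact hbad (Or.inl (IIa_three hdeg hx hy exy.symm hv hA))
  push Not at hdeg
  obtain ⟨u, hu, a0, b0, hab0⟩ := hdeg
  by_cases htwo : two H S u
  · obtain ⟨a, ha, b, hb, hab, ea, eb⟩ := htwo
    have hnb : ∀ w ∈ S, H.Adj u w → w = a ∨ w = b := by
      have h1 := hab0 a ha ea
      have h2 := hab0 b hb eb
      intro w hw e
      have h3 := hab0 w hw e
      by_contra hcon
      push Not at hcon
      rw [ne_eq, ← or_iff_not_imp_left] at h1 h2 h3
      clear ih hlt hab0
      rcases h1 with rfl | rfl <;> rcases h2 with rfl | rfl <;> rcases h3 with rfl | rfl <;>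
        simp_all
    by_cases eab : H.Adj a b
    · obtain ⟨v, hv, hA⟩ := ih _ (hlt u hu) (H := H) (S := S \ {u}) ⟨a, ha, ea.ne'⟩
        (fun h => hbad (h.mono Set.sdiff_subset)) rfl
      have hcut : ∀ c d, c ∈ S → (∀ w ∈ S, H.Adj u w → w = c ∨ w = d) →
          Acy H ((S \ {u}) \ {c}) → Acy H (S \ {c}) := by
        intro c d hc hcd hAc T hT hTc
        by_cases huT : u ∈ T
        · obtain ⟨p, hp, q, hq, hpq, e1, e2⟩ := hTc.2 u huT
          have := hcd p (hT hp).1 e1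
          have := hcd q (hT hq).1 e2
          have := (hT hp).2
          have := (hT hq).2
          simp only [Set.mem_singleton_iff] at *
          grind
        · exact hAc T (fun z hz => ⟨⟨(hT hz).1, by rintro rfl; exact huT hz⟩, (hT hz).2⟩) hTc
      by_cases hva : v = a
      · subst hva
        exact ⟨v, hv.1, hcut v b hv.1 hnb hA⟩
      by_cases hvb : v = b
      · subst hvb
        exact ⟨v, hv.1, hcut v a hv.1 (fun w hw e => (hnb w hw e).symm) hA⟩
      rcases IIa_tri hu ha hb ea eb eab hnb hv.1 hv.2 hva hvb hA hbad with h | h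
      · exact ⟨a, ha, h⟩
      · exact ⟨b, hb, h⟩
    · obtain ⟨v, hv, hA⟩ := ih _ (hlt u hu) (H := ctr H a u) (S := S \ {u}) ⟨a, ha, ea.ne'⟩
        (fun h => hbad (h.of_ctr ea hu)) rfl
      refine ⟨v, hv.1, fun T hT hTc => ?_⟩
      by_cases huT : u ∈ T
      · have haT : a ∈ T ∧ b ∈ T := by
          obtain ⟨p, hp, q, hq, hpq, e1, e2⟩ := hTc.2 u huT
          rcases hnb p (hT hp).1 e1 with rfl | rfl <;> rcases hnb q (hT hq).1 e2 with rfl | rfl <;>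
            simp_all
        refine hA (T \ {u}) (fun z hz => ⟨⟨(hT hz.1).1, hz.2⟩, (hT hz.1).2⟩)
          ⟨⟨a, haT.1, ea.ne'⟩, ?_⟩
        have up : ∀ p q, H.Adj p q → (ctr H a u).Adj p q := fun p q e => ⟨e.ne, Or.inl e⟩
        have eab' : (ctr H a u).Adj a b := ⟨hab, Or.inr (Or.inl ⟨rfl, eb⟩)⟩
        rintro w ⟨hw, hwu⟩
        obtain ⟨p, hp, q, hq, hpq, e1, e2⟩ := hTc.2 w hw
        by_cases hpu : p = u
        · subst hpu
          have hqp : q ∈ T \ {p} := ⟨hq, hpq.symm⟩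
          rcases hnb w (hT hw).1 e1.symm with rfl | rfl
          · exact ⟨q, hqp, b, ⟨haT.2, eb.ne'⟩, by rintro rfl; exact eab e2, up _ _ e2, eab'⟩
          · exact ⟨q, hqp, a, ⟨haT.1, ea.ne'⟩, by rintro rfl; exact eab e2.symm, up _ _ e2,
              eab'.symm⟩
        by_cases hqu : q = u
        · subst hqu
          have hqp : p ∈ T \ {q} := ⟨hp, hpq⟩
          rcases hnb w (hT hw).1 e2.symm with rfl | rfl
          · exact ⟨p, hqp, b, ⟨haT.2, eb.ne'⟩, by rintro rfl; exact eab e1, up _ _ e1, eab'⟩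
          · exact ⟨p, hqp, a, ⟨haT.1, ea.ne'⟩, by rintro rfl; exact eab e1.symm, up _ _ e1,
              eab'.symm⟩
        exact ⟨p, ⟨hp, hpu⟩, q, ⟨hq, hqu⟩, hpq, up _ _ e1, up _ _ e2⟩
      · refine (hA.of_agree fun p _ q _ e => ⟨e.ne, Or.inl e⟩) T (fun z hz => ?_) hTc
        exact ⟨⟨(hT hz).1, by rintro rfl; exact huT hz⟩, (hT hz).2⟩
  · by_cases hne : (S \ {u}).Nonempty
    · obtain ⟨v, hv, hA⟩ := ih _ (hlt u hu) hne (fun h => hbad (h.mono Set.sdiff_subset)) rfl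
      refine ⟨v, hv.1, fun T hT hTc => ?_⟩
      by_cases huT : u ∈ T
      · exact htwo ((hTc.2 u huT).mono (hT.trans Set.sdiff_subset))
      · exact hA T (fun z hz => ⟨⟨(hT hz).1, by rintro rfl; exact huT hz⟩, (hT hz).2⟩) hTc
    · refine ⟨u, hu, fun T hT hTc => ?_⟩
      obtain ⟨z, hz⟩ := hTc.1
      exact hne ⟨z, hT hz⟩

end IIa


/-! Linear arrangement of a forest without a three-branching towards `N` -/

section IIb
variable {W : Type*} {H : SimpleGraph W}

def TB (H : SimpleGraph W) (F N : Set W) : Prop :=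
  ∃ y ∈ F, ∃ D : Fin 3 → Set W, (∀ i, D i ⊆ F \ {y}) ∧ (∀ i, Cn H (D i)) ∧
    (∀ i j, i ≠ j → Disjoint (D i) (D j)) ∧ (∀ i, Tch H {y} (D i)) ∧ ∀ i, (D i ∩ N).Nonempty

theorem TB.mono {F N F' N' : Set W} (h : TB H F N) (hF : F ⊆ F') (hN : N ⊆ N') : TB H F' N' := by
  obtain ⟨y, hy, D, h1, h2, h3, h4, h5⟩ := h
  exact ⟨y, hF hy, D, fun i => (h1 i).trans (Set.sdiff_subset_sdiff_left hF), h2, h3, h4,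
    fun i => (h5 i).mono (Set.inter_subset_inter_right _ hN)⟩

def Btwn (R : Set W) (π : W → ℕ) (a b : W) : Prop := ∃ r ∈ R, π a < π r ∧ π r < π b

def Arr (H : SimpleGraph W) (F N : Set W) : Prop :=
  ∃ (R : Set W) (π : W → ℕ), N ⊆ R ∧ R ⊆ F ∧ (∀ a ∈ R, ∀ b ∈ R, π a = π b → a = b) ∧
    (∀ w ∈ F, ∃ r ∈ R, π r = π w) ∧ ∀ w ∈ F, ∀ w' ∈ F, H.Adj w w' →
      π w = π w' ∨ (w ∈ R ∧ w' ∈ R ∧ ¬ Btwn R π w w' ∧ ¬ Btwn R π w' w)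

theorem Acy.branch [Finite W] {F : Set W} (hF : Acy H F) {y w1 w2 : W} (hy : y ∈ F) (h1 : w1 ∈ F)
    (h2 : w2 ∈ F) (e1 : H.Adj y w1) (e2 : H.Adj y w2) (hne : w1 ≠ w2) :
    Disjoint (cpt H (F \ {y}) w1) (cpt H (F \ {y}) w2) := by
  have h1' : w1 ∈ F \ {y} := ⟨h1, e1.ne'⟩
  have h2' : w2 ∈ F \ {y} := ⟨h2, e2.ne'⟩
  rw [Set.disjoint_left]
  intro z hz1 hz2
  have hw2 : w2 ∈ cpt H (F \ {y}) w1 := cpt_max cpt_sub (cpt_cn h2') ⟨z, hz2, hz1⟩ (mem_cpt h2')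
  have hsub : cpt H (F \ {y}) w1 ⊆ F \ {y} := cpt_sub
  refine hF.edge e2 (D := insert y (cpt H (F \ {y}) w1))
    (Set.insert_subset hy (hsub.trans Set.sdiff_subset)) (by simp) (Or.inr hw2) ?_
  refine Cn.insert ((cpt_cn h1').mono_graph fun a ha b hb e => ?_) ⟨w1, mem_cpt h1', y, rfl, ?_⟩
  · rw [deleteEdges_adj]
    refine ⟨e, ?_⟩
    have := (hsub ha).2
    have := (hsub hb).2
    simp_all
  · rw [deleteEdges_adj]
    refine ⟨e1.symm, ?_⟩
    have := e1.ne
    simp_all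

theorem IIb [Finite W] {F N : Set W} (hF : Acy H F) (hN : N ⊆ F) (hTB : ¬ TB H F N) :
    Arr H F N := by
  classical
  induction hn : F.ncard using Nat.strong_induction_on generalizing F N with
  | _ n ih =>
  by_cases hne : F.Nonempty
  swap
  · rw [Set.not_nonempty_iff_eq_empty] at hne
    subst hne
    exact ⟨∅, fun _ => 0, hN, le_rfl, by simp, by simp, by simp⟩
  have hlt : ∀ u ∈ F, (F \ {u}).ncard < n := fun u hu => by
    rw [← hn]; exact Set.ncard_lt_ncard (Set.sdiff_singleton_ssubset.2 hu)
  by_cases hA : ∃ z ∈ F, ∀ w ∈ F, ¬ H.Adj z w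
  · obtain ⟨z, hz, hzi⟩ := hA
    obtain ⟨R, π, r1, r2, r3, r4, r5⟩ := ih _ (hlt z hz) (F := F \ {z}) (N := N \ {z})
      (hF.mono Set.sdiff_subset) (Set.sdiff_subset_sdiff_left hN)
      (fun h => hTB (h.mono Set.sdiff_subset Set.sdiff_subset)) rfl
    have hRz : ∀ r ∈ R, r ≠ z := fun r hr => (r2 hr).2
    refine ⟨insert z R, fun w => if w = z then 0 else π w + 1, ?_, ?_, ?_, ?_, ?_⟩
    · intro w hw
      by_cases h : w = z
      · exact Or.inl h
      · exact Or.inr (r1 ⟨hw, h⟩)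
    · exact Set.insert_subset hz (r2.trans Set.sdiff_subset)
    · intro a ha b hb hab
      by_cases h1 : a = z <;> by_cases h2 : b = z
      · rw [h1, h2]
      · simp [h1, h2] at hab
      · simp [h1, h2] at hab
      · simp only [h1, h2, if_false] at hab
        exact r3 a (ha.resolve_left h1) b (hb.resolve_left h2) (by omega)
    · intro w hw
      by_cases h : w = z
      · exact ⟨z, Or.inl rfl, by simp [h]⟩
      · obtain ⟨r, hr, e⟩ := r4 w ⟨hw, h⟩
        exact ⟨r, Or.inr hr, by simp [h, hRz r hr, e]⟩
    · intro w hw w' hw' e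
      have h1 : w ≠ z := by rintro rfl; exact hzi w' hw' e
      have h2 : w' ≠ z := by rintro rfl; exact hzi w hw e.symm
      rcases r5 w ⟨hw, h1⟩ w' ⟨hw', h2⟩ e with h | ⟨a, b, c, d⟩
      · left; simp [h1, h2, h]
      · right
        refine ⟨Or.inr a, Or.inr b, ?_, ?_⟩
        · rintro ⟨r, hr, p, q⟩
          rcases hr with rfl | hr
          · simp at p
          · simp only [h1, h2, hRz r hr, if_false] at p q
            exact c ⟨r, hr, by omega, by omega⟩
        · rintro ⟨r, hr, p, q⟩
          rcases hr with rfl | hr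
          · simp at p
          · simp only [h1, h2, hRz r hr, if_false] at p q
            exact d ⟨r, hr, by omega, by omega⟩
  push Not at hA
  by_cases hB : ∃ z ∈ F, ¬ two H F z ∧ z ∉ N
  · obtain ⟨z, hz, hzt, hzN⟩ := hB
    obtain ⟨y, hy, ey⟩ := hA z hz
    have huniq : ∀ w ∈ F, H.Adj z w → w = y := by
      intro w hw e
      by_contra h
      exact hzt ⟨w, hw, y, hy, h, e, ey⟩
    obtain ⟨R, π, r1, r2, r3, r4, r5⟩ := ih _ (hlt z hz) (F := F \ {z}) (N := N)
      (hF.mono Set.sdiff_subset) (fun w hw => ⟨hN hw, by rintro rfl; exact hzN hw⟩)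
      (fun h => hTB (h.mono Set.sdiff_subset le_rfl)) rfl
    have hRz : ∀ r ∈ R, r ≠ z := fun r hr => (r2 hr).2
    have hyz : y ≠ z := ey.ne'
    refine ⟨R, fun w => if w = z then π y else π w, r1, r2.trans Set.sdiff_subset, ?_, ?_, ?_⟩
    · intro a ha b hb hab
      simp only [hRz a ha, hRz b hb, if_false] at hab
      exact r3 a ha b hb hab
    · intro w hw
      by_cases h : w = z
      · obtain ⟨r, hr, e⟩ := r4 y ⟨hy, hyz⟩
        exact ⟨r, hr, by simp [h, hRz r hr, e]⟩
      · obtain ⟨r, hr, e⟩ := r4 w ⟨hw, h⟩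
        exact ⟨r, hr, by simp [h, hRz r hr, e]⟩
    · intro w hw w' hw' e
      by_cases h1 : w = z
      · subst h1
        left; simp [huniq w' hw' e]
      by_cases h2 : w' = z
      · subst h2
        left; simp [huniq w hw e.symm]
      rcases r5 w ⟨hw, h1⟩ w' ⟨hw', h2⟩ e with h | ⟨a, b, c, d⟩
      · left; simp [h1, h2, h]
      · right
        refine ⟨a, b, ?_, ?_⟩
        · rintro ⟨r, hr, p, q⟩
          simp only [h1, h2, hRz r hr, if_false] at p q
          exact c ⟨r, hr, p, q⟩
        · rintro ⟨r, hr, p, q⟩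
          simp only [h1, h2, hRz r hr, if_false] at p q
          exact d ⟨r, hr, p, q⟩
  push Not at hB
  obtain ⟨z, hz, hzt⟩ := hF.leaf le_rfl hne
  have hzN := hB z hz hzt
  obtain ⟨y, hy, ey⟩ := hA z hz
  have hyz : y ≠ z := ey.ne'
  have huniq : ∀ w ∈ F, H.Adj z w → w = y := by
    intro w hw e
    by_contra h
    exact hzt ⟨w, hw, y, hy, h, e, ey⟩
  obtain ⟨R, π, r1, r2, r3, r4, r5⟩ := ih _ (hlt z hz) (F := F \ {z}) (N := insert y (N \ {z}))
    (hF.mono Set.sdiff_subset) (Set.insert_subset ⟨hy, hyz⟩ (Set.sdiff_subset_sdiff_left hN)) (by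
      rintro ⟨y', hy', D, d1, d2, d3, d4, d5⟩
      refine hTB ⟨y', hy'.1, fun i => if y ∈ D i then insert z (D i) else D i, ?_, ?_, ?_, ?_, ?_⟩
      · intro i
        simp only
        split_ifs
        · exact Set.insert_subset ⟨hz, fun h => hy'.2 h.symm⟩ fun w hw => ⟨(d1 i hw).1.1, (d1 i hw).2⟩
        · exact fun w hw => ⟨(d1 i hw).1.1, (d1 i hw).2⟩
      · intro i
        simp only
        split_ifs with h
        · exact (d2 i).insert ⟨y, h, z, rfl, ey.symm⟩
        · exact d2 i
      · intro i j hij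
        have hd := d3 i j hij
        have hzD : ∀ i, z ∉ D i := fun i h => (d1 i h).1.2 rfl
        simp only
        split_ifs with ha hb hb
        · exact absurd hb (Set.disjoint_left.1 hd ha)
        · exact Set.disjoint_insert_left.2 ⟨hzD j, hd⟩
        · exact Set.disjoint_insert_right.2 ⟨hzD i, hd⟩
        · exact hd
      · intro i
        simp only
        split_ifs
        · exact (d4 i).mono le_rfl (Set.subset_insert _ _)
        · exact d4 i
      · intro i
        simp only
        split_ifs with h
        · exact ⟨z, by simp, hzN⟩
        · obtain ⟨w, hw, hw'⟩ := d5 i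
          refine ⟨w, hw, ?_⟩
          rcases hw' with rfl | hw'
          · exact absurd hw h
          · exact hw'.1) rfl
  have hRz : ∀ r ∈ R, r ≠ z := fun r hr => (r2 hr).2
  have hyR : y ∈ R := r1 (by simp)
  have hfree : (∀ w ∈ F \ {z}, H.Adj y w → π w ≤ π y) ∨ (∀ w ∈ F \ {z}, H.Adj y w → π y ≤ π w) := by
    by_contra hcon
    push Not at hcon
    obtain ⟨⟨w1, hw1, e1, l1⟩, w2, hw2, e2, l2⟩ := hcon
    have hw12 : w1 ≠ w2 := by rintro rfl; omega
    have hD : ∀ w ∈ F \ {z}, H.Adj y w → (cpt H (F \ {y}) w ∩ N).Nonempty ∧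
        Cn H (cpt H (F \ {y}) w) ∧ cpt H (F \ {y}) w ⊆ F \ {y} ∧ Tch H {y} (cpt H (F \ {y}) w) := by
      intro w hw e
      have hw' : w ∈ F \ {y} := ⟨hw.1, e.ne'⟩
      have hs : cpt H (F \ {y}) w ⊆ F \ {y} := cpt_sub
      refine ⟨?_, cpt_cn hw', hs, y, rfl, w, mem_cpt hw', e⟩
      obtain ⟨t, ht, hty, htt⟩ := hF.leaf_ne (T := insert y (cpt H (F \ {y}) w)) (y := y)
        (Set.insert_subset hy (hs.trans Set.sdiff_subset)) ⟨w, Or.inr (mem_cpt hw'), e.ne'⟩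
      have ht' := ht.resolve_left hty
      refine ⟨t, ht', hB t (hs ht').1 fun ⟨p, hp, q, hq, hpq, f1, f2⟩ => htt ⟨p, ?_, q, ?_, hpq, f1, f2⟩⟩
      · by_cases h : p = y
        · exact Or.inl h
        · exact Or.inr (cpt_closed ht' ⟨hp, h⟩ f1)
      · by_cases h : q = y
        · exact Or.inl h
        · exact Or.inr (cpt_closed ht' ⟨hq, h⟩ f2)
    obtain ⟨a1, a2, a3, a4⟩ := hD w1 hw1 e1
    obtain ⟨b1, b2, b3, b4⟩ := hD w2 hw2 e2
    have dd := hF.branch hy hw1.1 hw2.1 e1 e2 hw12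
    have dz : ∀ w ∈ F \ {z}, H.Adj y w → z ∉ cpt H (F \ {y}) w := by
      intro w hw e h
      have := hF.branch hy hw.1 hz e ey.symm (fun h => hw.2 h)
      exact Set.disjoint_left.1 this h (mem_cpt ⟨hz, hyz.symm⟩)
    have dz1 := dz w1 hw1 e1
    have dz2 := dz w2 hw2 e2
    refine hTB ⟨y, hy, ![cpt H (F \ {y}) w1, cpt H (F \ {y}) w2, {z}], ?_, ?_, ?_, ?_, ?_⟩
    · intro i
      fin_cases i
      · exact a3
      · exact b3
      · simpa using ⟨hz, hyz.symm⟩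
    · intro i
      fin_cases i
      · exact a2
      · exact b2
      · exact cn_singleton z
    · intro i j hij
      fin_cases i <;> fin_cases j <;> first | exact absurd rfl hij | skip
      · exact dd
      · simpa using dz1
      · exact dd.symm
      · simpa using dz2
      · simpa using dz1
      · simpa using dz2
    · intro i
      fin_cases i
      · exact a4
      · exact b4
      · exact ⟨y, rfl, z, rfl, ey.symm⟩
    · intro i
      fin_cases i
      · exact a1
      · exact b1
      · exact ⟨z, rfl, hzN⟩
  obtain ⟨c, hc, hcf⟩ : ∃ c : ℕ, c ≤ 1 ∧ ∀ w ∈ R, H.Adj y w → (c = 0 → π w ≤ π y) ∧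
      (c = 1 → π y ≤ π w) := by
    rcases hfree with h | h
    · exact ⟨0, by simp, fun w hw e => ⟨fun _ => h w (r2 hw) e, by simp⟩⟩
    · exact ⟨1, by simp, fun w hw e => ⟨by simp, fun _ => h w (r2 hw) e⟩⟩
  have hbt : ∀ w ∈ R, ∀ w' ∈ R, H.Adj w w' → ¬ Btwn R π w w' →
      ¬ Btwn (insert z R) (fun w => if w = z then 2 * π y + (1 - c) else 2 * π w + c) w w' := by
    intro w hw w' hw' e hb
    rintro ⟨r, hr, p, q⟩
    rcases hr with rfl | hr
    · simp only [hRz w hw, hRz w' hw', if_false, if_true] at p q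
      have h0 : π w < π w' := by omega
      by_cases h1 : π w < π y
      · by_cases h2 : π y < π w'
        · exact hb ⟨y, hyR, h1, h2⟩
        · have : π w' = π y := by omega
          have := r3 _ hw' _ hyR this
          subst this
          have := hcf w hw e.symm
          omega
      · have : π w = π y := by omega
        have := r3 _ hw _ hyR this
        subst this
        have := hcf w' hw' e
        omega
    · simp only [hRz w hw, hRz w' hw', hRz r hr, if_false] at p q
      exact hb ⟨r, hr, by omega, by omega⟩
  have hzy : ¬ Btwn (insert z R) (fun w => if w = z then 2 * π y + (1 - c) else 2 * π w + c) z y ∧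
      ¬ Btwn (insert z R) (fun w => if w = z then 2 * π y + (1 - c) else 2 * π w + c) y z := by
    constructor
    · rintro ⟨r, hr, p, q⟩
      simp only [hyz, if_false, if_true] at p q
      omega
    · rintro ⟨r, hr, p, q⟩
      simp only [hyz, if_false, if_true] at p q
      omega
  refine ⟨insert z R, fun w => if w = z then 2 * π y + (1 - c) else 2 * π w + c, ?_, ?_, ?_, ?_, ?_⟩
  · intro w hw
    by_cases h : w = z
    · exact Or.inl h
    · exact Or.inr (r1 (Or.inr ⟨hw, h⟩))
  · exact Set.insert_subset hz (r2.trans Set.sdiff_subset)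
  · intro a ha b hb hab
    by_cases h1 : a = z <;> by_cases h2 : b = z
    · rw [h1, h2]
    · simp only [h1, h2, if_false, if_true] at hab
      omega
    · simp only [h1, h2, if_false, if_true] at hab
      omega
    · simp only [h1, h2, if_false] at hab
      exact r3 a (ha.resolve_left h1) b (hb.resolve_left h2) (by omega)
  · intro w hw
    by_cases h : w = z
    · exact ⟨z, Or.inl rfl, by simp [h]⟩
    · obtain ⟨r, hr, e⟩ := r4 w ⟨hw, h⟩
      exact ⟨r, Or.inr hr, by simp [h, hRz r hr, e]⟩
  · intro w hw w' hw' e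
    by_cases h1 : w = z
    · subst h1
      have := huniq w' hw' e
      subst this
      right
      exact ⟨Or.inl rfl, Or.inr hyR, hzy⟩
    by_cases h2 : w' = z
    · subst h2
      have := huniq w hw e.symm
      subst this
      right
      exact ⟨Or.inr hyR, Or.inl rfl, hzy.2, hzy.1⟩
    rcases r5 w ⟨hw, h1⟩ w' ⟨hw', h2⟩ e with h | ⟨a, b, c1, d⟩
    · left; simp [h1, h2, h]
    · right
      exact ⟨Or.inr a, Or.inr b, hbt w a w' b e c1, hbt w' b w a e.symm d⟩

/-- final form: consecutive positions -/
theorem Arr.index [Finite W] {F N : Set W} (h : Arr H F N) :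
    ∃ (R : Set W) (π : W → ℕ), N ⊆ R ∧ R ⊆ F ∧ (∀ a ∈ R, ∀ b ∈ R, π a = π b → a = b) ∧
    (∀ w ∈ F, ∃ r ∈ R, π r = π w) ∧ (∀ w ∈ F, π w < Nat.card W) ∧
    ∀ w ∈ F, ∀ w' ∈ F, H.Adj w w' →
      π w = π w' ∨ (w ∈ R ∧ w' ∈ R ∧ (π w' = π w + 1 ∨ π w = π w' + 1)) := by
  obtain ⟨R, π, r1, r2, r3, r4, r5⟩ := h
  let σ : W → ℕ := fun w => {r | r ∈ R ∧ π r < π w}.ncard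
  have hσle : ∀ a b, π a ≤ π b → σ a ≤ σ b := fun a b hab => Set.ncard_le_ncard
    fun r hr => ⟨hr.1, hr.2.trans_le hab⟩
  have hσlt : ∀ a ∈ R, ∀ b, π a < π b → σ a < σ b := fun a ha b hab => Set.ncard_lt_ncard
    ⟨fun r hr => ⟨hr.1, hr.2.trans hab⟩, fun h => lt_irrefl _ (h ⟨ha, hab⟩).2⟩
  have hnext : ∀ a ∈ R, ∀ b ∈ R, π a < π b → ¬ Btwn R π a b → σ b = σ a + 1 := by
    intro a ha b hb hab hbt
    have : {r | r ∈ R ∧ π r < π b} = insert a {r | r ∈ R ∧ π r < π a} := by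
      ext r
      constructor
      · rintro ⟨hr, h⟩
        by_cases h1 : π r < π a
        · exact Or.inr ⟨hr, h1⟩
        · left
          by_contra h2
          have : π r ≠ π a := fun h3 => h2 (r3 _ hr _ ha h3)
          exact hbt ⟨r, hr, by omega, h⟩
      · rintro (rfl | ⟨hr, h⟩)
        · exact ⟨ha, hab⟩
        · exact ⟨hr, h.trans hab⟩
    show Set.ncard _ = Set.ncard _ + 1
    rw [this, Set.ncard_insert_of_notMem]
    exact fun h => lt_irrefl _ h.2
  refine ⟨R, σ, r1, r2, ?_, ?_, ?_, ?_⟩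
  · intro a ha b hb hab
    rcases lt_trichotomy (π a) (π b) with h | h | h
    · have := hσlt a ha b h; omega
    · exact r3 a ha b hb h
    · have := hσlt b hb a h; omega
  · intro w hw
    obtain ⟨r, hr, e⟩ := r4 w hw
    exact ⟨r, hr, by simp only [σ, e]⟩
  · intro w hw
    obtain ⟨r, hr, e⟩ := r4 w hw
    calc σ w < (Set.univ : Set W).ncard := Set.ncard_lt_ncard
          ⟨fun _ _ => trivial, fun h => by have := (h (Set.mem_univ r)).2; omega⟩
      _ = Nat.card W := Set.ncard_univ W
  · intro w hw w' hw' e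
    rcases r5 w hw w' hw' e with h | ⟨a, b, c, d⟩
    · left; simp only [σ, h]
    · rcases lt_trichotomy (π w) (π w') with h | h | h
      · exact Or.inr ⟨a, b, Or.inl (hnext w a w' b h c)⟩
      · left; simp only [σ, h]
      · exact Or.inr ⟨a, b, Or.inr (hnext w' b w a h d)⟩

/-- `H` without the four excluded minors: one vertex plus an arranged forest -/
theorem structureH [Finite W] [Nonempty W] (h4 : ¬ IsMinor K4 H) (h23 : ¬ IsMinor K23 H)
    (hc : ¬ IsMinor C32 H) (ha : ¬ IsMinor graphA H) :
    ∃ (v : W) (R : Set W) (π : W → ℕ), Acy H {v}ᶜ ∧ (∀ w, H.Adj v w → w ∈ R) ∧ R ⊆ {v}ᶜ ∧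
    (∀ a ∈ R, ∀ b ∈ R, π a = π b → a = b) ∧
    (∀ w, w ≠ v → ∃ r ∈ R, π r = π w) ∧ (∀ w, w ≠ v → π w < Nat.card W) ∧
    ∀ w w', w ≠ v → w' ≠ v → H.Adj w w' →
      π w = π w' ∨ (w ∈ R ∧ w' ∈ R ∧ (π w' = π w + 1 ∨ π w = π w' + 1)) := by
  obtain ⟨v, -, hA⟩ := IIa (H := H) (S := Set.univ) Set.univ_nonempty (by
    rintro (h | h | h)
    · exact h4 h.isMinor
    · exact hc h.isMinor
    · exact ha h.isMinor)
  have hA' : Acy H {v}ᶜ := hA.mono fun z hz => ⟨trivial, hz⟩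
  have hTB : ¬ TB H {v}ᶜ {w | H.Adj v w} := by
    rintro ⟨y, hy, D, d1, d2, d3, d4, d5⟩
    refine h23 (isMinor_mk (Sum.elim (fun i => if i = 0 then {v} else {y}) D) ?_ ?_ ?_)
    · rintro (i | i)
      · simp only [Sum.elim_inl]
        split_ifs <;> exact cn_singleton _
      · exact d2 i
    · have hvy : v ≠ y := fun h => hy h.symm
      have hvD : ∀ i, v ∉ D i := fun i h => (d1 i h).1 rfl
      have hyD : ∀ i, y ∉ D i := fun i h => (d1 i h).2 rfl
      rintro (i | i) (j | j) hij
      · simp only [Sum.elim_inl]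
        fin_cases i <;> fin_cases j <;> simp_all [Ne.symm]
      · simp only [Sum.elim_inl, Sum.elim_inr]
        split_ifs <;> simp [hvD, hyD]
      · simp only [Sum.elim_inl, Sum.elim_inr]
        split_ifs <;> simp [hvD, hyD]
      · exact d3 i j fun h => hij (by rw [h])
    · have key : ∀ (i : Fin 2) (j : Fin 3), Tch H (if i = 0 then {v} else {y}) (D j) := by
        intro i j
        split_ifs
        · obtain ⟨w, hw, hw'⟩ := d5 j
          exact ⟨v, rfl, w, hw, hw'⟩
        · exact d4 j
      rintro (i | i) (j | j) e
      · simp [K23] at e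
      · exact key i j
      · exact (key j i).symm
      · simp [K23] at e
  obtain ⟨R, π, r1, r2, r3, r4, r5, r6⟩ := (IIb hA' (fun w hw => (SimpleGraph.Adj.ne hw).symm) hTB).index
  exact ⟨v, R, π, hA', fun w hw => r1 hw, r2, r3, fun w hw => r4 w hw, fun w hw => r5 w hw,
    fun w w' hw hw' e => r6 w hw w' hw' e⟩

end IIb


/-! Embedding forests in sets of large rank -/

section embed
variable {W : Type} {H : SimpleGraph W}

theorem tree_embed [Finite W] (n : ℕ) : ∀ (Q : Set W) (q : W), Q.ncard = n → q ∈ Q → Acy H Q →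
    ∀ j, ∃ K, ∀ (V : Type) [Finite V] (G : SimpleGraph V) (r : V) (X : Set V), Rk G K r X →
    ∃ f : W → Set V, (∀ w ∈ Q, f w ⊆ X ∧ HRk G j (f w)) ∧
      (∀ w ∈ Q, ∀ w' ∈ Q, w ≠ w' → Disjoint (f w) (f w')) ∧
      (∀ w ∈ Q, ∀ w' ∈ Q, H.Adj w w' → Tch G (f w) (f w')) ∧ r ∈ f q := by
  classical
  induction n with
  | zero =>
    intro Q q hn hq
    rw [Set.ncard_eq_zero] at hn
    simp [hn] at hq
  | succ n ih =>
    intro Q q hn hq hA j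
    by_cases hQ : (Q \ {q}).Nonempty
    swap
    · have hQ' : ∀ w ∈ Q, w = q := fun w hw => by
        by_contra h
        exact hQ ⟨w, hw, h⟩
      refine ⟨j, fun V _ G r X h => ⟨fun _ => X, fun w _ => ⟨le_rfl, r, h⟩, ?_, ?_, h.mem⟩⟩
      · intro w hw w' hw' hne
        exact absurd ((hQ' w hw).trans (hQ' w' hw').symm) hne
      · intro w hw w' hw' e
        rw [hQ' w hw, hQ' w' hw'] at e
        exact absurd e H.irrefl
    obtain ⟨z, hz, hzq, h2⟩ := hA.leaf_ne le_rfl hQ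
    have hn' : (Q \ {z}).ncard = n := by
      have := Set.ncard_sdiff_singleton_add_one hz
      omega
    have hq' : q ∈ Q \ {z} := ⟨hq, fun h => hzq h.symm⟩
    obtain ⟨y, hy, hyz⟩ : ∃ y ∈ Q \ {z}, ∀ w ∈ Q, H.Adj z w → w = y := by
      by_cases h : ∃ y ∈ Q, H.Adj z y
      · obtain ⟨y, hy, e⟩ := h
        refine ⟨y, ⟨hy, fun h => H.irrefl (h ▸ e)⟩, fun w hw e' => ?_⟩
        by_contra hne
        exact h2 ⟨w, hw, y, hy, hne, e', e⟩
      · push Not at h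
        exact ⟨q, hq', fun w hw e => absurd e (h w hw)⟩
    obtain ⟨K, hK⟩ := ih (Q \ {z}) q hn' hq' (hA.mono Set.sdiff_subset) (j + (n + 1) + 1)
    refine ⟨K, fun V _ G r X h => ?_⟩
    obtain ⟨f, f1, f2, f3, f4⟩ := hK V G r X h
    have hch : ∀ w : W, ∃ a : V, w ∈ Q \ {z} → H.Adj y w → a ∈ f y ∧ ∃ b ∈ f w, G.Adj a b := by
      intro w
      by_cases hw : w ∈ Q \ {z} ∧ H.Adj y w
      · obtain ⟨a, ha, b, hb, e⟩ := f3 y hy w hw.1 hw.2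
        exact ⟨a, fun _ _ => ⟨ha, b, hb, e⟩⟩
      · exact ⟨r, fun h1 h2 => absurd ⟨h1, h2⟩ hw⟩
    choose a ha using hch
    obtain ⟨ry, hry⟩ := (f1 y hy).2
    obtain ⟨Z, r', hZ, hr', hd, -, hc, ht, hk⟩ := hry.piece (insert r (a '' (Q \ {z}))) (by
      refine (Set.ncard_le_ncard Set.inter_subset_left (Set.toFinite _)).trans
        ((Set.ncard_insert_le _ _).trans ?_)
      have := Set.ncard_image_le (f := a) (s := Q \ {z}) (Set.toFinite _)
      omega)
    have hrZ : r ∉ Z := fun h => Set.disjoint_left.1 hd h (by simp)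
    have haZ : ∀ w ∈ Q \ {z}, a w ∉ Z := fun w hw h =>
      Set.disjoint_left.1 hd h (Or.inr ⟨w, hw, rfl⟩)
    have hyz' : y ≠ z := fun h => hy.2 h
    let g : W → Set V := fun w => if w = z then Z else if w = y then f y \ Z else f w
    have gz : g z = Z := by simp [g]
    have gy : g y = f y \ Z := by simp [g, hyz']
    have go : ∀ w, w ≠ z → w ≠ y → g w = f w := fun w h1 h2 => by simp [g, h1, h2]
    have gs : ∀ w, w ≠ z → g w ⊆ f w := fun w h1 => by
      by_cases h2 : w = y
      · subst h2
        rw [gy]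
        exact Set.sdiff_subset
      · rw [go w h1 h2]
    have hzw : ∀ w ∈ Q, w ≠ z → Disjoint Z (g w) := by
      intro w hw h1
      by_cases h2 : w = y
      · subst h2
        rw [gy]
        exact Set.disjoint_sdiff_right
      · exact (f2 y hy w ⟨hw, h1⟩ (Ne.symm h2)).mono hZ (gs w h1)
    have hyw : ∀ w ∈ Q, w ≠ z → H.Adj y w → Tch G (g y) (g w) := by
      intro w hw h1 e
      obtain ⟨h3, b, hb, h4⟩ := ha w ⟨hw, h1⟩ e
      rw [gy, go w h1 (fun h => H.irrefl (h ▸ e))]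
      exact ⟨a w, ⟨h3, haZ w ⟨hw, h1⟩⟩, b, hb, h4⟩
    refine ⟨g, ?_, ?_, ?_, ?_⟩
    · intro w hw
      by_cases h1 : w = z
      · subst h1
        rw [gz]
        exact ⟨hZ.trans (f1 y hy).1, r', hr'⟩
      by_cases h2 : w = y
      · subst h2
        rw [gy]
        exact ⟨Set.sdiff_subset.trans (f1 w hy).1, hk⟩
      rw [go w h1 h2]
      obtain ⟨h3, s, h4⟩ := f1 w ⟨hw, h1⟩
      exact ⟨h3, s, h4.le (by omega)⟩
    · intro w hw w' hw' hne
      by_cases h1 : w = z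
      · subst h1
        rw [gz]
        exact hzw w' hw' (Ne.symm hne)
      by_cases h2 : w' = z
      · subst h2
        rw [gz]
        exact (hzw w hw hne).symm
      exact (f2 w ⟨hw, h1⟩ w' ⟨hw', h2⟩ hne).mono (gs w h1) (gs w' h2)
    · have hzy : Tch G (g z) (g y) := by
        rw [gz, gy]
        exact ht.symm.mono (by simpa using hr'.mem) le_rfl
      intro w hw w' hw' e
      by_cases h1 : w = z
      · subst h1
        rw [hyz w' hw' e]
        exact hzy
      by_cases h2 : w' = z
      · subst h2
        rw [hyz w hw e.symm]
        exact hzy.symm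
      by_cases h3 : w = y
      · subst h3
        exact hyw w' hw' h2 e
      by_cases h4 : w' = y
      · subst h4
        exact (hyw w hw h1 e.symm).symm
      rw [go w h1 h3, go w' h2 h4]
      exact f3 w ⟨hw, h1⟩ w' ⟨hw', h2⟩ e
    · by_cases h : q = y
      · subst h
        rw [gy]
        exact ⟨f4, hrZ⟩
      · rw [go q (Ne.symm hzq) h]
        exact f4

/-- A fan: a hub and a row of sets of large rank. -/
def Fan {V : Type} (G : SimpleGraph V) (n K : ℕ) : Prop :=
  ∃ (B : Set V) (P : ℕ → Set V), Cn G B ∧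
    (∀ i < n, Disjoint B (P i) ∧ Tch G (P i) B ∧ HRk G K (P i)) ∧
    (∀ i < n, ∀ j < n, i ≠ j → Disjoint (P i) (P j)) ∧
    ∀ i, i + 1 < n → Tch G (P i) (P (i + 1))

theorem fan_minor [Finite W] [Nonempty W] (h4 : ¬ IsMinor K4 H) (h23 : ¬ IsMinor K23 H)
    (hc : ¬ IsMinor C32 H) (ha : ¬ IsMinor graphA H) :
    ∃ K, ∀ (V : Type) [Finite V] (G : SimpleGraph V), Fan G (Nat.card W) K → IsMinor H G := by
  classical
  obtain ⟨v, R, π, hA, hR1, hR2, hR3, hR4, hπ, hH⟩ := structureH h4 h23 hc ha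
  have hQ : ∀ r : W, ∃ K, r ∈ R → ∀ (V : Type) [Finite V] (G : SimpleGraph V) (s : V) (X : Set V),
      Rk G K s X → ∃ f : W → Set V,
      (∀ w ∈ {w | w ≠ v ∧ π w = π r}, f w ⊆ X ∧ HRk G 0 (f w)) ∧
      (∀ w ∈ {w | w ≠ v ∧ π w = π r}, ∀ w' ∈ {w | w ≠ v ∧ π w = π r},
        w ≠ w' → Disjoint (f w) (f w')) ∧
      (∀ w ∈ {w | w ≠ v ∧ π w = π r}, ∀ w' ∈ {w | w ≠ v ∧ π w = π r},
        H.Adj w w' → Tch G (f w) (f w')) ∧ s ∈ f r := by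
    intro r
    by_cases hr : r ∈ R
    · obtain ⟨K, hK⟩ := tree_embed _ {w | w ≠ v ∧ π w = π r} r rfl ⟨hR2 hr, rfl⟩
        (hA.mono fun w hw => hw.1) 0
      exact ⟨K, fun _ => hK⟩
    · exact ⟨0, fun h => absurd h hr⟩
  choose k hk using hQ
  obtain ⟨M, hM⟩ := Finite.exists_le k
  refine ⟨M + 3 + 1, fun V _ G ⟨B, P, hB, hP, hPd, hPc⟩ => ?_⟩
  obtain ⟨x0, hx0⟩ := hB.nonempty
  have hb : ∀ i, ∃ b, i < Nat.card W → b ∈ P i ∧ ∃ y ∈ B, G.Adj b y := by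
    intro i
    by_cases hi : i < Nat.card W
    · obtain ⟨a, ha, b, hb, e⟩ := (hP i hi).2.1
      exact ⟨a, fun _ => ⟨ha, b, hb, e⟩⟩
    · exact ⟨x0, fun h => absurd h hi⟩
  choose b hb using hb
  have hcd : ∀ i, ∃ c d, i + 1 < Nat.card W → c ∈ P i ∧ d ∈ P (i + 1) ∧ G.Adj c d := by
    intro i
    by_cases hi : i + 1 < Nat.card W
    · obtain ⟨a, ha, b, hb, e⟩ := hPc i hi
      exact ⟨a, b, fun _ => ⟨ha, hb, e⟩⟩
    · exact ⟨x0, x0, fun h => absurd h hi⟩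
  choose c d hcd using hcd
  have hg : ∀ r : W, ∃ g : W → Set V, r ∈ R →
      (∀ w, w ≠ v → π w = π r → g w ⊆ P (π r) ∧ Cn G (g w)) ∧
      (∀ w w', w ≠ v → π w = π r → w' ≠ v → π w' = π r → w ≠ w' → Disjoint (g w) (g w')) ∧
      (∀ w w', w ≠ v → π w = π r → w' ≠ v → π w' = π r → H.Adj w w' → Tch G (g w) (g w')) ∧
      {b (π r), c (π r), d (π r - 1)} ∩ P (π r) ⊆ g r := by
    intro r
    by_cases hr : r ∈ R
    swap
    · exact ⟨fun _ => B, fun h => absurd h hr⟩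
    obtain ⟨s, hs⟩ := (hP (π r) (hπ r (hR2 hr))).2.2
    obtain ⟨Z, r', hZ, hr', hd, -, hcn, ht, -⟩ := hs.piece {b (π r), c (π r), d (π r - 1)} (by
      refine (Set.ncard_le_ncard Set.inter_subset_left (Set.toFinite _)).trans ?_
      refine (Set.ncard_insert_le _ _).trans ?_
      have := Set.ncard_insert_le (c (π r)) {d (π r - 1)}
      rw [Set.ncard_singleton] at this
      omega)
    obtain ⟨f, f1, f2, f3, f4⟩ := hk r hr V G r' Z (hr'.le (hM r))
    have hfr := f1 r ⟨hR2 hr, rfl⟩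
    let g : W → Set V := fun w => if w = r then f r ∪ P (π r) \ Z else f w
    have gr : g r = f r ∪ P (π r) \ Z := by simp [g]
    have go : ∀ w, w ≠ r → g w = f w := fun w h => by simp [g, h]
    have gs : ∀ w, f w ⊆ g w := fun w => by
      by_cases h : w = r
      · subst h
        rw [gr]
        exact Set.subset_union_left
      · rw [go w h]
    have hrd : ∀ w, w ≠ v → π w = π r → w ≠ r → Disjoint (g r) (g w) := by
      intro w h1 h2 h3
      rw [gr, go w h3, Set.disjoint_union_left]
      exact ⟨f2 r ⟨hR2 hr, rfl⟩ w ⟨h1, h2⟩ (Ne.symm h3),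
        Set.disjoint_sdiff_left.mono_right (f1 w ⟨h1, h2⟩).1⟩
    refine ⟨g, fun _ => ⟨fun w h1 h2 => ?_, fun w w' h1 h2 h3 h4 hne => ?_,
      fun w w' h1 h2 h3 h4 e => (f3 w ⟨h1, h2⟩ w' ⟨h3, h4⟩ e).mono (gs w) (gs w'), ?_⟩⟩
    · by_cases h : w = r
      · subst h
        rw [gr]
        refine ⟨Set.union_subset (hfr.1.trans hZ) Set.sdiff_subset, ?_⟩
        obtain ⟨t, ht'⟩ := hfr.2
        exact ht'.cn.union hcn (ht.symm.mono (by simpa using f4) le_rfl)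
      · rw [go w h]
        obtain ⟨h5, t, h6⟩ := f1 w ⟨h1, h2⟩
        exact ⟨h5.trans hZ, h6.cn⟩
    · by_cases h5 : w = r
      · subst h5
        exact hrd w' h3 h4 (Ne.symm hne)
      by_cases h6 : w' = r
      · subst h6
        exact (hrd w h1 h2 hne).symm
      rw [go w h5, go w' h6]
      exact f2 w ⟨h1, h2⟩ w' ⟨h3, h4⟩ hne
    · rw [gr]
      exact fun x hx => Or.inr ⟨hx.2, fun h => Set.disjoint_left.1 hd h hx.1⟩
  choose g hg using hg
  have hρ : ∀ w : W, ∃ r, w ≠ v → r ∈ R ∧ π r = π w := by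
    intro w
    by_cases h : w = v
    · exact ⟨v, fun h' => absurd h h'⟩
    · obtain ⟨r, h1, h2⟩ := hR4 w h
      exact ⟨r, fun _ => ⟨h1, h2⟩⟩
  choose ρ hρ using hρ
  have hρR : ∀ w ∈ R, ρ w = w := fun w hw =>
    hR3 _ (hρ w (hR2 hw)).1 _ hw (hρ w (hR2 hw)).2
  let F : W → Set V := fun w => if w = v then B else g (ρ w) w
  have Fv : F v = B := by simp [F]
  have Fo : ∀ w, w ≠ v → F w = g (ρ w) w := fun w h => by simp [F, h]
  have FP : ∀ w, w ≠ v → F w ⊆ P (π w) ∧ Cn G (F w) := by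
    intro w h
    rw [Fo w h]
    have := (hg (ρ w) (hρ w h).1).1 w h (hρ w h).2.symm
    rwa [(hρ w h).2] at this
  have FR : ∀ w ∈ R, {b (π w), c (π w), d (π w - 1)} ∩ P (π w) ⊆ F w := by
    intro w hw
    rw [Fo w (hR2 hw), hρR w hw]
    exact (hg w hw).2.2.2
  have Fρ : ∀ w w', w ≠ v → w' ≠ v → π w = π w' → ρ w = ρ w' := by
    intro w w' h h' e
    exact hR3 _ (hρ w h).1 _ (hρ w' h').1 (by rw [(hρ w h).2, (hρ w' h').2, e])
  have Fvw : ∀ w, H.Adj v w → Tch G B (F w) := by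
    intro w e
    have hw := hR1 w e
    obtain ⟨h1, y, hy, e'⟩ := hb (π w) (hπ w (hR2 hw))
    exact ⟨y, hy, b (π w), FR w hw ⟨by simp, h1⟩, e'.symm⟩
  have Fst : ∀ w ∈ R, ∀ w' ∈ R, π w' = π w + 1 → Tch G (F w) (F w') := by
    intro w hw w' hw' e
    have h1 := hπ w' (hR2 hw')
    rw [e] at h1
    obtain ⟨h2, h3, h4⟩ := hcd (π w) h1
    refine ⟨c (π w), FR w hw ⟨by simp, h2⟩, d (π w), FR w' hw' ⟨?_, ?_⟩, h4⟩
    · simp [e]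
    · rw [e]
      exact h3
  refine isMinor_mk F ?_ ?_ ?_
  · intro w
    by_cases h : w = v
    · rw [h, Fv]
      exact hB
    · exact (FP w h).2
  · intro w w' hne
    by_cases h : w = v
    · subst h
      rw [Fv]
      exact (hP _ (hπ w' hne.symm)).1.mono_right (FP w' hne.symm).1
    by_cases h' : w' = v
    · subst h'
      rw [Fv]
      exact ((hP _ (hπ w hne)).1.mono_right (FP w hne).1).symm
    by_cases e : π w = π w'
    · rw [Fo w h, Fo w' h', Fρ w w' h h' e]
      exact (hg (ρ w') (hρ w' h').1).2.1 w w' h (by rw [e, (hρ w' h').2]) h'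
        (hρ w' h').2.symm hne
    · exact (hPd _ (hπ w h) _ (hπ w' h') e).mono (FP w h).1 (FP w' h').1
  · intro w w' e
    by_cases h : w = v
    · subst h
      rw [Fv]
      exact Fvw w' e
    by_cases h' : w' = v
    · subst h'
      rw [Fv]
      exact (Fvw w e.symm).symm
    rcases hH w w' h h' e with e' | ⟨h1, h2, h3 | h3⟩
    · rw [Fo w h, Fo w' h', Fρ w w' h h' e']
      exact (hg (ρ w') (hρ w' h').1).2.2.1 w w' h (by rw [e', (hρ w' h').2]) h'
        (hρ w' h').2.symm e
    · exact Fst w h1 w' h2 h3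
    · exact (Fst w' h2 w h1 h3).symm

end embed


/-! Menger's theorem -/

section menger
variable {V : Type*}

theorem inj_of_ncard [Finite V] {k : ℕ} {S : Set V} (h : k ≤ S.ncard) :
    ∃ φ : Fin k → V, Function.Injective φ ∧ ∀ i, φ i ∈ S := by
  classical
  have := Fintype.ofFinite S
  obtain ⟨e⟩ : Nonempty (Fin k ↪ S) := Function.Embedding.nonempty_of_card_le (by
    rw [Fintype.card_fin, ← Nat.card_eq_fintype_card, Nat.card_coe_set_eq]
    exact h)
  exact ⟨fun i => (e i).1, fun i j hij => e.injective (Subtype.ext hij), fun i => (e i).2⟩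

theorem connect_idx [Finite V] {k : ℕ} {S : Set V} (hS : S.ncard = k) (C : Fin k → Set V)
    (hd : ∀ i j, i ≠ j → Disjoint (C i) (C j)) (hn : ∀ i, (C i ∩ S).Nonempty) :
    ∃ φ : Fin k → V, (∀ i, φ i ∈ C i) ∧ (∀ i, φ i ∈ S) ∧ (∀ s ∈ S, ∃ i, φ i = s) ∧
      ∀ i, ∀ s ∈ S, s ∈ C i → s = φ i := by
  choose φ hφ using hn
  have hinj : Function.Injective φ := fun i j hij => by
    by_contra hne
    exact Set.disjoint_left.1 (hd i j hne) (hφ i).1 (hij ▸ (hφ j).1)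
  have hr : Set.range φ = S := by
    refine Set.eq_of_subset_of_ncard_le (by rintro _ ⟨i, rfl⟩; exact (hφ i).2) ?_ (Set.toFinite _)
    rw [← Set.image_univ, Set.ncard_image_of_injective _ hinj, Set.ncard_univ, hS]
    simp
  have hs : ∀ s ∈ S, ∃ i, φ i = s := fun s hs => by rwa [← hr] at hs
  refine ⟨φ, fun i => (hφ i).1, fun i => (hφ i).2, hs, fun i s h1 h2 => ?_⟩
  obtain ⟨j, rfl⟩ := hs s h1
  by_contra hne
  exact Set.disjoint_left.1 (hd i j fun h => hne (by rw [h])) h2 (hφ j).1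

/-- separation hypothesis -/
def SepH (G : SimpleGraph V) (k : ℕ) (U A B : Set V) : Prop :=
  ∀ X Y, X ∪ Y = U → A ⊆ X → B ⊆ Y → (∀ x ∈ X \ Y, ∀ y ∈ Y \ X, ¬ G.Adj x y) → k ≤ (X ∩ Y).ncard

theorem SepH.symm {G : SimpleGraph V} {k : ℕ} {U A B : Set V} (h : SepH G k U A B) :
    SepH G k U B A := fun X Y h1 h2 h3 h4 => by
  rw [Set.inter_comm]
  exact h Y X (by rwa [Set.union_comm]) h3 h2 fun x hx y hy e => h4 y hy x hx e.symm

theorem SepH.sub {G : SimpleGraph V} {k : ℕ} {U A B X Y : Set V} (h : SepH G k U A B)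
    (h1 : X ∪ Y = U) (h3 : B ⊆ Y) (h4 : ∀ x ∈ X \ Y, ∀ y ∈ Y \ X, ¬ G.Adj x y) :
    SepH G k X A (X ∩ Y) := fun P Q p1 p2 p3 p4 => by
  have e : P ∩ (Q ∪ Y) = P ∩ Q := by
    ext z
    have : z ∈ P → z ∈ X := fun hz => p1 ▸ Or.inl hz
    have : z ∈ X ∩ Y → z ∈ Q := fun hz => p3 hz
    simp only [Set.mem_inter_iff, Set.mem_union] at *
    tauto
  rw [← e]
  refine h P (Q ∪ Y) (by rw [← Set.union_assoc, p1, h1]) p2 (h3.trans Set.subset_union_right) ?_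
  rintro x ⟨hx, hx'⟩ y ⟨hy, hy'⟩ hxy
  rw [Set.mem_union, not_or] at hx'
  by_cases hyQ : y ∈ Q
  · exact p4 x ⟨hx, hx'.1⟩ y ⟨hyQ, hy'⟩ hxy
  · have hyY := hy.resolve_left hyQ
    exact h4 x ⟨p1 ▸ Or.inl hx, hx'.2⟩ y ⟨hyY, fun h => hyQ (p3 ⟨h, hyY⟩)⟩ hxy

theorem menger [Finite V] (k n : ℕ) : ∀ (G : SimpleGraph V) (U A B : Set V),
    U.ncard + G.edgeSet.ncard = n → A ⊆ U → B ⊆ U → SepH G k U A B →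
    ∃ C : Fin k → Set V, (∀ i, C i ⊆ U ∧ Cn G (C i) ∧ (C i ∩ A).Nonempty ∧ (C i ∩ B).Nonempty) ∧
      ∀ i j, i ≠ j → Disjoint (C i) (C j) := by
  classical
  induction n using Nat.strong_induction_on with
  | _ n ih =>
  intro G U A B hn hA hB h
  by_cases hsep : ∃ X Y, X ∪ Y = U ∧ A ⊆ X ∧ B ⊆ Y ∧ (∀ x ∈ X \ Y, ∀ y ∈ Y \ X, ¬ G.Adj x y) ∧
      (X ∩ Y).ncard = k ∧ X ≠ U ∧ Y ≠ U
  · obtain ⟨X, Y, h1, h2, h3, h4, h5, h6, h7⟩ := hsep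
    have hX : X ⊂ U := lt_of_le_of_ne (h1 ▸ Set.subset_union_left) h6
    have hY : Y ⊂ U := lt_of_le_of_ne (h1 ▸ Set.subset_union_right) h7
    have cX := Set.ncard_lt_ncard hX
    have cY := Set.ncard_lt_ncard hY
    obtain ⟨C, c1, c2⟩ := ih _ (by omega) G X A (X ∩ Y) rfl h2 Set.inter_subset_left
      (h.sub h1 h3 h4)
    obtain ⟨D, d1, d2⟩ := ih _ (by omega) G Y B (Y ∩ X) rfl h3 Set.inter_subset_left
      (h.symm.sub (by rwa [Set.union_comm]) h2 fun x hx y hy e => h4 y hy x hx e.symm)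
    rw [Set.inter_comm] at d1
    obtain ⟨φ, p1, p2, p3, p4⟩ := connect_idx h5 C c2 fun i => (c1 i).2.2.2
    obtain ⟨ψ, q1, q2, q3, q4⟩ := connect_idx h5 D d2 fun i => (d1 i).2.2.2
    choose m hm using fun i => q3 _ (p2 i)
    have key : ∀ i j, i ≠ j → Disjoint (C i) (D (m j)) := by
      intro i j hij
      refine Set.disjoint_left.2 fun z hz hz' => ?_
      have hzS : z ∈ X ∩ Y := ⟨(c1 i).1 hz, (d1 _).1 hz'⟩
      have e1 := p4 i z hzS hz
      have e2 := q4 _ z hzS hz'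
      rw [hm] at e2
      exact Set.disjoint_left.1 (c2 i j hij) hz (e2 ▸ p1 j)
    refine ⟨fun i => C i ∪ D (m i), fun i => ⟨Set.union_subset ((c1 i).1.trans hX.1)
      ((d1 _).1.trans hY.1), (c1 i).2.1.union_inter (d1 _).2.1 ⟨φ i, p1 i, hm i ▸ q1 _⟩,
      (c1 i).2.2.1.mono (Set.inter_subset_inter_left _ Set.subset_union_left),
      (d1 _).2.2.1.mono (Set.inter_subset_inter_left _ Set.subset_union_right)⟩, ?_⟩
    intro i j hij
    rw [Set.disjoint_union_left, Set.disjoint_union_right, Set.disjoint_union_right]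
    refine ⟨⟨c2 i j hij, key i j hij⟩, (key j i hij.symm).symm, d2 _ _ fun e => ?_⟩
    have e' : φ i = φ j := by rw [← hm, ← hm, e]
    exact Set.disjoint_left.1 (c2 i j hij) (p1 i) (e' ▸ p1 j)
  by_cases hE : ∃ x ∈ U, ∃ y ∈ U, G.Adj x y
  swap
  · push Not at hE
    have := h A (B ∪ U \ A) (by
      ext z
      have := @hA z
      have := @hB z
      simp only [Set.mem_union, Set.mem_sdiff]
      tauto) le_rfl Set.subset_union_left (fun x hx y hy => hE x (hA hx.1) y (by
        rcases hy.1 with h | h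
        · exact hB h
        · exact h.1))
    obtain ⟨φ, f1, f2⟩ := inj_of_ncard this
    have f3 : ∀ i, φ i ∈ A ∧ φ i ∈ B := fun i => ⟨(f2 i).1, by
      rcases (f2 i).2 with h | h
      · exact h
      · exact absurd (f2 i).1 h.2⟩
    refine ⟨fun i => {φ i}, fun i => ⟨by simpa using hA (f3 i).1, cn_singleton _,
      ⟨φ i, rfl, (f3 i).1⟩, ⟨φ i, rfl, (f3 i).2⟩⟩, fun i j hij => ?_⟩
    simpa using fun h => hij (f1 h)
  obtain ⟨x, hx, y, hy, hxy⟩ := hE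
  let G' := G.deleteEdges {s(x, y)}
  have hG' : ∀ a b, G'.Adj a b → G.Adj a b := fun a b h => (deleteEdges_adj.1 h).1
  by_cases h' : SepH G' k U A B
  · have hlt : G'.edgeSet.ncard < G.edgeSet.ncard := by
      refine Set.ncard_lt_ncard ⟨?_, ?_⟩
      · rw [edgeSet_deleteEdges]
        exact Set.sdiff_subset
      · intro hh
        have := hh (show s(x, y) ∈ G.edgeSet from hxy)
        rw [edgeSet_deleteEdges] at this
        exact this.2 rfl
    obtain ⟨C, c1, c2⟩ := ih _ (by omega) G' U A B rfl hA hB h'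
    exact ⟨C, fun i => ⟨(c1 i).1, (c1 i).2.1.mono_graph fun a _ b _ => hG' a b, (c1 i).2.2⟩, c2⟩
  unfold SepH at h'
  push Not at h'
  obtain ⟨X, Y, h1, h2, h3, h4, h5⟩ := h'
  obtain ⟨x, hx, y, hy, hxy, h4⟩ : ∃ x ∈ X \ Y, ∃ y ∈ Y \ X, G.Adj x y ∧
      ∀ a ∈ X \ Y, ∀ b ∈ Y \ X, G.Adj a b → a = x ∧ b = y := by
    have hh : ∀ a ∈ X \ Y, ∀ b ∈ Y \ X, G.Adj a b → s(a, b) = s(x, y) := by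
      intro a ha b hb e
      by_contra hne
      exact h4 a ha b hb (deleteEdges_adj.2 ⟨e, hne⟩)
    by_contra hcon
    push Not at hcon
    refine absurd (h X Y h1 h2 h3 fun a ha b hb e => ?_) (by omega)
    obtain ⟨a', ha', b', hb', e', hne⟩ := hcon a ha b hb e
    have e1 := hh a ha b hb e
    have e2 := hh a' ha' b' hb' e'
    rw [← e1, Sym2.eq_iff] at e2
    rcases e2 with ⟨e2, e3⟩ | ⟨e2, e3⟩
    · exact hne e2 e3
    · exact ha'.2 (e2 ▸ hb.1)
  have cy : (X ∪ {y}) ∩ Y = insert y (X ∩ Y) := by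
    ext z
    have : z = y → z ∈ Y := fun h => h ▸ hy.1
    simp only [Set.mem_inter_iff, Set.mem_union, Set.mem_insert_iff, Set.mem_singleton_iff]
    tauto
  have cx : X ∩ (Y ∪ {x}) = insert x (X ∩ Y) := by
    ext z
    have : z = x → z ∈ X := fun h => h ▸ hx.1
    simp only [Set.mem_inter_iff, Set.mem_union, Set.mem_insert_iff, Set.mem_singleton_iff]
    tauto
  have n1 := Set.ncard_insert_le y (X ∩ Y)
  have n2 := Set.ncard_insert_le x (X ∩ Y)
  have hyU : y ∈ U := h1 ▸ Or.inr hy.1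
  have hxU : x ∈ U := h1 ▸ Or.inl hx.1
  have s1 : (X ∪ {y}) ∪ Y = U := by
    rw [Set.union_right_comm, h1, Set.union_eq_left]
    simpa using hyU
  have s2 : X ∪ (Y ∪ {x}) = U := by
    rw [← Set.union_assoc, h1, Set.union_eq_left]
    simpa using hxU
  have t1 : ∀ a ∈ (X ∪ {y}) \ Y, ∀ b ∈ Y \ (X ∪ {y}), ¬ G.Adj a b := by
    rintro a ⟨ha | ha, ha'⟩ b ⟨hb, hb'⟩ e
    · exact hb' (Or.inr (h4 a ⟨ha, ha'⟩ b ⟨hb, fun h => hb' (Or.inl h)⟩ e).2)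
    · rw [Set.mem_singleton_iff] at ha
      exact ha' (ha ▸ hy.1)
  have t2 : ∀ a ∈ X \ (Y ∪ {x}), ∀ b ∈ (Y ∪ {x}) \ X, ¬ G.Adj a b := by
    rintro a ⟨ha, ha'⟩ b ⟨hb | hb, hb'⟩ e
    · exact ha' (Or.inr (h4 a ⟨ha, fun h => ha' (Or.inl h)⟩ b ⟨hb, hb'⟩ e).1)
    · rw [Set.mem_singleton_iff] at hb
      exact hb' (hb ▸ hx.1)
  have k1 := h _ _ s1 (h2.trans Set.subset_union_left) h3 t1
  have k2 := h _ _ s2 h2 (h3.trans Set.subset_union_left) t2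
  rw [cy] at k1
  rw [cx] at k2
  have e1 : X ∪ {y} = U := by
    by_contra hne
    exact hsep ⟨_, _, s1, h2.trans Set.subset_union_left, h3, t1, by rw [cy]; omega, hne,
      fun h => hx.2 (h ▸ hxU)⟩
  have e2 : Y ∪ {x} = U := by
    by_contra hne
    exact hsep ⟨_, _, s2, h2, h3.trans Set.subset_union_left, t2, by rw [cx]; omega,
      fun h => hy.2 (h ▸ hyU), hne⟩
  have eX : X = insert x (X ∩ Y) := by
    ext z
    constructor
    · intro hz
      have : z ∈ Y ∪ {x} := e2 ▸ h1 ▸ Or.inl hz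
      rcases this with h | h
      · exact Or.inr ⟨hz, h⟩
      · exact Or.inl h
    · rintro (rfl | hz)
      · exact hx.1
      · exact hz.1
  have eY : Y = insert y (X ∩ Y) := by
    ext z
    constructor
    · intro hz
      have : z ∈ X ∪ {y} := e1 ▸ h1 ▸ Or.inr hz
      rcases this with h | h
      · exact Or.inr ⟨h, hz⟩
      · exact Or.inl h
    · rintro (rfl | hz)
      · exact hy.1
      · exact hz.2
  have kA := h A U (by rwa [Set.union_eq_right]) le_rfl hB (fun a ha => absurd (hA ha.1) ha.2)
  have kB := h U B (by rwa [Set.union_eq_left]) hA le_rfl (fun a _ b hb => absurd (hB hb.1) hb.2)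
  rw [Set.inter_eq_left.2 hA] at kA
  rw [Set.inter_eq_right.2 hB] at kB
  have eA : A = X := Set.eq_of_subset_of_ncard_le h2 (by rw [eX]; omega) (Set.toFinite _)
  have eB : B = Y := Set.eq_of_subset_of_ncard_le h3 (by rw [eY]; omega) (Set.toFinite _)
  obtain ⟨φ, f1, f2⟩ := inj_of_ncard kA
  refine ⟨fun i => if φ i = x then {x, y} else {φ i}, fun i => ?_, fun i j hij => ?_⟩
  · dsimp only
    split_ifs with hi
    · exact ⟨by rintro z (rfl | rfl) <;> assumption, cn_pair hxy, ⟨x, by simp, hi ▸ f2 i⟩,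
        ⟨y, by simp, eB ▸ hy.1⟩⟩
    · refine ⟨by simpa using hA (f2 i), cn_singleton _, ⟨φ i, rfl, f2 i⟩, ⟨φ i, rfl, ?_⟩⟩
      have := f2 i
      rw [eA, eX] at this
      exact eB ▸ (this.resolve_left hi).2
  · have hy' : ∀ i, φ i ≠ y := fun i h => hy.2 (eA ▸ h ▸ f2 i)
    have hne : φ i ≠ φ j := fun h => hij (f1 h)
    have h1 := hy' i
    have h2 := hy' j
    dsimp only
    split_ifs with hi hj hj
    · exact absurd (hi.trans hj.symm) hne
    · simp only [Set.disjoint_singleton_right, Set.mem_insert_iff, Set.mem_singleton_iff]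
      tauto
    · simp only [Set.disjoint_singleton_left, Set.mem_insert_iff, Set.mem_singleton_iff]
      tauto
    · simpa using hne

end menger


/-! Large path-width gives large rank -/

section brst
variable {V : Type*} {G : SimpleGraph V}

def bd (G : SimpleGraph V) (X : Set V) : Set V := {x | x ∈ X ∧ ∃ y, y ∉ X ∧ G.Adj x y}

def PD (G : SimpleGraph V) (k : ℕ) (X : Set V) : Prop :=
  ∃ (n : ℕ) (b : ℕ → Set V), (∀ i ≤ n, b i ⊆ X ∧ (b i).ncard ≤ k) ∧ (∀ x ∈ X, ∃ i ≤ n, x ∈ b i) ∧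
    (∀ x ∈ X, ∀ y ∈ X, G.Adj x y → ∃ i ≤ n, x ∈ b i ∧ y ∈ b i) ∧
    (∀ i j l, i ≤ j → j ≤ l → l ≤ n → ∀ x, x ∈ b i → x ∈ b l → x ∈ b j) ∧ bd G X ⊆ b n

theorem pd_empty (k : ℕ) : PD G k ∅ :=
  ⟨0, fun _ => ∅, by simp, by simp, by simp, by simp, fun _ hx => hx.1⟩

theorem PD.add [Finite V] {k : ℕ} {X : Set V} {v : V} (h : PD G k X) (hv : v ∉ X) (hk : (bd G X).ncard < k) :
    PD G k (insert v X) ∧ bd G (insert v X) ⊆ insert v (bd G X) := by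
  obtain ⟨n, b, h1, h2, h3, h4, h5⟩ := h
  have hs : bd G (insert v X) ⊆ insert v (bd G X) := by
    rintro x ⟨hx, y, hy, e⟩
    rcases hx with rfl | hx
    · exact Or.inl rfl
    · exact Or.inr ⟨hx, y, fun h => hy (Or.inr h), e⟩
  have hb : bd G X ⊆ X := fun x hx => hx.1
  refine ⟨⟨n + 1, fun i => if i ≤ n then b i else insert v (bd G X), ?_, ?_, ?_, ?_, ?_⟩, hs⟩
  · intro i _
    dsimp only
    split_ifs with hi
    · exact ⟨(h1 i hi).1.trans (Set.subset_insert _ _), (h1 i hi).2⟩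
    · have := Set.ncard_insert_le v (bd G X)
      exact ⟨Set.insert_subset_insert hb, by omega⟩
  · rintro x (rfl | hx)
    · exact ⟨n + 1, le_rfl, by simp⟩
    · obtain ⟨i, hi, hx⟩ := h2 x hx
      exact ⟨i, by omega, by simpa [hi] using hx⟩
  · rintro x hx y hy e
    rcases hx with rfl | hx <;> rcases hy with rfl | hy
    · exact absurd e G.irrefl
    · exact ⟨n + 1, le_rfl, by simp, by simpa using Or.inr ⟨hy, x, hv, e.symm⟩⟩
    · exact ⟨n + 1, le_rfl, by simpa using Or.inr ⟨hx, y, hv, e⟩, by simp⟩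
    · obtain ⟨i, hi, h⟩ := h3 x hx y hy e
      exact ⟨i, by omega, by simpa [hi] using h⟩
  · intro i j l hij hjl hl x hxi hxl
    by_cases hj : j ≤ n
    · have hi : i ≤ n := by omega
      simp only [hi, hj, if_true] at hxi ⊢
      by_cases hl' : l ≤ n
      · simp only [hl', if_true] at hxl
        exact h4 i j l hij hjl hl' x hxi hxl
      · simp only [hl', if_false] at hxl
        rcases hxl with rfl | hxl
        · exact absurd ((h1 i hi).1 hxi) hv
        · exact h4 i j n hij hj le_rfl x hxi (h5 hxl)
    · have hl' : ¬ l ≤ n := by omega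
      simp only [hj, hl', if_false] at hxl ⊢
      exact hxl
  · simpa using hs

/-- linking lemma -/
theorem bd_link [Finite V] {X Z : Set V} (hXZ : X ⊆ Z)
    (h : ∀ Y, X ⊆ Y → Y ⊆ Z → (bd G X).ncard ≤ (bd G Y).ncard) :
    ∃ C : V → Set V, (∀ s ∈ bd G X, s ∈ C s ∧ Cn G (C s) ∧ C s ⊆ Z ∧ (C s ∩ bd G Z).Nonempty ∧
      ∀ x ∈ C s, x ∈ X → x = s) ∧
      ∀ s ∈ bd G X, ∀ t ∈ bd G X, s ≠ t → Disjoint (C s) (C t) := by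
  have hUZ : Z \ X ∪ bd G X ⊆ Z := Set.union_subset Set.sdiff_subset fun x hx => hXZ hx.1
  obtain ⟨C, c1, c2⟩ := menger (bd G X).ncard _ G (Z \ X ∪ bd G X) (bd G X) (bd G Z) rfl
    Set.subset_union_right (fun x hx => by
      by_cases hxX : x ∈ X
      · obtain ⟨-, y, hy, e⟩ := hx
        exact Or.inr ⟨hxX, y, fun h => hy (hXZ h), e⟩
      · exact Or.inl ⟨hx.1, hxX⟩) (by
      intro P Q p1 p2 p3 p4
      refine (h (P ∪ X) Set.subset_union_right (Set.union_subset ((p1 ▸ Set.subset_union_left :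
        P ⊆ Z \ X ∪ bd G X).trans hUZ) hXZ)).trans (Set.ncard_le_ncard ?_ (Set.toFinite _))
      rintro y ⟨hy, u, hu, e⟩
      rw [Set.mem_union, not_or] at hu
      have hyP : y ∈ P := by
        rcases hy with hy | hy
        · exact hy
        · exact p2 ⟨hy, u, hu.2, e⟩
      refine ⟨hyP, ?_⟩
      by_cases huZ : u ∈ Z
      · have huQ : u ∈ P ∪ Q := p1 ▸ Or.inl ⟨huZ, hu.2⟩
        have huQ := huQ.resolve_left hu.1
        by_contra hyQ
        exact p4 y ⟨hyP, hyQ⟩ u ⟨huQ, hu.1⟩ e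
      · exact p3 ⟨hUZ (p1 ▸ Or.inl hyP), u, huZ, e⟩)
  obtain ⟨φ, f1, f2, f3, f4⟩ := connect_idx rfl C c2 fun i => (c1 i).2.2.1
  have hD : ∀ s, ∃ D : Set V, s ∈ bd G X → ∃ i, D = C i ∧ φ i = s := by
    intro s
    by_cases hs : s ∈ bd G X
    · obtain ⟨i, hi⟩ := f3 s hs
      exact ⟨C i, fun _ => ⟨i, rfl, hi⟩⟩
    · exact ⟨∅, fun h => absurd h hs⟩
  choose D hD using hD
  refine ⟨D, fun s hs => ?_, fun s hs t ht hst => ?_⟩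
  · obtain ⟨i, e, rfl⟩ := hD s hs
    rw [e]
    refine ⟨f1 i, (c1 i).2.1, (c1 i).1.trans hUZ, (c1 i).2.2.2, fun x hx hxX => f4 i x ?_ hx⟩
    rcases (c1 i).1 hx with h | h
    · exact absurd hxX h.2
    · exact h
  · obtain ⟨i, e, rfl⟩ := hD s hs
    obtain ⟨j, e', rfl⟩ := hD t ht
    rw [e, e']
    exact c2 i j fun h => hst (by rw [h])

theorem PD.shrink [Finite V] {k : ℕ} {Y Z : Set V} (hZ : PD G k Z) (hYZ : Y ⊆ Z)
    (h : ∀ Y', Y ⊆ Y' → Y' ⊆ Z → (bd G Y).ncard ≤ (bd G Y').ncard) : PD G k Y := by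
  classical
  obtain ⟨C, c1, c2⟩ := bd_link hYZ h
  obtain ⟨n, b, h1, h2, h3, h4, h5⟩ := hZ
  refine ⟨n, fun i => {s | s ∈ Y ∧ (s ∈ b i ∨ (s ∈ bd G Y ∧ (C s ∩ b i).Nonempty))},
    ?_, ?_, ?_, ?_, ?_⟩
  · intro i hi
    refine ⟨fun s hs => hs.1, le_trans ?_ (h1 i hi).2⟩
    have hg : ∀ s, ∃ x, (s ∈ b i ∨ (s ∈ bd G Y ∧ (C s ∩ b i).Nonempty)) → x ∈ b i ∧
        (x = s ∨ (s ∉ b i ∧ s ∈ bd G Y ∧ x ∈ C s)) := by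
      intro s
      by_cases hs : s ∈ b i
      · exact ⟨s, fun _ => ⟨hs, Or.inl rfl⟩⟩
      · by_cases hs' : s ∈ bd G Y ∧ (C s ∩ b i).Nonempty
        · obtain ⟨hs', x, hx⟩ := hs'
          exact ⟨x, fun _ => ⟨hx.2, Or.inr ⟨hs, hs', hx.1⟩⟩⟩
        · exact ⟨s, fun h => absurd h (by tauto)⟩
    choose g hg using hg
    refine Set.ncard_le_ncard_of_injOn g (fun s hs => (hg s hs.2).1) ?_ (Set.toFinite _)
    intro s hs t ht e
    have es := hg s hs.2
    have et := hg t ht.2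
    rw [← e] at et
    obtain ⟨e1, e2 | ⟨e2, e3, e4⟩⟩ := es <;> obtain ⟨-, e5 | ⟨e5, e6, e7⟩⟩ := et
    · exact e2.symm.trans e5
    · rw [e2] at e7
      exact (c1 t e6).2.2.2.2 s e7 hs.1
    · rw [e5] at e4
      exact ((c1 s e3).2.2.2.2 t e4 ht.1).symm
    · by_contra hne
      exact Set.disjoint_left.1 (c2 s e3 t e6 hne) e4 e7
  · intro x hx
    obtain ⟨i, hi, h⟩ := h2 x (hYZ hx)
    exact ⟨i, hi, hx, Or.inl h⟩
  · intro x hx y hy e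
    obtain ⟨i, hi, h, h'⟩ := h3 x (hYZ hx) y (hYZ hy) e
    exact ⟨i, hi, ⟨hx, Or.inl h⟩, ⟨hy, Or.inl h'⟩⟩
  · rintro i j l hij hjl hl s ⟨hs, hsi⟩ ⟨-, hsl⟩
    refine ⟨hs, ?_⟩
    by_cases hsY : s ∈ bd G Y
    swap
    · exact Or.inl (h4 i j l hij hjl hl s (by tauto) (by tauto))
    refine Or.inr ⟨hsY, ?_⟩
    obtain ⟨d1, d2, d3, -, -⟩ := c1 s hsY
    have hm : ∀ i, (s ∈ b i ∨ (s ∈ bd G Y ∧ (C s ∩ b i).Nonempty)) → (C s ∩ b i).Nonempty := by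
      rintro i (h | h)
      · exact ⟨s, d1, h⟩
      · exact h.2
    obtain ⟨x, hxC, hx⟩ := hm i hsi
    obtain ⟨y, hyC, hy⟩ := hm l hsl
    by_contra hne
    have hne : ∀ z ∈ C s, z ∉ b j := fun z hz h => hne ⟨z, hz, h⟩
    have hij' : i < j := lt_of_le_of_ne hij fun h => hne x hxC (h ▸ hx)
    obtain ⟨p, ⟨hp, p', hp', hpb⟩, q, ⟨hq, hq'⟩, e⟩ := d2.cut (T := {z | ∃ i < j, z ∈ b i})
      ⟨x, hxC, i, hij', hx⟩ ⟨y, hyC, fun ⟨i', hi', h⟩ => hne y hyC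
        (h4 i' j l hi'.le hjl hl y h hy)⟩
    obtain ⟨m, hm, hpm, hqm⟩ := h3 p (d3 hp) q (d3 hq) e
    rcases lt_trichotomy m j with h | h | h
    · exact hq' ⟨m, h, hqm⟩
    · exact hne p hp (h ▸ hpm)
    · exact hne p hp (h4 p' j m hp'.le h.le hm p hpb hpm)
  · intro s hs
    obtain ⟨x, hx, hx'⟩ := (c1 s hs).2.2.2.1
    exact ⟨hs.1, Or.inr ⟨hs, x, hx, h5 hx'⟩⟩

theorem exists_max [Finite V] {k d : ℕ} {X : Set V} (h : PD G k X) (hd : (bd G X).ncard ≤ d) :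
    ∃ Z, X ⊆ Z ∧ PD G k Z ∧ (bd G Z).ncard ≤ d ∧
      ∀ Y, PD G k Y → Z ⊂ Y → d < (bd G Y).ncard := by
  obtain ⟨Z, hZ, hm⟩ := Set.Finite.exists_le_maximal
    (s := {Y | PD G k Y ∧ (bd G Y).ncard ≤ d}) (Set.toFinite _) ⟨h, hd⟩
  refine ⟨Z, hZ, hm.prop.1, hm.prop.2, fun Y hY hZY => ?_⟩
  by_contra hcon
  exact hZY.2 (hm.le_of_ge ⟨hY, by omega⟩ hZY.1)

def State (G : SimpleGraph V) (k : ℕ) (D : Finset (List Bool)) : Prop :=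
  ∃ (X : Set V) (f : List Bool → Set V), PD G k X ∧ (bd G X).ncard = D.card ∧
    (∀ Y, PD G k Y → X ⊂ Y → D.card < (bd G Y).ncard) ∧
    (∀ σ ∈ D, f σ ⊆ X ∧ Cn G (f σ) ∧ (f σ ∩ bd G X).Nonempty) ∧
    (∀ σ ∈ D, ∀ τ ∈ D, σ ≠ τ → Disjoint (f σ) (f τ)) ∧
    ∀ b τ, b :: τ ∈ D → τ ∈ D → Tch G (f (b :: τ)) (f τ)

theorem State.step [Finite V] {k : ℕ} {D : Finset (List Bool)} (hk : D.card < k)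
    (hG : ¬ PD G k Set.univ) (h : State G k D) {σ : List Bool} (hσ : σ ∉ D)
    (hl : ∀ τ ∈ D, τ.length ≤ σ.length)
    (ht : σ.tail ∈ D ∨ D = ∅) : State G k (insert σ D) := by
  classical
  obtain ⟨X, f, hX, hc, hmax, f1, f2, f3⟩ := h
  have hx : ∀ τ, ∃ x, τ ∈ D → x ∈ f τ ∧ x ∈ bd G X := by
    intro τ
    by_cases hτ : τ ∈ D
    · obtain ⟨x, hx⟩ := (f1 τ hτ).2.2
      exact ⟨x, fun _ => hx⟩
    · obtain ⟨x, -⟩ : (Set.univ : Set V).Nonempty := by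
        rw [Set.nonempty_iff_ne_empty]
        intro h0
        exact hG (h0 ▸ pd_empty k)
      exact ⟨x, fun h => absurd h hτ⟩
  choose x hx using hx
  have xinj : Set.InjOn x D := fun a ha b hb e => by
    by_contra hne
    exact Set.disjoint_left.1 (f2 a ha b hb hne) (hx a ha).1 (e ▸ (hx b hb).1)
  have xim : x '' D = bd G X := by
    refine Set.eq_of_subset_of_ncard_le ?_ ?_ (Set.toFinite _)
    · rintro _ ⟨τ, hτ, rfl⟩
      exact (hx τ hτ).2
    · rw [Set.InjOn.ncard_image xinj, Set.ncard_coe_finset, hc]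
  have xu : ∀ τ ∈ D, ∀ s ∈ f τ, s ∈ bd G X → s = x τ := by
    intro τ hτ s hs hsb
    rw [← xim] at hsb
    obtain ⟨ρ, hρ, rfl⟩ := hsb
    by_contra hne
    exact Set.disjoint_left.1 (f2 τ hτ ρ hρ fun h => hne (by rw [h])) hs (hx ρ hρ).1
  obtain ⟨v, hv, hvt⟩ : ∃ v, v ∉ X ∧ (σ.tail ∈ D → G.Adj v (x σ.tail)) := by
    by_cases h0 : σ.tail ∈ D
    · obtain ⟨-, v, hv, e⟩ := (hx _ h0).2
      exact ⟨v, hv, fun _ => e.symm⟩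
    · have : X ≠ Set.univ := fun h => hG (h ▸ hX)
      obtain ⟨v, hv⟩ := (Set.ne_univ_iff_exists_notMem _).1 this
      exact ⟨v, hv, fun h => absurd h h0⟩
  obtain ⟨hX', hbs⟩ := hX.add hv (by omega)
  have hXX' : X ⊂ insert v X := Set.ssubset_insert hv
  have hb' : bd G (insert v X) = insert v (bd G X) := by
    refine Set.eq_of_subset_of_ncard_le hbs ?_ (Set.toFinite _)
    have := hmax _ hX' hXX'
    have := Set.ncard_insert_le v (bd G X)
    omega
  have hbc : (bd G (insert v X)).ncard = D.card + 1 := by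
    rw [hb', Set.ncard_insert_of_notMem (fun h => hv h.1), hc]
  obtain ⟨Z, hXZ, hZ, hZc, hZm⟩ := exists_max hX' hbc.le
  have hmin : ∀ Y, insert v X ⊆ Y → Y ⊆ Z → (bd G (insert v X)).ncard ≤ (bd G Y).ncard := by
    by_contra hcon
    push Not at hcon
    obtain ⟨Y0, a1, a2, a3⟩ := hcon
    obtain ⟨Y, ⟨b1, b2⟩, b3⟩ := Set.exists_min_image {Y | insert v X ⊆ Y ∧ Y ⊆ Z}
      (fun Y => (bd G Y).ncard) (Set.toFinite _) ⟨Y0, a1, a2⟩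
    have := hmax Y (hZ.shrink b2 fun Y' c1 c2 => b3 Y' ⟨b1.trans c1, c2⟩)
      (lt_of_lt_of_le hXX' b1)
    have := b3 Y0 ⟨a1, a2⟩
    omega
  obtain ⟨C, c1, c2⟩ := bd_link hXZ hmin
  rw [hb'] at c1 c2
  have hxb : ∀ τ ∈ D, x τ ∈ insert v (bd G X) := fun τ hτ => Or.inr (hx τ hτ).2
  have hvb : v ∈ insert v (bd G X) := Or.inl rfl
  have hfC : ∀ τ ∈ D, ∀ s ∈ insert v (bd G X), s ≠ x τ → Disjoint (f τ) (C s) := by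
    intro τ hτ s hs hne
    refine Set.disjoint_left.2 fun z hz hz' => ?_
    have := (c1 s hs).2.2.2.2 z hz' (Or.inr ((f1 τ hτ).1 hz))
    subst this
    rcases hs with rfl | hs
    · exact hv ((f1 τ hτ).1 hz)
    · exact hne (xu τ hτ z hz hs)
  have hxv : ∀ τ ∈ D, v ≠ x τ := fun τ hτ h => hv (h ▸ (hx τ hτ).2.1)
  let g : List Bool → Set V := fun τ => if τ = σ then C v else f τ ∪ C (x τ)
  have gσ : g σ = C v := by simp [g]
  have go : ∀ τ ∈ D, g τ = f τ ∪ C (x τ) := fun τ hτ => by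
    have : τ ≠ σ := fun h => hσ (h ▸ hτ)
    simp [g, this]
  have gd : ∀ τ ∈ D, Disjoint (g σ) (g τ) := by
    intro τ hτ
    rw [gσ, go τ hτ, Set.disjoint_union_right]
    exact ⟨(hfC τ hτ v hvb (hxv τ hτ)).symm, c2 v hvb _ (hxb τ hτ) (hxv τ hτ)⟩
  have hcard : (insert σ D).card = D.card + 1 := Finset.card_insert_of_notMem hσ
  refine ⟨Z, g, hZ, ?_, ?_, ?_, ?_, ?_⟩
  · have := hmin Z hXZ le_rfl
    omega
  · rw [hcard]
    exact hZm
  · intro τ hτ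
    rw [Finset.mem_insert] at hτ
    rcases hτ with rfl | hτ
    · rw [gσ]
      obtain ⟨d1, d2, d3, d4, -⟩ := c1 v hvb
      exact ⟨d3, d2, d4⟩
    · rw [go τ hτ]
      obtain ⟨d1, d2, d3, d4, -⟩ := c1 _ (hxb τ hτ)
      exact ⟨Set.union_subset ((f1 τ hτ).1.trans (hXX'.1.trans hXZ)) d3,
        (f1 τ hτ).2.1.union_inter d2 ⟨x τ, (hx τ hτ).1, d1⟩,
        d4.mono (Set.inter_subset_inter_left _ Set.subset_union_right)⟩
  · intro τ hτ ρ hρ hne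
    rw [Finset.mem_insert] at hτ hρ
    rcases hτ with rfl | hτ <;> rcases hρ with rfl | hρ
    · exact absurd rfl hne
    · exact gd ρ hρ
    · exact (gd τ hτ).symm
    · have : x τ ≠ x ρ := fun h => hne (xinj hτ hρ h)
      rw [go τ hτ, go ρ hρ, Set.disjoint_union_left, Set.disjoint_union_right,
        Set.disjoint_union_right]
      exact ⟨⟨f2 τ hτ ρ hρ hne, hfC τ hτ _ (hxb ρ hρ) this.symm⟩,
        (hfC ρ hρ _ (hxb τ hτ) this).symm, c2 _ (hxb τ hτ) _ (hxb ρ hρ) this⟩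
  · intro b τ h1 h2
    rw [Finset.mem_insert] at h1 h2
    have hτD : τ ∈ D := by
      rcases h2 with rfl | h2
      · rcases h1 with h1 | h1
        · exact absurd (congrArg List.length h1) (by simp)
        · have := hl _ h1
          simp at this
      · exact h2
    rcases h1 with rfl | h1
    · rw [gσ, go τ hτD]
      exact ⟨v, (c1 v hvb).1, x τ, Or.inl (hx τ hτD).1, hvt hτD⟩
    · rw [go _ h1, go _ hτD]
      exact (f3 b τ h1 hτD).mono Set.subset_union_left Set.subset_union_left

theorem state_all [Finite V] {k : ℕ} (hG : ¬ PD G k Set.univ) (n : ℕ) : ∀ D : Finset (List Bool),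
    D.card = n → n ≤ k → (∀ σ ∈ D, σ.tail ∈ D) → State G k D := by
  classical
  induction n with
  | zero =>
    intro D hD _ _
    rw [Finset.card_eq_zero] at hD
    subst hD
    have hb : bd G (∅ : Set V) = ∅ := Set.eq_empty_of_forall_notMem fun x hx => hx.1
    obtain ⟨Z, -, h1, h2, h3⟩ := exists_max (pd_empty (G := G) k) (d := 0) (by rw [hb]; simp)
    exact ⟨Z, fun _ => ∅, h1, by simpa using h2, by simpa using h3, by simp, by simp, by simp⟩
  | succ n ih =>
    intro D hD hk ht
    have hne : D.Nonempty := Finset.card_pos.1 (by omega)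
    obtain ⟨σ, hσ, hm⟩ := Finset.exists_max_image D List.length hne
    have hc : (D.erase σ).card = n := by
      rw [Finset.card_erase_of_mem hσ]
      omega
    have hs := ih (D.erase σ) hc (by omega) fun τ hτ => by
      rw [Finset.mem_erase] at hτ ⊢
      refine ⟨fun h => ?_, ht τ hτ.2⟩
      have h1 := hm τ hτ.2
      have h2 := congrArg List.length h
      rw [List.length_tail] at h2
      have h3 : τ.length = 0 := by omega
      rw [List.length_eq_zero_iff] at h3
      subst h3
      exact hτ.1 h
    rw [← Finset.insert_erase hσ]
    refine hs.step (by omega) hG (Finset.notMem_erase _ _)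
      (fun τ hτ => hm τ (Finset.mem_of_mem_erase hτ)) ?_
    cases σ with
    | nil =>
      right
      refine Finset.eq_empty_of_forall_notMem fun τ hτ => ?_
      rw [Finset.mem_erase] at hτ
      have := hm τ hτ.2
      simp at this
      exact hτ.1 this
    | cons b τ =>
      left
      rw [Finset.mem_erase]
      refine ⟨fun h => ?_, ht _ hσ⟩
      have := congrArg List.length h
      simp at this

theorem rk_of_tree {N : ℕ} {f : List Bool → Set V} (h1 : ∀ σ, σ.length ≤ N → Cn G (f σ))
    (h2 : ∀ σ τ, σ.length ≤ N → τ.length ≤ N → σ ≠ τ → Disjoint (f σ) (f τ))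
    (h3 : ∀ b τ, τ.length + 1 ≤ N → Tch G (f (b :: τ)) (f τ)) (j : ℕ) :
    ∀ σ, σ.length + j ≤ N → ∀ r ∈ f σ, ∃ X, Rk G j r X ∧
      ∀ x ∈ X, ∃ ρ, σ <:+ ρ ∧ ρ.length ≤ N ∧ x ∈ f ρ := by
  induction j with
  | zero =>
    intro σ hσ r hr
    exact ⟨f σ, ⟨hr, h1 σ (by omega)⟩, fun x hx => ⟨σ, List.suffix_rfl, by omega, hx⟩⟩
  | succ j ih =>
    intro σ hσ r hr
    have step : ∀ b, ∃ s X, Tch G (f σ) {s} ∧ Rk G j s X ∧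
        ∀ x ∈ X, ∃ ρ, b :: σ <:+ ρ ∧ ρ.length ≤ N ∧ x ∈ f ρ := by
      intro b
      obtain ⟨s, hs, y, hy, e⟩ := h3 b σ (by omega)
      obtain ⟨X, h⟩ := ih (b :: σ) (by simp; omega) s hs
      exact ⟨s, X, ⟨y, hy, s, rfl, e.symm⟩, h⟩
    obtain ⟨r1, X1, t1, k1, m1⟩ := step true
    obtain ⟨r2, X2, t2, k2, m2⟩ := step false
    have dY : ∀ (b : Bool) (X : Set V), (∀ x ∈ X, ∃ ρ, b :: σ <:+ ρ ∧ ρ.length ≤ N ∧ x ∈ f ρ) →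
        Disjoint (f σ) X := by
      intro b X hX
      refine Set.disjoint_left.2 fun x hx hx' => ?_
      obtain ⟨ρ, hρ, hρN, hxρ⟩ := hX x hx'
      refine Set.disjoint_left.1 (h2 σ ρ (by omega) hρN fun h => ?_) hx hxρ
      have := hρ.length_le
      rw [← h] at this
      simp at this
    refine ⟨f σ ∪ X1 ∪ X2, ⟨f σ, X1, X2, r1, r2, rfl, dY _ _ m1, dY _ _ m2, ?_, hr,
      h1 σ (by omega), t1, t2, k1, k2⟩, ?_⟩
    · refine Set.disjoint_left.2 fun x hx hx' => ?_
      obtain ⟨ρ, hρ, hρN, hxρ⟩ := m1 x hx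
      obtain ⟨τ, hτ, hτN, hxτ⟩ := m2 x hx'
      by_cases e : ρ = τ
      · subst e
        have := (List.suffix_of_suffix_length_le hρ hτ (by simp)).eq_of_length (by simp)
        simp at this
      · exact Set.disjoint_left.1 (h2 ρ τ hρN hτN e) hxρ hxτ
    · rintro x ((hx | hx) | hx)
      · exact ⟨σ, List.suffix_rfl, by omega, hx⟩
      · obtain ⟨ρ, hρ, h⟩ := m1 x hx
        exact ⟨ρ, (List.suffix_cons _ _).trans hρ, h⟩
      · obtain ⟨ρ, hρ, h⟩ := m2 x hx
        exact ⟨ρ, (List.suffix_cons _ _).trans hρ, h⟩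

/-- Bounded rank implies bounded path-width. -/
theorem pathwidth_rank (N : ℕ) : ∃ p, ∀ (V : Type) [Fintype V] (G : SimpleGraph V),
    p < pathwidth G → ∃ r X, Rk G N r X := by
  classical
  let D : Finset (List Bool) := (List.finite_length_le Bool N).toFinset
  have hD : ∀ σ, σ ∈ D ↔ σ.length ≤ N := fun σ => by simp [D]
  refine ⟨D.card, fun V _ G hp => ?_⟩
  have hG : ¬ PD G D.card Set.univ := by
    rintro ⟨n, b, h1, h2, h3, h4, -⟩
    refine absurd (Nat.sInf_le (s := {w | ∃ (n : ℕ) (X : Fin n → Finset V), IsPathDecomp G X ∧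
      ∀ i, (X i).card ≤ w + 1}) (m := D.card) ?_) (not_le.2 hp)
    refine ⟨n + 1, fun i => (b i).toFinset, ⟨fun v => ?_, fun u v e => ?_,
      fun i j k hij hjk v h h' => ?_⟩, fun i => ?_⟩
    · obtain ⟨i, hi, h⟩ := h2 v trivial
      exact ⟨⟨i, by omega⟩, by simpa using h⟩
    · obtain ⟨i, hi, h, h'⟩ := h3 u trivial v trivial e
      exact ⟨⟨i, by omega⟩, by simpa using h, by simpa using h'⟩
    · rw [Set.mem_toFinset] at h h' ⊢
      exact h4 i j k hij hjk (by omega) v h h'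
    · have := (h1 i (by omega)).2
      rw [Set.ncard_eq_toFinset_card'] at this
      dsimp only
      omega
  obtain ⟨X, f, -, -, -, f1, f2, f3⟩ := state_all hG D.card D rfl le_rfl fun σ hσ => by
    rw [hD] at hσ ⊢
    rw [List.length_tail]
    omega
  obtain ⟨r, hr⟩ := (f1 [] ((hD _).2 (by simp))).2.1.nonempty
  obtain ⟨X, hX, -⟩ := rk_of_tree (G := G) (N := N) (f := f)
    (fun σ h => (f1 σ ((hD _).2 h)).2.1)
    (fun σ τ h h' => f2 σ ((hD _).2 h) τ ((hD _).2 h'))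
    (fun b τ h => f3 b τ ((hD _).2 (by simpa using h)) ((hD _).2 (by omega))) N [] (by simp) r hr
  exact ⟨r, X, hX⟩

end brst


/-! Two-connected graphs of large rank contain large fans -/

section fans
variable {V : Type} {G : SimpleGraph V}

theorem seq_cn {Q : ℕ → Set V} {a b : ℕ} (hab : a < b) (h1 : ∀ t, a ≤ t → t < b → Cn G (Q t))
    (h2 : ∀ t, a ≤ t → t + 1 < b → Tch G (Q t) (Q (t + 1))) :
    Cn G {x | ∃ t, a ≤ t ∧ t < b ∧ x ∈ Q t} := by
  induction b, hab using Nat.le_induction with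
  | base =>
    convert h1 a le_rfl (by omega) using 1
    ext x
    constructor
    · rintro ⟨t, h, h', hx⟩
      have : t = a := by omega
      exact this ▸ hx
    · exact fun hx => ⟨a, le_rfl, by omega, hx⟩
  | succ b hb ih =>
    have hb' : a < b := hb
    have := (ih (fun t h h' => h1 t h (by omega)) (fun t h h' => h2 t h (by omega))).union
      (h1 b (by omega) (by omega)) (by
        have := h2 (b - 1) (by omega) (by omega)
        rw [Nat.sub_add_cancel (by omega)] at this
        exact this.mono (fun x hx => ⟨b - 1, by omega, by omega, hx⟩) le_rfl)
    convert this using 1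
    ext x
    constructor
    · rintro ⟨t, h, h', hx⟩
      by_cases e : t = b
      · exact Or.inr (e ▸ hx)
      · exact Or.inl ⟨t, h, by omega, hx⟩
    · rintro (⟨t, h, h', hx⟩ | hx)
      · exact ⟨t, h, by omega, hx⟩
      · exact ⟨b, by omega, by omega, hx⟩

theorem fan_of_seq [Finite V] {n K l : ℕ} {B : Set V} {Q : ℕ → Set V} (hB : Cn G B)
    (h1 : ∀ t ≤ l, Cn G (Q t) ∧ Disjoint B (Q t) ∧ Tch G (Q t) B)
    (h2 : ∀ t, t < l → Tch G (Q t) (Q (t + 1)))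
    (h3 : ∀ s ≤ l, ∀ t ≤ l, s ≠ t → Disjoint (Q s) (Q t)) (T : Finset ℕ)
    (hT : ∀ t ∈ T, t ≤ l ∧ HRk G K (Q t)) (hn : n + 1 ≤ T.card) : Fan G n K := by
  let φ := T.orderEmbOfCardLe hn
  let e : ℕ → ℕ := fun i => if h : i < n + 1 then φ ⟨i, h⟩ else 0
  have he : ∀ i < n + 1, e i ∈ T := fun i hi => by
    simp only [e, hi, dif_pos]
    exact Finset.orderEmbOfCardLe_mem _ _ _
  have hm : ∀ i j, i < j → j < n + 1 → e i < e j := fun i j hij hj => by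
    have hi : i < n + 1 := by omega
    simp only [e, hi, hj, dif_pos]
    exact φ.strictMono (by simpa using hij)
  have hmw : ∀ i j, i ≤ j → j < n + 1 → e i ≤ e j := fun i j hij hj => by
    rcases hij.lt_or_eq with h | h
    · exact (hm i j h hj).le
    · rw [h]
  have hl : ∀ i < n + 1, e i ≤ l := fun i hi => (hT _ (he i hi)).1
  refine ⟨B, fun i => {x | ∃ t, e i ≤ t ∧ t < e (i + 1) ∧ x ∈ Q t}, hB, fun i hi => ?_,
    fun i hi j hj hij => ?_, fun i hi => ?_⟩
  · have hlt := hm i (i + 1) (by omega) (by omega)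
    have hl' := hl (i + 1) (by omega)
    have hs : Q (e i) ⊆ {x | ∃ t, e i ≤ t ∧ t < e (i + 1) ∧ x ∈ Q t} := fun x hx =>
      ⟨e i, le_rfl, hlt, hx⟩
    refine ⟨Set.disjoint_left.2 ?_, (h1 (e i) (by omega)).2.2.mono hs le_rfl,
      (hT _ (he i (by omega))).2.mono hs (seq_cn hlt (fun t _ h => (h1 t (by omega)).1)
        fun t _ h => h2 t (by omega))⟩
    rintro x hx ⟨t, -, ht, hxt⟩
    exact Set.disjoint_left.1 (h1 t (by omega)).2.1 hx hxt
  · refine Set.disjoint_left.2 ?_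
    rintro x ⟨s, hs1, hs2, hxs⟩ ⟨t, ht1, ht2, hxt⟩
    have a1 := hl (i + 1) (by omega)
    have a2 := hl (j + 1) (by omega)
    refine Set.disjoint_left.1 (h3 s (by omega) t (by omega) ?_) hxs hxt
    rcases lt_or_gt_of_ne hij with h | h
    · have := hmw (i + 1) j h (by omega)
      omega
    · have := hmw (j + 1) i h (by omega)
      omega
  · have hlt := hm i (i + 1) (by omega) (by omega)
    have hlt' := hm (i + 1) (i + 1 + 1) (by omega) (by omega)
    have hl' := hl (i + 1) (by omega)
    have := h2 (e (i + 1) - 1) (by omega)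
    rw [Nat.sub_add_cancel (by omega)] at this
    exact this.mono (fun x hx => ⟨_, by omega, by omega, hx⟩) (fun x hx => ⟨_, le_rfl, hlt', hx⟩)

theorem Fan.mono {n K K' : ℕ} (h : Fan G n K) (hK : K' ≤ K) : Fan G n K' := by
  obtain ⟨B, P, h1, h2, h3⟩ := h
  refine ⟨B, P, h1, fun i hi => ?_, h3⟩
  obtain ⟨a, b, r, c⟩ := h2 i hi
  exact ⟨a, b, r, c.le hK⟩

/-- either a comb or a deep piece -/
theorem dich [Finite V] {K n : ℕ} {B : Set V} : ∀ (r : V) (X : Set V), Rk G (K + n) r X →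
    (∃ P : ℕ → Set V, (∀ i < n, P i ⊆ X ∧ Tch G (P i) B ∧ HRk G K (P i)) ∧
      (∀ i < n, ∀ j < n, i ≠ j → Disjoint (P i) (P j)) ∧
      (∀ i, i + 1 < n → Tch G (P i) (P (i + 1))) ∧ (0 < n → r ∈ P 0)) ∨
    ∃ X' r', X' ⊆ X ∧ Rk G K r' X' ∧ Cn G (X \ X') ∧ r ∈ X \ X' ∧ Tch G (X \ X') {r'} ∧
      ¬ Tch G X' B := by
  induction n with
  | zero =>
    intro r X _
    exact Or.inl ⟨fun _ => ∅, by simp, by simp, by simp, by simp⟩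
  | succ n ih =>
    intro r X h
    obtain ⟨Y, X1, X2, r1, r2, rfl, d1, d2, d3, hr, hY, t1, t2, k1, k2⟩ := h
    have tY2 : Tch G Y X2 := t2.mono le_rfl (by simpa using k2.mem)
    by_cases h1 : Tch G X1 B
    swap
    · right
      have e : (Y ∪ X1 ∪ X2) \ X1 = Y ∪ X2 := by
        rw [Set.union_right_comm, Set.union_sdiff_right]
        exact Disjoint.sdiff_eq_left (Set.disjoint_union_left.2 ⟨d1, d3.symm⟩)
      refine ⟨X1, r1, fun x hx => Or.inl (Or.inr hx), k1.le (Nat.le_add_right _ _), ?_, ?_, ?_, h1⟩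
      · rw [e]
        exact hY.union k2.cn tY2
      · rw [e]
        exact Or.inl hr
      · rw [e]
        exact t1.mono Set.subset_union_left le_rfl
    rcases ih r2 X2 k2 with ⟨P, p1, p2, p3, p4⟩ | ⟨X', r', q1, q2, q3, q4, q5, q6⟩
    · left
      have dP : ∀ i < n, Disjoint (Y ∪ X1) (P i) := fun i hi =>
        (Set.disjoint_union_left.2 ⟨d2, d3⟩).mono_right (p1 i hi).1
      refine ⟨fun i => if i = 0 then Y ∪ X1 else P (i - 1), ?_, ?_, ?_, ?_⟩
      · intro i hi
        by_cases h0 : i = 0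
        · simp only [h0, if_true]
          exact ⟨Set.subset_union_left, h1.mono Set.subset_union_right le_rfl,
            r, (k1.ext hY hr t1 d1).le (Nat.le_add_right _ _)⟩
        · simp only [h0, if_false]
          obtain ⟨a, b⟩ := p1 (i - 1) (by omega)
          exact ⟨a.trans Set.subset_union_right, b⟩
      · intro i hi j hj hij
        by_cases hi0 : i = 0 <;> by_cases hj0 : j = 0
        · omega
        · simp only [hi0, hj0, if_true, if_false]
          exact dP _ (by omega)
        · simp only [hi0, hj0, if_true, if_false]
          exact (dP _ (by omega)).symm
        · simp only [hi0, hj0, if_false]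
          exact p2 _ (by omega) _ (by omega) (by omega)
      · intro i hi
        by_cases h0 : i = 0
        · subst h0
          simp only [if_true]
          exact t2.mono Set.subset_union_left (by simpa using p4 (by omega))
        · have := p3 (i - 1) (by omega)
          rw [Nat.sub_add_cancel (by omega)] at this
          simpa [h0] using this
      · exact fun _ => by simpa using Or.inl hr
    · right
      have e : (Y ∪ X1 ∪ X2) \ X' = Y ∪ X1 ∪ X2 \ X' := by
        rw [Set.union_sdiff_distrib, Disjoint.sdiff_eq_left]
        exact (Set.disjoint_union_left.2 ⟨d2, d3⟩).mono_right q1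
      refine ⟨X', r', q1.trans Set.subset_union_right, q2, ?_, ?_, ?_, fun h => q6 h⟩
      · rw [e]
        exact (hY.union k1.cn (t1.mono le_rfl (by simpa using k1.mem))).union q3
          (t2.mono Set.subset_union_left (by simpa using q4))
      · rw [e]
        exact Or.inl (Or.inl hr)
      · rw [e]
        exact q5.mono Set.subset_union_right le_rfl

/-- nested levels -/
def Chain (G : SimpleGraph V) (K m : ℕ) (r : V) (X : Set V) (lam : V → ℕ) (Z : ℕ → Set V) : Prop :=
  (∀ v, lam v ≤ m) ∧ (∀ v, v ∉ X → lam v = 0) ∧ (∀ u v, G.Adj u v → lam u ≤ lam v + 1) ∧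
  (∀ i ≤ m, Cn G {v | lam v = i}) ∧ Cn G {v | lam v = 0 ∧ v ∈ X} ∧
  (∀ u v, lam u ≠ 0 → v ∉ X → ¬ G.Adj u v) ∧
  (∀ i ≤ m, (∀ z ∈ Z i, lam z = i ∧ z ∈ X) ∧ HRk G K (Z i) ∧ Cn G (Z i)ᶜ ∧
    ∃ v ∈ X, lam v = i ∧ v ∉ Z i) ∧ r ∈ X

theorem chain_exists [Finite V] {K n : ℕ} (m : ℕ) : ∀ (r : V) (X : Set V),
    Rk G (K + 1 + m * (n + 1)) r X → Cn G Xᶜ → Tch G Xᶜ {r} →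
    Fan G n K ∨ ∃ lam Z, Chain G K m r X lam Z := by
  classical
  have comp1 : ∀ {X Y X1 X2 : Set V} {r r2 : V}, X = Y ∪ X1 ∪ X2 → Disjoint Y X1 → Disjoint X1 X2 →
      r ∈ Y → Cn G Y → Tch G Y {r2} → r2 ∈ X2 → Cn G X2 → Cn G Xᶜ → Tch G Xᶜ {r} →
      Cn G X1ᶜ := by
    intro X Y X1 X2 r r2 hX d1 d3 hr hY t2 hr2 h2 hc ht
    have := hc.union (hY.union h2 (t2.mono le_rfl (by simpa using hr2)))
      (ht.mono le_rfl (by simpa using Or.inl hr))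
    convert this using 1
    ext z
    have a3 : z ∈ Y → z ∉ X1 := fun h h' => Set.disjoint_left.1 d1 h h'
    have a4 : z ∈ X1 → z ∉ X2 := fun h h' => Set.disjoint_left.1 d3 h h'
    simp only [hX, Set.mem_compl_iff, Set.mem_union]
    tauto
  induction m with
  | zero =>
    intro r X h hc ht
    rw [Nat.zero_mul] at h
    have hX := h.cn
    have hrX := h.mem
    obtain ⟨Y, X1, X2, r1, r2, e, d1, d2, d3, hr, hY, t1, t2, k1, k2⟩ := h
    have hu : Cn G (Set.univ : Set V) := by
      have := hc.union hX (ht.mono le_rfl (by simpa using hrX))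
      rwa [Set.compl_union_self] at this
    refine Or.inr ⟨fun _ => 0, fun _ => X1, by simp, by simp, by simp, ?_, by simpa using hX,
      by simp, ?_, hrX⟩
    · intro i hi
      obtain rfl : i = 0 := by omega
      simpa using hu
    · intro i hi
      obtain rfl : i = 0 := by omega
      exact ⟨fun z hz => ⟨rfl, e ▸ Or.inl (Or.inr hz)⟩, ⟨r1, k1⟩,
        comp1 e d1 d3 hr hY t2 k2.mem k2.cn hc ht, r, hrX, rfl,
        fun h => Set.disjoint_left.1 d1 hr h⟩
  | succ m ih =>
    intro r X h hc ht
    have hrX := h.mem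
    rw [show K + 1 + (m + 1) * (n + 1) = K + 1 + m * (n + 1) + n + 1 by ring] at h
    obtain ⟨Y, X1, X2, r1, r2, e, d1, d2, d3, hr, hY, t1, t2, k1, k2⟩ := h
    have c1 : Cn G X1ᶜ := comp1 e d1 d3 hr hY t2 k2.mem k2.cn hc ht
    have c2 : Cn G X2ᶜ := comp1 (X1 := X2) (X2 := X1) (r2 := r1)
      (by rw [e, Set.union_right_comm]) d2 d3.symm hr hY t1 k1.mem k1.cn hc ht
    have tY2 : Tch G X2ᶜ {r2} := t2.mono (fun y hy h => Set.disjoint_left.1 d2 hy h) le_rfl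
    have hX2X : X2 ⊆ X := e ▸ Set.subset_union_right
    rcases dich (B := X2ᶜ) r2 X2 k2 with ⟨P, p1, p2, p3, -⟩ | ⟨X', r', q1, q2, q3, q4, q5, q6⟩
    · left
      exact Fan.mono (K := K + 1 + m * (n + 1)) ⟨X2ᶜ, P, c2, fun i hi => ⟨
        disjoint_compl_left.mono_right (p1 i hi).1, (p1 i hi).2⟩, p2, p3⟩ (by omega)
    have eX' : X'ᶜ = X2ᶜ ∪ X2 \ X' := by
      ext z
      have := @q1 z
      simp only [Set.mem_compl_iff, Set.mem_union, Set.mem_sdiff]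
      tauto
    have cX' : Cn G X'ᶜ := by
      rw [eX']
      exact c2.union q3 (tY2.mono le_rfl (by simpa using q4))
    rcases ih r' X' q2 cX' (q5.mono (fun z hz => hz.2) le_rfl) with h | ⟨lam, Z, l1, l2, l3, l4,
      l5, l6, l7, l8⟩
    · exact Or.inl h
    right
    have hX1' : ∀ z ∈ X1, z ∉ X' := fun z hz h => Set.disjoint_left.1 d3 hz (q1 h)
    refine ⟨fun v => if v ∈ X' then lam v + 1 else 0, fun i => if i = 0 then X1 else Z (i - 1),
      ?_, ?_, ?_, ?_, ?_, ?_, ?_, hrX⟩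
    · intro v
      have := l1 v
      dsimp only
      split_ifs <;> omega
    · intro v hv
      simp [show v ∉ X' from fun h => hv (hX2X (q1 h))]
    · intro u v e
      dsimp only
      have := l3 u v e
      split_ifs with hu hv hv
      · omega
      · have : lam u = 0 := by
          by_contra h
          exact l6 u v h hv e
        omega
      · omega
      · omega
    · intro i hi
      by_cases h0 : i = 0
      · subst h0
        convert cX' using 1
        ext v
        simp
      · by_cases h1 : i = 1
        · subst h1
          convert l5 using 1
          ext v
          by_cases hv : v ∈ X' <;> simp [hv]
        · convert l4 (i - 1) (by omega) using 1
          ext v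
          by_cases hv : v ∈ X'
          · simp only [hv, if_true, Set.mem_ofPred_eq]
            omega
          · have := l2 v hv
            simp only [hv, if_false, Set.mem_ofPred_eq]
            omega
    · have : Cn G (Y ∪ X1 ∪ X2 \ X') :=
        (hY.union k1.cn (t1.mono le_rfl (by simpa using k1.mem))).union q3
          (t2.mono Set.subset_union_left (by simpa using q4))
      convert this using 1
      ext v
      have a1 : v ∈ Y → v ∉ X2 := fun h h' => Set.disjoint_left.1 d2 h h'
      have a2 : v ∈ X1 → v ∉ X2 := fun h h' => Set.disjoint_left.1 d3 h h'
      have a3 := @q1 v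
      by_cases hv : v ∈ X'
      · simp only [hv, if_true, Set.mem_ofPred_eq, Set.mem_union, Set.mem_sdiff]
        simp
        tauto
      · simp only [hv, e, if_false, Set.mem_ofPred_eq, Set.mem_union, Set.mem_sdiff]
        tauto
    · intro u v hu hv e'
      by_cases hu' : u ∈ X'
      · exact q6 ⟨u, hu', v, fun h => hv (hX2X h), e'⟩
      · simp [hu'] at hu
    · intro i hi
      by_cases h0 : i = 0
      · subst h0
        simp only [if_true]
        exact ⟨fun z hz => ⟨by simp [hX1' z hz], e ▸ Or.inl (Or.inr hz)⟩,
          ⟨r1, k1.le (by nlinarith)⟩, c1, r, hrX,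
          by simp [show r ∉ X' from fun h => Set.disjoint_left.1 d2 hr (q1 h)],
          fun h => Set.disjoint_left.1 d1 hr h⟩
      · obtain ⟨a1, a2, a3, v, a4, a5, a6⟩ := l7 (i - 1) (by omega)
        simp only [h0, if_false]
        refine ⟨fun z hz => ?_, a2, a3, v, hX2X (q1 a4), ?_, a6⟩
        · obtain ⟨b1, b2⟩ := a1 z hz
          simp only [b2, if_true]
          exact ⟨by omega, hX2X (q1 b2)⟩
        · simp only [a4, if_true]
          omega

end fans


/-! Two crossing classes and the main theorem -/

section crossing
variable {V : Type} {G : SimpleGraph V}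

/-- a bipartition into two connected classes crossing all levels -/
def Valid (G : SimpleGraph V) (m : ℕ) (lam : V → ℕ) (Z : ℕ → Set V) (L : Set V) : Prop :=
  Cn G L ∧ Cn G Lᶜ ∧ (∃ x ∈ L, lam x = 0) ∧ (∃ x ∈ L, lam x = m) ∧ (∃ x ∈ Lᶜ, lam x = 0) ∧
    (∃ x ∈ Lᶜ, lam x = m) ∧ ∀ i ≤ m, Z i ⊆ L ∨ Z i ⊆ Lᶜ

theorem Valid.symm {m : ℕ} {lam : V → ℕ} {Z : ℕ → Set V} {L : Set V} (h : Valid G m lam Z L) :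
    Valid G m lam Z Lᶜ := by
  obtain ⟨h1, h2, h3, h4, h5, h6, h7⟩ := h
  refine ⟨h2, by rwa [compl_compl], h5, h6, by rwa [compl_compl], by rwa [compl_compl], ?_⟩
  rw [compl_compl]
  exact fun i hi => (h7 i hi).symm

theorem valid_exists [Finite V] (hc : Cn G (Set.univ : Set V)) (hc1 : ∀ x, Cn G ({x}ᶜ : Set V))
    {K m : ℕ} {r : V} {X : Set V} {lam : V → ℕ} {Z : ℕ → Set V} (h : Chain G K m r X lam Z) :
    ∃ L, Valid G m lam Z L := by
  classical
  obtain ⟨l1, -, -, -, -, -, l7, -⟩ := h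
  have hz : ∀ i, ∃ z, i ≤ m → z ∈ Z i := by
    intro i
    by_cases hi : i ≤ m
    · obtain ⟨s, hs⟩ := (l7 i hi).2.1
      exact ⟨s, fun _ => hs.mem⟩
    · exact ⟨r, fun h => absurd h hi⟩
  choose z hz using hz
  let f : V → V := fun v => if v ∈ Z (lam v) then z (lam v) else v
  have f1 : ∀ i ≤ m, ∀ v ∈ Z i, f v = z i := fun i hi v hv => by
    have := ((l7 i hi).1 v hv).1
    subst this
    simp [f, hv]
  have f2 : ∀ v, v ∉ Z (lam v) → f v = v := fun v hv => by simp [f, hv]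
  have f3 : ∀ i ≤ m, ∀ v, f v = z i → v ∈ Z i := fun i hi v e => by
    by_cases hv : v ∈ Z (lam v)
    · rw [f1 _ (l1 v) v hv] at e
      have h1 := ((l7 _ (l1 v)).1 _ (hz _ (l1 v))).1
      rw [e, ((l7 i hi).1 _ (hz i hi)).1] at h1
      rwa [h1]
    · rw [f2 v hv] at e
      rw [e]
      exact hz i hi
  have fib : ∀ w, Cn G (f ⁻¹' {f w}) ∧ Cn G (f ⁻¹' {f w})ᶜ := by
    intro w
    by_cases hw : w ∈ Z (lam w)
    · have e : f ⁻¹' {f w} = Z (lam w) := by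
        ext v
        rw [Set.mem_preimage, Set.mem_singleton_iff, f1 _ (l1 w) w hw]
        exact ⟨f3 _ (l1 w) v, f1 _ (l1 w) v⟩
      rw [e]
      obtain ⟨s, hs⟩ := (l7 _ (l1 w)).2.1
      exact ⟨hs.cn, (l7 _ (l1 w)).2.2.1⟩
    · have e : f ⁻¹' {f w} = {w} := by
        ext v
        rw [Set.mem_preimage, Set.mem_singleton_iff, f2 w hw, Set.mem_singleton_iff]
        constructor
        · intro h
          by_cases hv : v ∈ Z (lam v)
          · rw [f1 _ (l1 v) v hv] at h
            have h1 := (l7 _ (l1 v)).1 _ (hz _ (l1 v))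
            rw [h] at h1
            exact absurd (h1.1 ▸ h ▸ hz _ (l1 v)) hw
          · rwa [f2 v hv] at h
        · rintro rfl
          exact f2 v hw
      rw [e]
      exact ⟨cn_singleton w, hc1 w⟩
  let G' : SimpleGraph V := SimpleGraph.fromRel fun a b => ∃ u v, f u = a ∧ f v = b ∧ G.Adj u v
  have hG' : ∀ u v, f u ≠ f v → G.Adj u v → G'.Adj (f u) (f v) := fun u v h e =>
    (fromRel_adj _ _ _).2 ⟨h, Or.inl ⟨u, v, rfl, rfl, e⟩⟩
  have hG'' : ∀ a b, G'.Adj a b → Tch G (f ⁻¹' {a}) (f ⁻¹' {b}) := fun a b h => by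
    obtain ⟨-, ⟨u, v, h1, h2, e⟩ | ⟨u, v, h1, h2, e⟩⟩ := (fromRel_adj _ _ _).1 h
    · exact ⟨u, h1, v, h2, e⟩
    · exact ⟨v, h2, u, h1, e.symm⟩
  have two : ∀ i ≤ m, ∀ S : Set V, S.ncard < 2 → ∃ v, lam v = i ∧ f v ∉ S := by
    intro i hi S hS
    by_contra hcon
    push Not at hcon
    obtain ⟨h1, -, -, v, -, h3, h4⟩ := l7 i hi
    have a1 := hcon v h3
    have a2 := hcon (z i) (h1 _ (hz i hi)).1
    have a3 : f v ≠ f (z i) := fun h => h4 (f3 i hi v (by rw [h, f1 i hi _ (hz i hi)]))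
    have : ({f v, f (z i)} : Set V).ncard ≤ S.ncard := Set.ncard_le_ncard (by
      rintro x (rfl | rfl) <;> assumption) (Set.toFinite _)
    rw [Set.ncard_pair a3] at this
    omega
  have hsep : SepH G' 2 (Set.range f) (f '' {v | lam v = 0}) (f '' {v | lam v = m}) := by
    intro P Q p1 p2 p3 p4
    by_contra hlt
    push Not at hlt
    obtain ⟨a, ha, ha'⟩ := two 0 (by omega) _ hlt
    obtain ⟨b, hb, hb'⟩ := two m le_rfl _ hlt
    have haP := p2 ⟨a, ha, rfl⟩
    have hbQ := p3 ⟨b, hb, rfl⟩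
    have hS : Cn G (f ⁻¹' (P ∩ Q))ᶜ := by
      rcases (P ∩ Q).eq_empty_or_nonempty with h0 | ⟨w, hw⟩
      · rw [h0]
        simpa using hc
      · have : P ∩ Q = {w} := by
          refine (Set.eq_of_subset_of_ncard_le (by simpa using hw) ?_ (Set.toFinite _)).symm
          rw [Set.ncard_singleton]
          omega
        have hwr : w ∈ Set.range f := p1 ▸ Or.inl hw.1
        obtain ⟨v, rfl⟩ := hwr
        rw [this]
        exact (fib v).2
    obtain ⟨u, ⟨hu, hu'⟩, v, ⟨hv, hv'⟩, e⟩ := hS.cut (T := f ⁻¹' P) ⟨a, ha', haP⟩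
      ⟨b, hb', fun h => hb' ⟨h, hbQ⟩⟩
    have hvQ : f v ∈ Q := by
      have : f v ∈ P ∪ Q := p1 ▸ ⟨v, rfl⟩
      exact this.resolve_left hv'
    exact p4 (f u) ⟨hu', fun h => hu ⟨hu', h⟩⟩ (f v) ⟨hvQ, hv'⟩
      (hG' u v (fun h => hv' (by rw [Set.mem_preimage, ← h]; exact hu')) e)
  obtain ⟨C, c1, c2⟩ := menger 2 _ G' (Set.range f) _ _ rfl (Set.image_subset_range _ _)
    (Set.image_subset_range _ _) hsep
  have hU : Cn G' (Set.range f) := by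
    refine cn_of_cut ⟨f r, r, rfl⟩ ?_
    rintro T hT ⟨a, ha⟩ ⟨b, ⟨b', rfl⟩, hb⟩
    obtain ⟨a', rfl⟩ := hT ha
    obtain ⟨u, ⟨-, hu⟩, v, ⟨-, hv⟩, e⟩ := hc.cut (T := f ⁻¹' T) ⟨a', trivial, ha⟩ ⟨b', trivial, hb⟩
    exact ⟨f u, hu, f v, ⟨⟨v, rfl⟩, hv⟩, hG' u v (fun h => hv (by
      rw [Set.mem_preimage, ← h]; exact hu)) e⟩
  obtain ⟨A, B, s1, s2, s3, s4, s5, s6, -⟩ := grow2 hU (c1 0).2.1 (c1 1).2.1 (c1 0).1 (c1 1).1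
    (c2 0 1 (by decide))
  have pull : ∀ A : Set V, A ⊆ Set.range f → Cn G' A → Cn G (f ⁻¹' A) := by
    intro A hA hAc
    have := cn_biUnion (G := G) (f := fun a => f ⁻¹' {a}) hAc
      (fun a ha => by
        obtain ⟨v, rfl⟩ := hA ha
        exact (fib v).1) (fun a _ b _ e => hG'' a b e)
    rwa [Set.biUnion_preimage_singleton] at this
  have eB : (f ⁻¹' A)ᶜ = f ⁻¹' B := by
    ext v
    have h1 : f v ∈ A ∪ B := s6 ▸ ⟨v, rfl⟩
    constructor
    · exact fun h => h1.resolve_left h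
    · exact fun h h' => Set.disjoint_left.1 s5 h' h
  have meet : ∀ (i : Fin 2) (A : Set V) (j : ℕ), C i ⊆ A → (C i ∩ f '' {v | lam v = j}).Nonempty →
      ∃ x ∈ f ⁻¹' A, lam x = j := by
    rintro i A j hA ⟨_, h1, x, h2, rfl⟩
    exact ⟨x, hA h1, h2⟩
  refine ⟨f ⁻¹' A, pull A (s6 ▸ Set.subset_union_left) s3,
    eB ▸ pull B (s6 ▸ Set.subset_union_right) s4, meet 0 A 0 s1 (c1 0).2.2.1,
    meet 0 A m s1 (c1 0).2.2.2, eB ▸ meet 1 B 0 s2 (c1 1).2.2.1,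
    eB ▸ meet 1 B m s2 (c1 1).2.2.2, fun i hi => ?_⟩
  by_cases h : z i ∈ f ⁻¹' A
  · left
    intro v hv
    rw [Set.mem_preimage, f1 i hi v hv, ← f1 i hi _ (hz i hi)]
    exact h
  · right
    intro v hv hv'
    rw [Set.mem_preimage, f1 i hi v hv, ← f1 i hi _ (hz i hi)] at hv'
    exact h hv'

def cell (lam : V → ℕ) (L : Set V) (x : V) : Set V := {v | lam v = lam x ∧ (v ∈ L ↔ x ∈ L)}

def Kc (G : SimpleGraph V) (lam : V → ℕ) (L : Set V) (x : V) : Set V := cpt G (cell lam L x) x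

theorem mem_cell (lam : V → ℕ) (L : Set V) (x : V) : x ∈ cell lam L x := ⟨rfl, Iff.rfl⟩

theorem mem_Kc (lam : V → ℕ) (L : Set V) (x : V) : x ∈ Kc G lam L x := mem_cpt (mem_cell lam L x)

theorem Kc_cn (lam : V → ℕ) (L : Set V) (x : V) : Cn G (Kc G lam L x) := cpt_cn (mem_cell lam L x)

theorem Kc_cell {lam : V → ℕ} {L : Set V} {x y : V} (h : y ∈ Kc G lam L x) :
    y ∈ cell lam L x := cpt_sub h

theorem Kc_eq {lam : V → ℕ} {L : Set V} {x y : V} (h : y ∈ Kc G lam L x) :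
    Kc G lam L y = Kc G lam L x := by
  have hc := Kc_cell h
  have : cell lam L y = cell lam L x := by
    ext v
    unfold cell at *
    simp only [Set.mem_ofPred_eq] at *
    rw [hc.1, hc.2]
  unfold Kc
  rw [this]
  exact cpt_eq h

theorem Kc_sub {lam : V → ℕ} {L : Set V} {x : V} (hx : x ∈ L) : Kc G lam L x ⊆ L :=
  fun _ hy => (Kc_cell hy).2.2 hx

theorem Kc_compl (lam : V → ℕ) (L : Set V) (x : V) : Kc G lam Lᶜ x = Kc G lam L x := by
  have : cell lam Lᶜ x = cell lam L x := by
    ext v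
    simp only [cell, Set.mem_ofPred_eq, Set.mem_compl_iff, not_iff_not]
  unfold Kc
  rw [this]

def prs (G : SimpleGraph V) (lam : V → ℕ) (L : Set V) : Set (V × V) :=
  {p | p.2 ∈ Kc G lam L p.1}

theorem crossing {lam : V → ℕ} {m : ℕ} {L : Set V} (hL : Cn G L)
    (hl : ∀ u v, G.Adj u v → lam u ≤ lam v + 1) (h0 : ∃ x ∈ L, lam x = 0) (hm : ∃ x ∈ L, lam x = m)
    {i : ℕ} (hi : i ≤ m) : ∃ x ∈ L, lam x = i := by
  by_cases hi0 : i = 0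
  · exact hi0 ▸ h0
  obtain ⟨x, hx, hx'⟩ := h0
  obtain ⟨y, hy, hy'⟩ := hm
  obtain ⟨u, ⟨-, hu⟩, v, ⟨hv, hv'⟩, e⟩ := hL.cut (T := {x | lam x < i})
    ⟨x, hx, by simp only [Set.mem_ofPred_eq]; omega⟩ ⟨y, hy, by simp only [Set.mem_ofPred_eq]; omega⟩
  have := hl v u e.symm
  simp only [Set.mem_ofPred_eq] at hu hv'
  exact ⟨v, hv, by omega⟩

/-- each component sees the other class inside its level -/
theorem Kc_touch {K m : ℕ} {r : V} {X : Set V} {lam : V → ℕ} {Z : ℕ → Set V} {L : Set V}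
    (h : Chain G K m r X lam Z) (hL : Valid G m lam Z L) {x : V} (hx : x ∈ L) :
    ∃ u ∈ Kc G lam L x, ∃ w ∈ Lᶜ, lam w = lam u ∧ G.Adj u w := by
  obtain ⟨l1, -, l3, l4, -⟩ := h
  obtain ⟨-, h2, -, -, h5, h6, -⟩ := hL
  obtain ⟨y, hy, hy'⟩ := crossing h2 l3 h5 h6 (l1 x)
  obtain ⟨u, ⟨hu, hu'⟩, w, ⟨hw, hw'⟩, e⟩ := (l4 _ (l1 x)).cut (T := Kc G lam L x)
    ⟨x, rfl, mem_Kc lam L x⟩ ⟨y, hy', fun h => hy (Kc_sub hx h)⟩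
  simp only [Set.mem_ofPred_eq] at hu hw
  refine ⟨u, hu', w, fun hwL => hw' ?_, by rw [hu, hw], e⟩
  exact cpt_closed hu' ⟨hw, by simp [hwL, hx]⟩ e

theorem no_proper [Finite V] {K m : ℕ} {r : V} {X : Set V} {lam : V → ℕ} {Z : ℕ → Set V} {L : Set V}
    (h : Chain G K m r X lam Z) (hL : Valid G m lam Z L)
    (hmax : ∀ L', Valid G m lam Z L' → (prs G lam L').ncard ≤ (prs G lam L).ncard)
    {M : Set V} (hML : M ⊆ L) (hM : Cn G M) (hcl : ∀ x ∈ M, Kc G lam L x ⊆ M)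
    (h0 : ∃ x ∈ M, lam x = 0) (hm : ∃ x ∈ M, lam x = m) : L ⊆ M := by
  by_contra hne
  obtain ⟨x, hxL, hxM⟩ := Set.not_subset.1 hne
  have hout : ∀ y ∈ L, y ∉ M → Kc G lam L y ⊆ Mᶜ := fun y _ hyM w hw hwM =>
    hyM (hcl w hwM (Kc_eq hw ▸ mem_Kc lam L y))
  have hLM : Lᶜ ⊆ Mᶜ := Set.compl_subset_compl.2 hML
  have hMc : Cn G Mᶜ := by
    obtain ⟨q, hq⟩ := hL.2.1.nonempty
    refine cn_of_all (hLM hq) fun y hy => ?_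
    by_cases hyL : y ∈ L
    · obtain ⟨u, hu, w, hw, -, e⟩ := Kc_touch h hL hyL
      exact ⟨Lᶜ ∪ Kc G lam L y, Set.union_subset hLM (hout y hyL hy), Or.inl hq,
        Or.inr (mem_Kc lam L y), hL.2.1.union (Kc_cn lam L y) ⟨w, hw, u, hu, e.symm⟩⟩
    · exact ⟨Lᶜ, hLM, hq, hyL, hL.2.1⟩
  have hsub : ∀ x, Kc G lam L x ⊆ Kc G lam M x := by
    intro x
    refine cpt_max (fun y hy => ⟨(Kc_cell hy).1, ?_⟩) (Kc_cn lam L x)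
      ⟨x, mem_Kc lam L x, mem_Kc lam M x⟩
    by_cases hxM : x ∈ M
    · exact ⟨fun _ => hxM, fun _ => hcl x hxM hy⟩
    · refine ⟨fun hyM => absurd hyM ?_, fun h => absurd h hxM⟩
      by_cases hxL : x ∈ L
      · exact hout x hxL hxM hy
      · exact fun hyM => hxL ((Kc_cell hy).2.1 (hML hyM))
  have hval : Valid G m lam Z M := by
    obtain ⟨v1, v2, v3, v4, ⟨a, v5, v5'⟩, ⟨b, v6, v6'⟩, v7⟩ := hL
    refine ⟨hM, hMc, h0, hm, ⟨a, hLM v5, v5'⟩, ⟨b, hLM v6, v6'⟩, fun i hi => ?_⟩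
    rcases v7 i hi with hz | hz
    · obtain ⟨-, -, -, -, -, -, l7, -⟩ := h
      obtain ⟨g1, ⟨s, g2⟩, -⟩ := l7 i hi
      have hZK : Z i ⊆ Kc G lam L s := cpt_max (fun y hy => ⟨by
        rw [(g1 y hy).1, (g1 s g2.mem).1], by simp [hz hy, hz g2.mem]⟩) g2.cn
        ⟨s, g2.mem, mem_Kc lam L s⟩
      by_cases hs : s ∈ M
      · exact Or.inl (hZK.trans (hcl s hs))
      · exact Or.inr (hZK.trans (hout s (hz g2.mem) hs))
    · exact Or.inr (hz.trans hLM)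
  refine absurd (hmax M hval) (not_le.2 (Set.ncard_lt_ncard ⟨fun p hp => hsub _ hp, ?_⟩
    (Set.toFinite _)))
  intro hss
  obtain ⟨u, hu, w, hw, hl, e⟩ := Kc_touch h hL hxL
  have huM : u ∉ M := hout x hxL hxM hu
  have : w ∈ Kc G lam M u := cpt_closed (mem_Kc lam M u) ⟨hl, by simp [huM, show w ∉ M from
    hLM hw]⟩ e
  have : w ∈ Kc G lam L u := hss (a := (u, w)) this
  exact hw (Kc_sub (Kc_sub hxL hu) this)

theorem fan_of_class [Finite V] {n K m : ℕ} {r : V} {X : Set V} {lam : V → ℕ} {Z : ℕ → Set V}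
    {L : Set V} (h : Chain G K m r X lam Z) (hL : Valid G m lam Z L)
    (hmax : ∀ L', Valid G m lam Z L' → (prs G lam L').ncard ≤ (prs G lam L).ncard)
    (I : Finset ℕ) (hI : ∀ i ∈ I, i ≤ m ∧ Z i ⊆ L) (hn : n + 1 ≤ I.card) : Fan G n K := by
  classical
  obtain ⟨x0, hx0, hx0'⟩ := hL.2.2.1
  obtain ⟨xm, hxm, hxm'⟩ := hL.2.2.2.1
  let Γ : SimpleGraph (Set V) := SimpleGraph.fromRel fun A B =>
    (∃ x ∈ L, A = Kc G lam L x) ∧ (∃ x ∈ L, B = Kc G lam L x) ∧ Tch G A B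
  have hΓ : ∀ A B, Γ.Adj A B → (∃ x ∈ L, A = Kc G lam L x) ∧ Tch G A B := fun A B e => by
    obtain ⟨-, ⟨h1, h2, h3⟩ | ⟨h1, h2, h3⟩⟩ := (fromRel_adj _ _ _).1 e
    · exact ⟨h1, h3⟩
    · exact ⟨h2, h3.symm⟩
  have hre : Γ.Reachable (Kc G lam L x0) (Kc G lam L xm) := by
    by_contra hcon
    obtain ⟨u, ⟨hu, hu'⟩, w, ⟨hw, hw'⟩, e⟩ := hL.1.cut
      (T := {x | Γ.Reachable (Kc G lam L x0) (Kc G lam L x)})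
      ⟨x0, hx0, Reachable.refl _⟩ ⟨xm, hxm, hcon⟩
    apply hw'
    by_cases hK : Kc G lam L u = Kc G lam L w
    · simp only [Set.mem_ofPred_eq, ← hK]
      exact hu'
    · exact Reachable.trans hu' (Adj.reachable ((fromRel_adj _ _ _).2 ⟨hK, Or.inl ⟨⟨u, hu, rfl⟩,
        ⟨w, hw, rfl⟩, u, mem_Kc lam L u, w, mem_Kc lam L w, e⟩⟩))
  obtain ⟨p⟩ := hre
  obtain ⟨q, hq⟩ : ∃ q : Γ.Walk (Kc G lam L x0) (Kc G lam L xm), q.IsPath :=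
    ⟨p.bypass, p.bypass_isPath⟩
  let Q : ℕ → Set V := q.getVert
  have hQ : ∀ t ≤ q.length, ∃ x ∈ L, Q t = Kc G lam L x := by
    intro t ht
    rcases ht.lt_or_eq with ht | rfl
    · exact (hΓ _ _ (q.adj_getVert_succ ht)).1
    · exact ⟨xm, hxm, q.getVert_length⟩
  have hQt : ∀ t < q.length, Tch G (Q t) (Q (t + 1)) := fun t ht =>
    (hΓ _ _ (q.adj_getVert_succ ht)).2
  have hQe : ∀ t ≤ q.length, ∀ x ∈ Q t, Q t = Kc G lam L x := by
    intro t ht x hx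
    obtain ⟨y, -, e⟩ := hQ t ht
    rw [e] at hx ⊢
    exact (Kc_eq hx).symm
  have hQc : ∀ t ≤ q.length, Cn G (Q t) := fun t ht => by
    obtain ⟨y, -, e⟩ := hQ t ht
    rw [e]
    exact Kc_cn lam L y
  have hQL : ∀ t ≤ q.length, Q t ⊆ L := fun t ht => by
    obtain ⟨y, hy, e⟩ := hQ t ht
    rw [e]
    exact Kc_sub hy
  have hcov := no_proper h hL hmax (M := {x | ∃ t, 0 ≤ t ∧ t < q.length + 1 ∧ x ∈ Q t})
    (fun x ⟨t, _, ht, hx⟩ => hQL t (by omega) hx)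
    (seq_cn (by omega) (fun t _ ht => hQc t (by omega)) (fun t _ ht => hQt t (by omega)))
    (fun x ⟨t, h0, ht, hx⟩ y hy => ⟨t, h0, ht, by rwa [hQe t (by omega) x hx]⟩)
    ⟨x0, ⟨0, le_rfl, by omega, by
      have : Q 0 = _ := q.getVert_zero
      rw [this]
      exact mem_Kc lam L x0⟩, hx0'⟩
    ⟨xm, ⟨q.length, by omega, by omega, by
      have : Q q.length = _ := q.getVert_length
      rw [this]
      exact mem_Kc lam L xm⟩, hxm'⟩
  have hJ : ∀ i, ∃ t, i ∈ I → t ≤ q.length ∧ Z i ⊆ Q t := by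
    intro i
    by_cases hi : i ∈ I
    · obtain ⟨-, -, -, -, -, -, l7, -⟩ := h
      obtain ⟨g1, ⟨s, g2⟩, -⟩ := l7 i (hI i hi).1
      have hz := (hI i hi).2
      obtain ⟨t, -, ht, hs⟩ := hcov (hz g2.mem)
      refine ⟨t, fun _ => ⟨by omega, ?_⟩⟩
      rw [hQe t (by omega) s hs]
      exact cpt_max (fun y hy => ⟨by rw [(g1 y hy).1, (g1 s g2.mem).1], by
        simp [hz hy, hz g2.mem]⟩) g2.cn ⟨s, g2.mem, mem_Kc lam L s⟩
    · exact ⟨0, fun h => absurd h hi⟩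
  choose t ht using hJ
  refine fan_of_seq (l := q.length) (B := Lᶜ) (Q := Q) hL.2.1 (fun t ht => ⟨hQc t ht,
    disjoint_compl_left.mono_right (hQL t ht), ?_⟩) hQt ?_ (I.image t) ?_ ?_
  · obtain ⟨y, hy, e⟩ := hQ t ht
    rw [e]
    obtain ⟨u, hu, w, hw, -, e⟩ := Kc_touch h hL hy
    exact ⟨u, hu, w, hw, e⟩
  · intro a ha b hb hab
    refine Set.disjoint_left.2 fun x hxa hxb => hab (hq.getVert_injOn ha hb ?_)
    exact (hQe a ha x hxa).trans (hQe b hb x hxb).symm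
  · intro s hs
    rw [Finset.mem_image] at hs
    obtain ⟨i, hi, rfl⟩ := hs
    obtain ⟨h1, h2⟩ := ht i hi
    obtain ⟨-, -, -, -, -, -, l7, -⟩ := h
    exact ⟨h1, (l7 i (hI i hi).1).2.1.mono h2 (hQc _ h1)⟩
  · rwa [Finset.card_image_of_injOn]
    intro i hi j hj e
    obtain ⟨-, -, -, -, -, -, l7, -⟩ := h
    obtain ⟨g1, ⟨s, g2⟩, -⟩ := l7 i (hI i hi).1
    obtain ⟨g1', ⟨s', g2'⟩, -⟩ := l7 j (hI j hj).1
    have a1 := (ht i hi).2 g2.mem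
    have a2 := (ht j hj).2 g2'.mem
    rw [← e, hQe _ (ht i hi).1 s a1] at a2
    rw [← (g1 s g2.mem).1, ← (g1' s' g2'.mem).1, (Kc_cell a2).1]

theorem two_connected_fan (n K : ℕ) : ∃ N, ∀ (V : Type) [Fintype V] (G : SimpleGraph V),
    IsKConnected 2 G → (∃ r X, Rk G N r X) → Fan G n K := by
  classical
  refine ⟨K + 1 + (2 * n + 1) * (n + 1) + 1, fun V _ G hG ⟨r, X, h⟩ => ?_⟩
  have hc1 : ∀ x, Cn G ({x}ᶜ : Set V) := fun x => by
    have := hG.2 {x} (by simp)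
    rwa [Finset.coe_singleton] at this
  have hc : Cn G (Set.univ : Set V) := by
    have := hG.2 ∅ (by simp)
    rwa [Finset.coe_empty, Set.compl_empty] at this
  obtain ⟨Y, X1, X2, r1, r2, rfl, d1, d2, d3, hr, hY, t1, t2, k1, k2⟩ := h
  obtain ⟨A, B, s1, s2, s3, s4, s5, s6, -⟩ := grow2 hc k1.cn
    (hY.union k2.cn (t2.mono le_rfl (by simpa using k2.mem))) (Set.subset_univ _)
    (Set.subset_univ _) (Set.disjoint_union_right.2 ⟨d1.symm, d3⟩)
  have eB : Aᶜ = B := by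
    ext v
    have h1 : v ∈ A ∪ B := s6 ▸ trivial
    exact ⟨fun h => h1.resolve_left h, fun h h' => Set.disjoint_left.1 s5 h' h⟩
  rcases chain_exists (n := n) (2 * n + 1) r1 A (k1.mono s1 s3) (eB ▸ s4)
    (eB ▸ t1.mono (Set.subset_union_left.trans s2) le_rfl) with h | ⟨lam, Z, h⟩
  · exact h
  obtain ⟨L0, hL0⟩ := valid_exists hc hc1 h
  obtain ⟨L, hL, hmax⟩ := Set.exists_max_image {L | Valid G (2 * n + 1) lam Z L}
    (fun L => (prs G lam L).ncard) (Set.toFinite _) ⟨L0, hL0⟩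
  have hp : prs G lam Lᶜ = prs G lam L := by
    unfold prs
    simp only [Kc_compl]
  let I := (Finset.range (2 * n + 2)).filter fun i => Z i ⊆ L
  let J := (Finset.range (2 * n + 2)).filter fun i => ¬ Z i ⊆ L
  have hIJ : I.card + J.card = 2 * n + 2 := by
    rw [Finset.card_filter_add_card_filter_not, Finset.card_range]
  rcases Nat.lt_or_ge n I.card with hn | hn
  · refine fan_of_class h hL hmax I (fun i hi => ?_) hn
    simp only [I, Finset.mem_filter, Finset.mem_range] at hi
    exact ⟨by omega, hi.2⟩
  · refine fan_of_class h hL.symm (by rw [hp]; exact hmax) J (fun i hi => ?_) (by omega)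
    simp only [J, Finset.mem_filter, Finset.mem_range] at hi
    exact ⟨by omega, (hL.2.2.2.2.2.2 i (by omega)).resolve_left hi.2⟩

end crossing


theorem final_aux {W : Type} [Fintype W] (H : SimpleGraph W) :
    (¬ IsMinor K4 H ∧ ¬ IsMinor K23 H ∧ ¬ IsMinor C32 H ∧ ¬ IsMinor graphA H) ↔
      ∃ g : ℕ, g ≤ 2 ∧ gProperty H g := by
  constructor
  · rintro ⟨h4, h23, hc, ha⟩
    refine ⟨2, le_rfl, ?_⟩
    rcases isEmpty_or_nonempty W with hW | hW
    · refine ⟨1, one_pos, fun V _ G _ hn => (hn ?_).elim⟩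
      exact ⟨fun _ => ∅, fun w => isEmptyElim w, fun w => isEmptyElim w,
        fun w => isEmptyElim w, fun w => isEmptyElim w⟩
    · obtain ⟨K, hK⟩ := fan_minor h4 h23 hc ha
      obtain ⟨N, hN⟩ := two_connected_fan (Nat.card W) K
      obtain ⟨p, hp⟩ := pathwidth_rank N
      refine ⟨p + 1, Nat.succ_pos p, fun V _ G hG hn => ?_⟩
      by_contra hlt
      exact hn (hK V G (hN V G hG (hp V G (by omega))))
  · rintro ⟨g, hg, h⟩
    exact part_one hg h

/-- Theorem 1.4, conjecture of Marshall and Wood. A graph `H` has no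
`K₄`, `K_{2,3}`, `C_{3,2}` or `A` minor if and only if `g(H) ≤ 2`. -/
theorem no_K4_K23_C32_A_minor_iff_g_le_two {W : Type} [Fintype W] (H : SimpleGraph W) :
    (¬ IsMinor K4 H ∧ ¬ IsMinor K23 H ∧ ¬ IsMinor C32 H ∧ ¬ IsMinor graphA H) ↔
      ∃ g : ℕ, g ≤ 2 ∧ gProperty H g := by
  exact final_aux H
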